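/- The 3D aTAM is intrinsically universal: there exists a finite tile set U of 3-dimensional tile types, a temperature τ' ∈ ℤ⁺, and computable functions ℛ (assigning to each 3D aTAM system a valid macrotile representation function) and S (assigning to each 3D aTAM system a finite seed assembly over U) such that for every 3D aTAM system 𝒯 = (T, σ, τ) there is m ∈ ℕ for which 𝒰_𝒯 = (U, S(𝒯), τ') simulates 𝒯 at scale m under ℛ(𝒯). -/

import Mathlib

open scoped Classical

noncomputable section

namespace ATAM

/-- A glue: a label (a finite string over the alphabet) together with a
nonnegative integer strength. -/
abbrev Glue : Type := String × ℕ

/-- A `d`-dimensional tile type: for each of the `d` axes, a glue on the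
positive face and a glue on the negative face (`2d` glues in total). -/
abbrev TileType (d : ℕ) : Type := Fin d → Glue × Glue

/-- Points of the integer lattice `ℤ^d`. -/
abbrev Pt (d : ℕ) : Type := Fin d → ℤ

/-- A configuration: a partial placement of tile types on `ℤ^d`. -/
abbrev Config (d : ℕ) : Type := Pt d → Option (TileType d)

variable {d : ℕ}

/-- The domain of a configuration. -/
def dom (α : Config d) : Set (Pt d) := {p | α p ≠ none}

/-- Grid-graph adjacency on `ℤ^d` (Euclidean, equivalently `ℓ¹`, distance one). -/
def adj (p q : Pt d) : Prop := (∑ i, |p i - q i|) = 1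

/-- A set of lattice points is connected in the grid graph of `ℤ^d`. -/
def ConnectedSet (S : Set (Pt d)) : Prop :=
  ∀ p ∈ S, ∀ q ∈ S,
    Relation.ReflTransGen (fun a b => adj a b ∧ a ∈ S ∧ b ∈ S) p q

/-- The strength with which a tile of type `t` at `p` and a tile of type `t'`
at `q` interact: nonzero only if `p` and `q` are adjacent and the abutting
glues are equal (in label and strength) with positive strength. -/
def bond (t t' : TileType d) (p q : Pt d) : ℕ :=
  ∑ i : Fin d,
    ((if q = Function.update p i (p i + 1) ∧ (t i).1 = (t' i).2 ∧ 0 < (t i).1.2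
        then (t i).1.2 else 0) +
     (if p = Function.update q i (q i + 1) ∧ (t i).2 = (t' i).1 ∧ 0 < (t i).2.2
        then (t i).2.2 else 0))

/-- The strength of the bond between positions `p` and `q` in configuration `α`. -/
def bondAt (α : Config d) (p q : Pt d) : ℕ :=
  match α p, α q with
  | some t, some t' => bond t t' p q
  | _, _ => 0

/-- `α` is `τ`-stable: every cut of its binding graph has weight at least `τ`. -/
def Stable (τ : ℕ) (α : Config d) : Prop :=
  ∀ A B : Set (Pt d), A.Nonempty → B.Nonempty → Disjoint A B → A ∪ B = dom α →
    ∃ F : Finset (Pt d × Pt d),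
      (∀ e ∈ F, e.1 ∈ A ∧ e.2 ∈ B) ∧ τ ≤ ∑ e ∈ F, bondAt α e.1 e.2

/-- `β` extends `α`, i.e. `α` is a subassembly of `β` (`α ⊑ β`). -/
def Extends (α β : Config d) : Prop := ∀ p t, α p = some t → β p = some t

/-- A `d`-dimensional tile assembly system `(T, σ, τ)`: a finite tile set, a
finite `τ`-stable seed assembly over the tile set, and a temperature `τ ≥ 1`. -/
structure TAS (d : ℕ) where
  tileset : Finset (TileType d)
  seed : Config d
  temp : ℕ
  temp_pos : 0 < temp
  seed_nonempty : (dom seed).Nonempty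
  seed_connected : ConnectedSet (dom seed)
  seed_finite : (dom seed).Finite
  seed_tiles : ∀ p t, seed p = some t → t ∈ tileset
  seed_stable : Stable temp seed

/-- One step of the (unrestricted) aTAM: a single tile of the tile set
`τ`-stably attaches at an empty location. -/
def Attach (T : TAS d) (α β : Config d) : Prop :=
  ∃ p t, p ∉ dom α ∧ t ∈ T.tileset ∧
    β = Function.update α p (some t) ∧ Stable T.temp β

/-- `q` lies outside the minimal bounding box of `α`. -/
def OutsideBBox (α : Config d) (q : Pt d) : Prop :=
  ∃ i : Fin d, (∀ p ∈ dom α, q i < p i) ∨ (∀ p ∈ dom α, p i < q i)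

/-- There is a diffusion path for `p` with respect to `α`: a path in the grid
graph of `ℤ^d` from `p` to a point outside the minimal bounding box of `α`,
none of whose points lies in `dom α`. -/
def HasDiffusionPath (α : Config d) (p : Pt d) : Prop :=
  ∃ (k : ℕ) (x : ℕ → Pt d), x 0 = p ∧ (∀ j < k, adj (x j) (x (j + 1))) ∧
    (∀ j ≤ k, x j ∉ dom α) ∧ OutsideBBox α (x k)

/-- One step of the diffusion-restricted aTAM: additionally the attachment
location must admit a diffusion path. -/
def AttachD (T : TAS d) (α β : Config d) : Prop :=
  ∃ p t, p ∉ dom α ∧ t ∈ T.tileset ∧ HasDiffusionPath α p ∧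
    β = Function.update α p (some t) ∧ Stable T.temp β

/-- A (possibly stuttering) chain of single-tile attachment steps with respect
to the attachment relation `A`. -/
def Chain (A : Config d → Config d → Prop) (f : ℕ → Config d) : Prop :=
  ∀ n, f n = f (n + 1) ∨ A (f n) (f (n + 1))

/-- `β` is the (limiting) result of the sequence `f`. -/
def Limit (f : ℕ → Config d) (β : Config d) : Prop :=
  ∀ p t, β p = some t ↔ ∃ n, f n p = some t

/-- `β` is producible from `α` by zero or more (possibly infinitely many)
single-tile attachment steps, with respect to the attachment relation `A`. -/
def ProducesFrom (A : Config d → Config d → Prop) (α β : Config d) : Prop :=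
  ∃ f : ℕ → Config d, f 0 = α ∧ Chain A f ∧ Limit f β

/-- `α` admits no attachment step: it is terminal. -/
def Terminal (A : Config d → Config d → Prop) (α : Config d) : Prop :=
  ∀ β, ¬ A α β

/-- The system with seed `σ` and attachment relation `A` is directed: it has
exactly one producible terminal assembly. -/
def DirectedSys (A : Config d → Config d → Prop) (σ : Config d) : Prop :=
  ∃! α, ProducesFrom A σ α ∧ Terminal A α

/-- The `m`-block macrotile of `α` at block position `x`. -/
def mblock (m : ℕ) (α : Config d) (x : Pt d) : Config d :=
  fun y => if ∀ i, 0 ≤ y i ∧ y i < (m : ℤ) then α (fun i => (m : ℤ) * x i + y i) else none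

/-- A (partial) macrotile representation function. -/
abbrev RepFn (d : ℕ) : Type := Config d → Option (TileType d)

/-- `R` is a valid macrotile representation function into the tile set `Tset`:
it is monotone with respect to the subassembly relation on macrotiles, and its
values are tile types of `Tset`. -/
def ValidRep (Tset : Finset (TileType d)) (R : RepFn d) : Prop :=
  (∀ γ γ', Extends γ γ' → ∀ t, R γ = some t → R γ' = some t) ∧
  (∀ γ t, R γ = some t → t ∈ Tset)

/-- The induced assembly representation function `R*`. -/
def repStar (R : RepFn d) (m : ℕ) (α' : Config d) : Config d :=
  fun x => R (mblock m α' x)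

/-- Block position `x` holds a nonempty `m`-block of `α'`. -/
def NonemptyBlock (m : ℕ) (α' : Config d) (x : Pt d) : Prop :=
  ∃ y, mblock m α' x y ≠ none

/-- `α'` maps cleanly to `R*(α')`: every nonempty block position lies in the
domain of `R*(α')` or is (non-diagonally) adjacent to a point of that domain,
or `α'` has at most one nonempty block. -/
def MapsCleanly (R : RepFn d) (m : ℕ) (α' : Config d) : Prop :=
  (∀ x, NonemptyBlock m α' x →
      repStar R m α' x ≠ none ∨ ∃ u, adj x u ∧ repStar R m α' u ≠ none) ∨
  (∃ x₀, ∀ x, NonemptyBlock m α' x → x = x₀)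

/-- The system with attachment relation `A_S` and seed `σ_S` simulates the
system with attachment relation `A_T` and seed `σ_T` at scale `m` under the
representation function `R`: they have equivalent productions, the simulated
system follows the simulator, and the simulator models the simulated system. -/
structure SimulatesVia (A_T : Config d → Config d → Prop) (σ_T : Config d)
    (A_S : Config d → Config d → Prop) (σ_S : Config d)
    (R : RepFn d) (m : ℕ) : Prop where
  /-- `{R*(α') : α' ∈ 𝒜[𝒮]} = 𝒜[𝒯]` -/
  prod_eq : ∀ α, ProducesFrom A_T σ_T α ↔
      ∃ α', ProducesFrom A_S σ_S α' ∧ repStar R m α' = α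
  /-- `{R*(α') : α' ∈ 𝒜□[𝒮]} = 𝒜□[𝒯]` -/
  term_eq : ∀ α, (ProducesFrom A_T σ_T α ∧ Terminal A_T α) ↔
      ∃ α', (ProducesFrom A_S σ_S α' ∧ Terminal A_S α') ∧ repStar R m α' = α
  /-- every producible assembly of the simulator maps cleanly -/
  clean : ∀ α', ProducesFrom A_S σ_S α' → MapsCleanly R m α'
  /-- `𝒯` follows `𝒮` -/
  follows : ∀ α' β', ProducesFrom A_S σ_S α' → ProducesFrom A_S σ_S β' →
      ProducesFrom A_S α' β' →
      ProducesFrom A_T (repStar R m α') (repStar R m β')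
  /-- `𝒮` models `𝒯` -/
  models : ∀ α, ProducesFrom A_T σ_T α → ∃ Ps : Set (Config d),
      (∀ α' ∈ Ps, ProducesFrom A_S σ_S α' ∧ repStar R m α' = α) ∧
      ∀ β, ProducesFrom A_T σ_T β → ProducesFrom A_T α β →
        (∀ α' ∈ Ps, ∃ β', ProducesFrom A_S α' β' ∧ repStar R m β' = β) ∧
        (∀ α'' β', ProducesFrom A_S σ_S α'' → repStar R m α'' = α →
            ProducesFrom A_S α'' β' → repStar R m β' = β →
            ∃ α' ∈ Ps, ProducesFrom A_S α' α'')

/-- `US` simulates `T` at scale `m` under `R`, both with the standard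
(unrestricted) aTAM dynamics. -/
def Simulates (US T : TAS d) (R : RepFn d) (m : ℕ) : Prop :=
  SimulatesVia (Attach T) T.seed (Attach US) US.seed R m

/-- `US` simulates `T` at scale `m` under `R`, both with the
diffusion-restricted dynamics. -/
def SimulatesD (US T : TAS d) (R : RepFn d) (m : ℕ) : Prop :=
  SimulatesVia (AttachD T) T.seed (AttachD US) US.seed R m

end ATAM

open ATAM

namespace IU

abbrev P3 := Pt 3
abbrev Dir := Fin 3 × Bool

def sg (b : Bool) : ℤ := if b then 1 else -1

def nb (p : P3) (f : Dir) : P3 := Function.update p f.1 (p f.1 + sg f.2)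

def opp (f : Dir) : Dir := (f.1, !f.2)

theorem opp_opp (f : Dir) : opp (opp f) = f := by simp [opp]

theorem nb_nb (p : P3) (f : Dir) : nb (nb p f) (opp f) = p := by
  funext i
  by_cases h : i = f.1
  · subst h; cases hb : f.2 <;> simp [nb, opp, sg, hb]
  · simp [nb, opp, h]

theorem nb_nb' (p : P3) (f : Dir) : nb (nb p (opp f)) f = p := by
  have := nb_nb p (opp f); rwa [opp_opp] at this

theorem nb_apply (p : P3) (f : Dir) (i : Fin 3) :
    nb p f i = p i + if i = f.1 then sg f.2 else 0 := by
  by_cases h : i = f.1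
  · subst h; simp [nb]
  · simp [nb, h]

theorem nb_inj {p : P3} {f g : Dir} (h : nb p f = nb p g) : f = g := by
  obtain ⟨a, s⟩ := f
  obtain ⟨b, t⟩ := g
  have h1 := congrFun h a
  rw [nb_apply, nb_apply] at h1
  by_cases hab : a = b
  · subst hab
    cases s <;> cases t <;> simp [sg] at h1 ⊢
  · simp [hab] at h1
    cases s <;> simp [sg] at h1

theorem nb_ne (p : P3) (f : Dir) : nb p f ≠ p := by
  intro h
  have := congrFun h f.1
  rw [nb_apply] at this
  cases hb : f.2 <;> simp [sg, hb] at this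

def face (t : TileType 3) (f : Dir) : Glue := if f.2 then (t f.1).1 else (t f.1).2

def gb (t t' : TileType 3) (f : Dir) : ℕ := if face t f = face t' (opp f) then (face t f).2 else 0

theorem gb_symm (t t' : TileType 3) (f : Dir) : gb t t' f = gb t' t (opp f) := by
  unfold gb
  rw [opp_opp]
  by_cases h : face t f = face t' (opp f)
  · simp [h]
  · rw [if_neg h, if_neg (fun h' => h h'.symm)]

theorem bond_eq (t t' : TileType 3) (p q : P3) :
    bond t t' p q = ∑ f : Dir, if q = nb p f then gb t t' f else 0 := by
  have e : ∀ i : Fin 3, (p = Function.update q i (q i + 1)) ↔ q = nb p (i, false) := by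
    intro i
    constructor
    · intro h; have := nb_nb q (i, true); simp only [opp] at this
      rw [show nb q (i, true) = p by rw [h]; simp [nb, sg]] at this
      exact this.symm
    · intro h; have := nb_nb p (i, false); rw [← h] at this
      simpa [nb, opp, sg] using this.symm
  rw [Fintype.sum_prod_type]
  unfold bond
  refine Finset.sum_congr rfl (fun i _ => ?_)
  rw [Fintype.sum_bool]
  have h1 : ∀ (c : Prop) [Decidable c] (g g' : Glue), (if c ∧ g = g' ∧ 0 < g.2 then g.2 else 0)
      = if c then (if g = g' then g.2 else 0) else 0 := by
    intro c _ g g'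
    by_cases hc : c <;> by_cases hg : g = g' <;> simp [hc, hg]
    intro h0; omega
  rw [h1, h1]
  simp only [e i]
  simp [gb, face, opp, nb, sg]

theorem bond_nb (t t' : TileType 3) (p : P3) (f : Dir) : bond t t' p (nb p f) = gb t t' f := by
  rw [bond_eq, Finset.sum_eq_single f]
  · simp
  · intro g _ hg; rw [if_neg]; intro h; exact hg (nb_inj h).symm
  · simp

theorem bond_symm (t t' : TileType 3) (p q : P3) : bond t t' p q = bond t' t q p := by
  unfold bond
  refine Finset.sum_congr rfl (fun i _ => ?_)
  rw [add_comm]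
  congr 1
  · by_cases h : (t i).2 = (t' i).1
    · simp [h]
    · rw [if_neg (fun h' => h h'.2.1), if_neg (fun h' => h h'.2.1.symm)]
  · by_cases h : (t i).1 = (t' i).2
    · simp [h]
    · rw [if_neg (fun h' => h h'.2.1), if_neg (fun h' => h h'.2.1.symm)]

theorem bondAt_symm (α : Config 3) (p q : P3) : bondAt α p q = bondAt α q p := by
  unfold bondAt
  cases α p <;> cases α q <;> simp [bond_symm]

/-- bond of a tile of type `t` at `p` with the neighbour in direction `f` -/
def lb (α : Config 3) (p : P3) (t : TileType 3) (f : Dir) : ℕ :=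
  match α (nb p f) with
  | none => 0
  | some t' => gb t t' f

def lsum (α : Config 3) (p : P3) (t : TileType 3) : ℕ := ∑ f : Dir, lb α p t f

theorem mem_dom {α : Config 3} {p : P3} : p ∈ dom α ↔ α p ≠ none := Iff.rfl
theorem not_mem_dom {α : Config 3} {p : P3} : p ∉ dom α ↔ α p = none := by
  simp [dom]

theorem lb_mono {α β : Config 3} (h : Extends α β) (p : P3) (t : TileType 3) (f : Dir) :
    lb α p t f ≤ lb β p t f := by
  unfold lb
  cases h1 : α (nb p f) with
  | none => simp
  | some t' => rw [h _ _ h1]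

theorem lsum_mono {α β : Config 3} (h : Extends α β) (p : P3) (t : TileType 3) :
    lsum α p t ≤ lsum β p t := Finset.sum_le_sum (fun f _ => lb_mono h p t f)

theorem extends_update {α : Config 3} {p : P3} (h : α p = none) (t : TileType 3) :
    Extends α (Function.update α p (some t)) := by
  intro q s hq
  have : q ≠ p := by rintro rfl; simp [h] at hq
  simp [this, hq]

theorem Ext_refl' (α : Config 3) : Extends α α := fun _ _ h => h
theorem Ext_trans' {α β γ : Config 3} (h : Extends α β) (h' : Extends β γ) : Extends α γ :=
  fun p t hp => h' p t (h p t hp)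

theorem bondAt_mono {α β : Config 3} (h : Extends α β) (p q : P3) :
    bondAt α p q ≤ bondAt β p q := by
  unfold bondAt
  cases h1 : α p with
  | none => simp
  | some t =>
    cases h2 : α q with
    | none => simp
    | some t' => rw [h _ _ h1, h _ _ h2]

theorem stable_update {τ : ℕ} {α : Config 3} (hs : Stable τ α) {p : P3} (hp : α p = none)
    {t : TileType 3} (ht : τ ≤ lsum α p t) : Stable τ (Function.update α p (some t)) := by
  set β := Function.update α p (some t) with hβ
  have hext : Extends α β := extends_update hp t
  have hdom : dom β = insert p (dom α) := by
    ext q; by_cases h : q = p <;> simp [dom, hβ, h]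
  have key : ∀ A B : Set (P3), p ∈ A → B.Nonempty → Disjoint A B → A ∪ B = dom β →
      ∃ F : Finset (P3 × P3), (∀ e ∈ F, e.1 ∈ A ∧ e.2 ∈ B) ∧ τ ≤ ∑ e ∈ F, bondAt β e.1 e.2 := by
    intro A B hpA hB hd hu
    by_cases hA : (A \ {p}).Nonempty
    · obtain ⟨F, hF, hF'⟩ := hs (A \ {p}) B hA hB (hd.mono_left Set.sdiff_subset) (by
        have : p ∉ B := fun h => Set.disjoint_left.mp hd hpA h
        ext q
        have hq := Set.ext_iff.mp hu q
        rw [hdom] at hq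
        by_cases h : q = p
        · subst h; simp [this, dom, hp]
        · simp [h] at hq ⊢; exact hq)
      refine ⟨F, fun e he => ⟨(hF e he).1.1, (hF e he).2⟩, hF'.trans ?_⟩
      exact Finset.sum_le_sum (fun e _ => bondAt_mono hext _ _)
    · have hA1 : A = {p} := by
        rw [Set.not_nonempty_iff_eq_empty, Set.sdiff_eq_empty] at hA
        exact Set.Subset.antisymm hA (by simpa using hpA)
      refine ⟨(Finset.univ.filter (fun f : Dir => α (nb p f) ≠ none)).image (fun f => (p, nb p f)), ?_, ?_⟩
      · intro e he
        simp only [Finset.mem_image, Finset.mem_filter] at he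
        obtain ⟨f, ⟨_, hf⟩, rfl⟩ := he
        refine ⟨hpA, ?_⟩
        have : nb p f ∈ dom β := by rw [hdom]; right; exact hf
        rw [← hu, hA1] at this
        rcases this with h | h
        · exact absurd h (nb_ne p f)
        · exact h
      · rw [Finset.sum_image (by
          intro f _ g _ h; exact nb_inj (Prod.ext_iff.mp h).2)]
        refine ht.trans ?_
        rw [lsum, Finset.sum_filter]
        refine Finset.sum_le_sum (fun f _ => ?_)
        unfold lb
        cases h1 : α (nb p f) with
        | none => simp
        | some t' =>
          simp only [ne_eq, reduceCtorEq, not_false_eq_true, if_true]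
          have h2 := hext _ _ h1
          have h3 : β p = some t := by simp [hβ]
          simp [bondAt, h2, h3, bond_nb]
  intro A B hA hB hd hu
  have hp' : p ∈ A ∪ B := by rw [hu, hdom]; simp
  rcases hp' with h | h
  · exact key A B h hB hd hu
  · obtain ⟨F, hF, hF'⟩ := key B A h hA hd.symm (by rw [Set.union_comm]; exact hu)
    refine ⟨F.image Prod.swap, ?_, ?_⟩
    · intro e he
      simp only [Finset.mem_image] at he
      obtain ⟨e', he', rfl⟩ := he
      exact ⟨(hF e' he').2, (hF e' he').1⟩
    · rw [Finset.sum_image (fun a _ b _ h => Prod.swap_injective h)]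
      refine hF'.trans (le_of_eq ?_)
      exact Finset.sum_congr rfl (fun e _ => bondAt_symm _ _ _)

theorem lsum_of_stable {τ : ℕ} {α : Config 3} (hne : (dom α).Nonempty) {p : P3} (hp : α p = none)
    {t : TileType 3} (hs : Stable τ (Function.update α p (some t))) : τ ≤ lsum α p t := by
  set β := Function.update α p (some t) with hβ
  obtain ⟨F, hF, hF'⟩ := hs {p} (dom α) (by simp) hne (by simpa [dom] using hp) (by
    ext q; by_cases h : q = p <;> simp [dom, hβ, h])
  refine hF'.trans ?_
  have h1 : ∀ e ∈ F, bondAt β e.1 e.2 = ∑ f : Dir, if e.2 = nb p f then lb α p t f else 0 := by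
    intro e he
    obtain ⟨h1, h2⟩ := hF e he
    obtain ⟨a, q⟩ := e
    simp only [Set.mem_singleton_iff] at h1
    subst h1
    have hqp : q ≠ a := by rintro rfl; exact h2 hp
    obtain ⟨t', ht'⟩ := Option.ne_none_iff_exists'.mp h2
    have hβp : β a = some t := by simp [hβ]
    have hβq : β q = some t' := by simp [hβ, hqp, ht']
    simp only [bondAt, hβp, hβq, bond_eq]
    refine Finset.sum_congr rfl (fun f _ => ?_)
    by_cases h : q = nb a f
    · simp only [h, if_true]
      simp only at ht'
      rw [h] at ht'
      simp [lb, ht']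
    · simp [h]
  rw [Finset.sum_congr rfl h1, Finset.sum_comm, lsum]
  refine Finset.sum_le_sum (fun f _ => ?_)
  rw [← Finset.sum_filter, Finset.sum_const, smul_eq_mul]
  have : (F.filter (fun e => e.2 = nb p f)).card ≤ 1 := by
    rw [Finset.card_le_one]
    intro a ha b hb
    simp only [Finset.mem_filter] at ha hb
    have h1 := (hF a ha.1).1
    have h2 := (hF b hb.1).1
    simp only [Set.mem_singleton_iff] at h1 h2
    exact Prod.ext (h1.trans h2.symm) (ha.2.trans hb.2.symm)
  calc _ ≤ 1 * lb α p t f := Nat.mul_le_mul_right _ this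
    _ = _ := one_mul _

/-- good configuration: nonempty and stable -/
def Good (T : TAS 3) (α : Config 3) : Prop := (dom α).Nonempty ∧ Stable T.temp α

theorem good_seed (T : TAS 3) : Good T T.seed := ⟨T.seed_nonempty, T.seed_stable⟩

theorem attach_iff {T : TAS 3} {α β : Config 3} (hg : Good T α) :
    Attach T α β ↔ ∃ p t, α p = none ∧ t ∈ T.tileset ∧ T.temp ≤ lsum α p t ∧
      β = Function.update α p (some t) := by
  constructor
  · rintro ⟨p, t, hp, ht, rfl, hs⟩
    rw [not_mem_dom] at hp
    exact ⟨p, t, hp, ht, lsum_of_stable hg.1 hp hs, rfl⟩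
  · rintro ⟨p, t, hp, ht, hl, rfl⟩
    exact ⟨p, t, not_mem_dom.mpr hp, ht, rfl, stable_update hg.2 hp hl⟩

theorem attach_ext {T : TAS 3} {α β : Config 3} (h : Attach T α β) : Extends α β := by
  obtain ⟨p, t, hp, _, rfl, _⟩ := h
  exact extends_update (not_mem_dom.mp hp) t

theorem good_mono {T : TAS 3} {α β : Config 3} (hg : Good T α) (h : Attach T α β) : Good T β := by
  refine ⟨?_, ?_⟩
  · obtain ⟨q, hq⟩ := hg.1
    obtain ⟨t, ht⟩ := Option.ne_none_iff_exists'.mp hq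
    exact ⟨q, by rw [mem_dom, attach_ext h _ _ ht]; simp⟩
  · obtain ⟨p, t, hp, _, rfl, hs⟩ := h
    exact hs

theorem chain_ext {T : TAS 3} {f : ℕ → Config 3} (hc : Chain (Attach T) f) {n m : ℕ} (h : n ≤ m) :
    Extends (f n) (f m) := by
  induction h with
  | refl => exact Ext_refl' _
  | step h ih =>
    refine Ext_trans' ih ?_
    rcases hc _ with h1 | h1
    · rw [← h1]; exact Ext_refl' _
    · exact attach_ext h1

theorem limit_ext {f : ℕ → Config 3} {β : Config 3} (hl : Limit f β) (n : ℕ) : Extends (f n) β :=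
  fun p t h => (hl p t).mpr ⟨n, h⟩

theorem produces_ext {T : TAS 3} {α β : Config 3} (h : ProducesFrom (Attach T) α β) : Extends α β := by
  obtain ⟨f, rfl, hc, hl⟩ := h
  exact limit_ext hl 0

/-- agreement with the limit on a finite set -/
theorem limit_agree {T : TAS 3} {f : ℕ → Config 3} (hc : Chain (Attach T) f) {β : Config 3}
    (hl : Limit f β) (s : Finset P3) : ∃ N, ∀ n, N ≤ n → ∀ p ∈ s, f n p = β p := by
  induction s using Finset.induction_on with
  | empty => exact ⟨0, by simp⟩
  | insert a s _ ih =>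
    obtain ⟨N, hN⟩ := ih
    have : ∃ M, ∀ n, M ≤ n → f n a = β a := by
      cases h : β a with
      | none =>
        refine ⟨0, fun n _ => ?_⟩
        cases h' : f n a with
        | none => rfl
        | some t => rw [limit_ext hl n _ _ h'] at h; simp at h
      | some t =>
        obtain ⟨M, hM⟩ := (hl a t).mp h
        exact ⟨M, fun n hn => chain_ext hc hn _ _ hM⟩
    obtain ⟨M, hM⟩ := this
    refine ⟨max N M, fun n hn p hp => ?_⟩
    rcases Finset.mem_insert.mp hp with rfl | hp
    · exact hM n (le_trans (le_max_right _ _) hn)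
    · exact hN n (le_trans (le_max_left _ _) hn) p hp

theorem chain_good {T : TAS 3} {f : ℕ → Config 3} (hc : Chain (Attach T) f) (h0 : Good T (f 0)) (n : ℕ) :
    Good T (f n) := by
  induction n with
  | zero => exact h0
  | succ n ih =>
    rcases hc n with h | h
    · rwa [← h]
    · exact good_mono ih h

theorem limit_good {T : TAS 3} {f : ℕ → Config 3} (hc : Chain (Attach T) f) (h0 : Good T (f 0))
    {β : Config 3} (hl : Limit f β) : Good T β := by
  refine ⟨?_, ?_⟩
  · obtain ⟨q, hq⟩ := h0.1
    obtain ⟨t, ht⟩ := Option.ne_none_iff_exists'.mp hq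
    exact ⟨q, by rw [mem_dom, limit_ext hl 0 _ _ ht]; simp⟩
  · intro A B ⟨a, ha⟩ ⟨b, hb⟩ hd hu
    obtain ⟨N, hN⟩ := limit_agree hc hl {a, b}
    have hN := hN N le_rfl
    have hsub : dom (f N) ⊆ dom β := by
      intro q hq
      obtain ⟨t, ht⟩ := Option.ne_none_iff_exists'.mp hq
      rw [mem_dom, limit_ext hl N _ _ ht]; simp
    have haβ : a ∈ dom (f N) := by
      rw [mem_dom, hN a (by simp), ← mem_dom, ← hu]; exact Or.inl ha
    have hbβ : b ∈ dom (f N) := by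
      rw [mem_dom, hN b (by simp), ← mem_dom, ← hu]; exact Or.inr hb
    obtain ⟨F, hF, hF'⟩ := (chain_good hc h0 N).2 (A ∩ dom (f N)) (B ∩ dom (f N)) ⟨a, ha, haβ⟩ ⟨b, hb, hbβ⟩
      (hd.mono Set.inter_subset_left Set.inter_subset_left) (by
        rw [← Set.union_inter_distrib_right, hu]; exact Set.inter_eq_right.mpr hsub)
    exact ⟨F, fun e he => ⟨(hF e he).1.1, (hF e he).2.1⟩,
      hF'.trans (Finset.sum_le_sum (fun e _ => bondAt_mono (limit_ext hl N) _ _))⟩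

theorem produces_good {T : TAS 3} {α β : Config 3} (hg : Good T α) (h : ProducesFrom (Attach T) α β) :
    Good T β := by
  obtain ⟨f, rfl, hc, hl⟩ := h
  exact limit_good hc hg hl

/-- A property preserved by steps and depending continuously on the chain passes to the limit. -/
theorem chain_ind {T : TAS 3} {f : ℕ → Config 3} (hc : Chain (Attach T) f) {I : Config 3 → Prop}
    (h0 : I (f 0)) (hs : ∀ α β, I α → Attach T α β → I β) (n : ℕ) : I (f n) := by
  induction n with
  | zero => exact h0
  | succ n ih =>
    rcases hc n with h | h
    · rwa [← h]
    · exact hs _ _ ih h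

def nbs (p : P3) : Finset P3 := insert p (Finset.univ.image (nb p))

theorem lsum_congr {α β : Config 3} {p : P3} (h : ∀ q ∈ nbs p, α q = β q) (t : TileType 3) :
    lsum α p t = lsum β p t := by
  refine Finset.sum_congr rfl (fun f _ => ?_)
  unfold lb
  rw [h (nb p f) (by simp [nbs])]

/-! ### the greedy extension -/

def gstep (T : TAS 3) (Ok : P3 → TileType 3 → Prop) (α : Config 3) (n : ℕ) : Config 3 :=
  match Encodable.decode (α := P3) (Nat.unpair n).1 with
  | none => α
  | some p =>
    if h : α p = none ∧ ∃ t ∈ T.tileset, Ok p t ∧ T.temp ≤ lsum α p t then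
      Function.update α p (some h.2.choose) else α

def gseq (T : TAS 3) (Ok : P3 → TileType 3 → Prop) (α : Config 3) : ℕ → Config 3
  | 0 => α
  | n + 1 => gstep T Ok (gseq T Ok α n) n

theorem gstep_cases (T : TAS 3) (Ok : P3 → TileType 3 → Prop) (α : Config 3) (n : ℕ) :
    gstep T Ok α n = α ∨ ∃ p t, α p = none ∧ t ∈ T.tileset ∧ Ok p t ∧ T.temp ≤ lsum α p t ∧
      gstep T Ok α n = Function.update α p (some t) := by
  unfold gstep
  cases h : Encodable.decode (α := P3) (Nat.unpair n).1 with
  | none => left; rfl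
  | some p =>
    simp only
    split_ifs with h'
    · right
      have := h'.2.choose_spec
      exact ⟨p, _, h'.1, this.1, this.2.1, this.2.2, rfl⟩
    · left; rfl

def ulim (f : ℕ → Config 3) : Config 3 := fun p =>
  if h : ∃ n, f n p ≠ none then f h.choose p else none

theorem ulim_limit {T : TAS 3} {f : ℕ → Config 3} (hc : Chain (Attach T) f) : Limit f (ulim f) := by
  intro p t
  unfold ulim
  constructor
  · intro h
    split_ifs at h with h'
    exact ⟨_, h⟩
  · rintro ⟨n, hn⟩
    have h' : ∃ n, f n p ≠ none := ⟨n, by simp [hn]⟩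
    rw [dif_pos h']
    have := h'.choose_spec
    obtain ⟨s, hs⟩ := Option.ne_none_iff_exists'.mp this
    rw [hs]
    have h1 := chain_ext hc (le_max_left n h'.choose) _ _ hn
    have h2 := chain_ext hc (le_max_right n h'.choose) _ _ hs
    rw [h1] at h2
    exact h2.symm

theorem greedy (T : TAS 3) (Ok : P3 → TileType 3 → Prop) {α : Config 3} (hg : Good T α) :
    ∃ β, ProducesFrom (Attach T) α β ∧ (∀ p t, α p = none → β p = some t → Ok p t) ∧
      ∀ p t, β p = none → t ∈ T.tileset → Ok p t → ¬ T.temp ≤ lsum β p t := by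
  set f := gseq T Ok α with hf
  have hgood : ∀ n, Good T (f n) := by
    intro n
    induction n with
    | zero => exact hg
    | succ n ih =>
      rcases gstep_cases T Ok (f n) n with h | ⟨p, t, h1, h2, h3, h4, h5⟩
      · change Good T (gstep T Ok (f n) n); rwa [h]
      · exact good_mono ih ((attach_iff ih).mpr ⟨p, t, h1, h2, h4, h5⟩)
  have hc : Chain (Attach T) f := by
    intro n
    rcases gstep_cases T Ok (f n) n with h | ⟨p, t, h1, h2, h3, h4, h5⟩
    · left; exact h.symm
    · right; exact (attach_iff (hgood n)).mpr ⟨p, t, h1, h2, h4, h5⟩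
  have hl := ulim_limit hc
  refine ⟨ulim f, ⟨f, rfl, hc, hl⟩, ?_, ?_⟩
  · intro p t hp ht
    obtain ⟨n, hn⟩ := (hl p t).mp ht
    clear ht
    induction n with
    | zero => change α p = _ at hn; rw [hp] at hn; simp at hn
    | succ n ih =>
      rcases gstep_cases T Ok (f n) n with h | ⟨p', t', h1, h2, h3, h4, h5⟩
      · change gstep T Ok (f n) n p = _ at hn; rw [h] at hn; exact ih hn
      · change gstep T Ok (f n) n p = _ at hn; rw [h5] at hn
        by_cases hpp : p = p'
        · subst hpp; simp at hn; rwa [← hn]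
        · simp [hpp] at hn; exact ih hn
  · intro p t hp ht hok hlt
    obtain ⟨N, hN⟩ := limit_agree hc hl (nbs p)
    set n := Nat.pair (Encodable.encode p) N with hn
    have hNn : N ≤ n := Nat.right_le_pair _ _
    have h1 := hN n hNn
    have h2 : f n p = none := by rw [h1 p (by simp [nbs])]; exact hp
    have h3 : f (n + 1) p = none := by rw [hN (n+1) (by omega) p (by simp [nbs])]; exact hp
    have h4 : f n p = none ∧ ∃ t ∈ T.tileset, Ok p t ∧ T.temp ≤ lsum (f n) p t :=
      ⟨h2, t, ht, hok, by rwa [lsum_congr h1]⟩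
    change gstep T Ok (f n) n p = none at h3
    unfold gstep at h3
    rw [hn, Nat.unpair_pair, Encodable.encodek] at h3
    simp only [← hn] at h3
    rw [dif_pos h4] at h3
    simp at h3

/-- `γ` is reached from `α` provided no intermediate configuration is stuck. -/
theorem reach {T : TAS 3} {α γ : Config 3} (hg : Good T α) (hαγ : Extends α γ)
    (h : ∀ δ, Extends α δ → Extends δ γ → δ ≠ γ →
      ∃ p t, δ p = none ∧ γ p = some t ∧ t ∈ T.tileset ∧ T.temp ≤ lsum δ p t) :
    ProducesFrom (Attach T) α γ := by
  obtain ⟨δ, h1, h2, h3⟩ := greedy T (fun p t => γ p = some t) hg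
  have hδ : Extends δ γ := by
    intro p t hp
    cases ha : α p with
    | none => exact h2 p t ha hp
    | some s =>
      have := produces_ext h1 _ _ ha
      rw [this] at hp
      rw [← hp]; exact hαγ _ _ ha
  by_cases he : δ = γ
  · rwa [← he]
  · obtain ⟨p, t, a, b, c, e⟩ := h δ (produces_ext h1) hδ he
    exact absurd e (h3 p t a c b)

/-- along a chain whose start is in `δ` but whose limit is not, some step adds a missing cell -/
theorem first_missing {T : TAS 3} {α β δ : Config 3} (hg : Good T α) (h : ProducesFrom (Attach T) α β)
    (h0 : Extends α δ) (hn : ¬ Extends β δ) :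
    ∃ ε p t, Extends ε δ ∧ Extends ε β ∧ ε p = none ∧ δ p ≠ some t ∧ β p = some t ∧ t ∈ T.tileset ∧
      T.temp ≤ lsum ε p t ∧ ProducesFrom (Attach T) α ε := by
  obtain ⟨f, rfl, hc, hl⟩ := h
  have : ∃ n, ¬ Extends (f n) δ := by
    by_contra hcon
    push Not at hcon
    apply hn
    intro p t hp
    obtain ⟨n, hn⟩ := (hl p t).mp hp
    exact hcon n p t hn
  have hspec := Nat.find_spec this
  have hmin := fun m => Nat.find_min this (m := m)
  set n := Nat.find this with hndef
  rcases Nat.eq_zero_or_pos n with h | h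
  · rw [h] at hspec; exact absurd h0 hspec
  · obtain ⟨m, hm⟩ : ∃ m, n = m + 1 := ⟨n - 1, by omega⟩
    have hm' := hmin m (by omega)
    push Not at hm'
    rcases hc m with he | ha
    · rw [hm, ← he] at hspec; exact absurd hm' hspec
    · have ha0 := ha
      rw [attach_iff (chain_good hc hg m)] at ha
      obtain ⟨p, t, h1, h2, h3, h4⟩ := ha
      refine ⟨f m, p, t, hm', limit_ext hl m, h1, ?_, ?_, h2, h3, ?_⟩
      · intro hd
        apply hspec
        rw [hm, h4]
        intro q s hq
        by_cases hqp : q = p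
        · subst hqp; simp at hq; rw [← hq]; exact hd
        · simp [hqp] at hq; exact hm' _ _ hq
      · apply limit_ext hl (m+1); rw [h4]; simp
      · refine ⟨fun i => f (min i m), by simp, ?_, ?_⟩
        · intro i
          change f (min i m) = f (min (i+1) m) ∨ Attach T (f (min i m)) (f (min (i+1) m))
          rcases lt_or_ge i m with hi | hi
          · rw [min_eq_left hi.le, min_eq_left (by omega)]; exact hc i
          · left; rw [min_eq_right hi, min_eq_right (by omega)]
        · intro p t
          constructor
          · intro h; exact ⟨m, by simpa using h⟩
          · rintro ⟨i, hi⟩; exact chain_ext hc (min_le_right i m) _ _ hi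

theorem ext_antisymm {α β : Config 3} (h : Extends α β) (h' : Extends β α) : α = β := by
  funext p
  cases ha : α p with
  | some t => exact (h _ _ ha).symm
  | none =>
    cases hb : β p with
    | none => rfl
    | some t => rw [h' _ _ hb] at ha; simp at ha

theorem produces_trans {T : TAS 3} {α β γ : Config 3} (hg : Good T α)
    (h1 : ProducesFrom (Attach T) α β) (h2 : ProducesFrom (Attach T) β γ) :
    ProducesFrom (Attach T) α γ := by
  refine reach hg (Ext_trans' (produces_ext h1) (produces_ext h2)) ?_
  intro δ hα hδ hne
  by_cases hβ : Extends β δ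
  · have : ¬ Extends γ δ := fun h => hne (ext_antisymm hδ h)
    obtain ⟨ε, p, t, a1, a2, a3, a4, a5, a6, a7, a8⟩ := first_missing (produces_good hg h1) h2 hβ this
    refine ⟨p, t, ?_, a5, a6, a7.trans (lsum_mono a1 _ _)⟩
    cases hd : δ p with
    | none => rfl
    | some s => have := hδ _ _ hd; rw [a5] at this; rw [hd] at a4; exact absurd this.symm a4
  · obtain ⟨ε, p, t, a1, a2, a3, a4, a5, a6, a7, a8⟩ := first_missing hg h1 hα hβ
    have a5' := produces_ext h2 _ _ a5
    refine ⟨p, t, ?_, a5', a6, a7.trans (lsum_mono a1 _ _)⟩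
    cases hd : δ p with
    | none => rfl
    | some s => have := hδ _ _ hd; rw [a5'] at this; rw [hd] at a4; exact absurd this.symm a4

theorem produces_refl {T : TAS 3} (α : Config 3) : ProducesFrom (Attach T) α α :=
  ⟨fun _ => α, rfl, fun _ => Or.inl rfl, fun _ _ => ⟨fun h => ⟨0, h⟩, fun ⟨_, h⟩ => h⟩⟩

theorem produces_step {T : TAS 3} {α β : Config 3} (h : Attach T α β) : ProducesFrom (Attach T) α β := by
  refine ⟨fun n => if n = 0 then α else β, by simp, ?_, ?_⟩
  · intro n
    by_cases hn : n = 0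
    · subst hn; right; simpa using h
    · left; simp [hn]
  · intro p t
    constructor
    · intro h; exact ⟨1, by simpa using h⟩
    · rintro ⟨n, hn⟩
      by_cases h0 : n = 0
      · subst h0; exact attach_ext h _ _ (by simpa using hn)
      · simpa [h0] using hn

/-- terminal extension -/
theorem terminal_ext {T : TAS 3} {α : Config 3} (hg : Good T α) :
    ∃ β, ProducesFrom (Attach T) α β ∧ Terminal (Attach T) β := by
  obtain ⟨β, h1, _, h3⟩ := greedy T (fun _ _ => True) hg
  refine ⟨β, h1, ?_⟩
  intro γ hγ
  obtain ⟨p, t, a, b, c, _⟩ := (attach_iff (produces_good hg h1)).mp hγ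
  exact h3 p t a b trivial c

end IU

set_option linter.unusedSectionVars false

namespace IU

theorem adj_iff (p q : P3) : adj p q ↔ ∃ f : Dir, q = nb p f := by
  unfold adj
  rw [Fin.sum_univ_three]
  constructor
  · intro h
    have key : ∃ f : Dir, ∀ i, q i = p i + if i = f.1 then sg f.2 else 0 := by
      by_cases h0 : p 0 = q 0
      · by_cases h1 : p 1 = q 1
        · by_cases h2 : p 2 < q 2
          · refine ⟨(2, true), fun i => ?_⟩
            fin_cases i <;> simp [sg] <;> grind
          · refine ⟨(2, false), fun i => ?_⟩
            fin_cases i <;> simp [sg] <;> grind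
        · by_cases h2 : p 1 < q 1
          · refine ⟨(1, true), fun i => ?_⟩
            fin_cases i <;> simp [sg] <;> grind
          · refine ⟨(1, false), fun i => ?_⟩
            fin_cases i <;> simp [sg] <;> grind
      · by_cases h2 : p 0 < q 0
        · refine ⟨(0, true), fun i => ?_⟩
          fin_cases i <;> simp [sg] <;> grind
        · refine ⟨(0, false), fun i => ?_⟩
          fin_cases i <;> simp [sg] <;> grind
    obtain ⟨f, hf⟩ := key
    refine ⟨f, funext fun i => ?_⟩
    rw [nb_apply, hf]
  · rintro ⟨⟨a, s⟩, rfl⟩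
    simp only [nb_apply]
    fin_cases a <;> cases s <;> simp [sg]

section TL

variable {Q : Type} [Finite Q] (R1 : Dir → Q → Q → Prop) (R2 : Dir → Q → Dir → Q → Q → Prop)

/-- face description: output, or (sigma?, neighbour content) -/
abbrev Spec (Q : Type) := Q × (Dir → Option (Bool × Q))

abbrev Lab (Q : Type) := (Dir × Q) ⊕ (Fin 3 × Q × Q)

theorem exists_enc (Q : Type) [Finite Q] : ∃ f : Lab Q → String, Function.Injective f := by
  obtain ⟨n, ⟨e⟩⟩ := Finite.exists_equiv_fin (Lab Q)
  refine ⟨fun x => String.ofList (List.replicate (e x).val default), ?_⟩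
  intro x y h
  have h2 := congrArg (fun s => s.toList.length) h
  simp at h2
  exact e.injective (Fin.ext h2)

def enc : Lab Q → String := (exists_enc Q).choose
theorem enc_inj : Function.Injective (enc (Q := Q)) := (exists_enc Q).choose_spec

/-- some single-input rule consumes content `q` lying in direction `f` of the new cell -/
def Str (f : Dir) (q : Q) : Prop := ∃ c, R1 f q c

def wt (q : Q) (g : Dir) : ℕ := if Str R1 (opp g) q then 2 else 1

def glue (s : Spec Q) (f : Dir) : Glue :=
  match s.2 f with
  | none => (enc (Sum.inl (f, s.1)), wt R1 s.1 f)
  | some (false, q) => (enc (Sum.inl (opp f, q)), wt R1 q (opp f))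
  | some (true, q) => (enc (Sum.inr (f.1, if f.2 then (s.1, q) else (q, s.1))), 2)

def tileOf (s : Spec Q) : TileType 3 := fun i => (glue R1 s (i, true), glue R1 s (i, false))

theorem face_tileOf (s : Spec Q) (f : Dir) : face (tileOf R1 s) f = glue R1 s f := by
  obtain ⟨a, b⟩ := f
  cases b <;> simp [face, tileOf]

theorem opp_ne (f : Dir) : opp f ≠ f := by
  intro h; have := congrArg Prod.snd h; simp [opp] at this

theorem tileOf_inj {s s' : Spec Q} (hs : ∃ f, ∀ q, s.2 f ≠ some (false, q))
    (h : tileOf R1 s = tileOf R1 s') : s = s' := by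
  have hg : ∀ f, glue R1 s f = glue R1 s' f := fun f => by
    rw [← face_tileOf, ← face_tileOf, h]
  have key : ∀ f, s.2 f = s'.2 f ∧ ((∀ q, s.2 f ≠ some (false, q)) → s.1 = s'.1) := by
    intro f
    have h1 := congrArg Prod.fst (hg f)
    unfold glue at h1
    have ho := opp_ne f
    have ho' := (opp_ne f).symm
    rcases hf : s.2 f with _ | ⟨_ | _, q⟩ <;> rcases hf' : s'.2 f with _ | ⟨_ | _, q'⟩ <;>
      simp only [hf, hf'] at h1 <;> have h1 := enc_inj h1 <;>
      simp [ho, ho'] at h1 ⊢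
    · exact h1
    · exact h1
    · split_ifs at h1 <;> simp at h1 <;> tauto
  obtain ⟨f, hf⟩ := hs
  exact Prod.ext ((key f).2 hf) (funext fun g => (key g).1)

/-- rules: output content, first input, optional second input -/
abbrev Rule (Q : Type) := Q × (Dir × Q) × Option (Dir × Q)

def IsRule (r : Rule Q) : Prop :=
  match r with
  | (c, (f, q), none) => R1 f q c
  | (c, (f, q), some (f', q')) => R2 f q f' q' c ∧ f ≠ f' ∧ ¬ Str R1 f q ∧ ¬ Str R1 f' q'

def inp (r : Rule Q) (g : Dir) : Option Q :=
  if g = r.2.1.1 then some r.2.1.2 else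
    match r.2.2 with
    | none => none
    | some (f', q') => if g = f' then some q' else none

def rspec (r : Rule Q) : Spec Q := (r.1, fun g => (inp r g).map (fun q => (false, q)))

def rtile (r : Rule Q) : TileType 3 := tileOf R1 (rspec r)

theorem rspec_out (r : Rule Q) : ∃ f, ∀ q, (rspec r).2 f ≠ some (false, q) := by
  obtain ⟨c, ⟨f, q⟩, o⟩ := r
  have : ∃ g : Dir, g ≠ f ∧ ∀ f' q', o = some (f', q') → g ≠ f' := by
    cases o with
    | none => exact ⟨opp f, opp_ne f, by simp⟩
    | some x =>
      obtain ⟨f', q'⟩ := x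
      by_contra hcon
      push Not at hcon
      have h : ∀ g, g ≠ f → g = f' := by
        intro g hg
        obtain ⟨a, b, h1, h2⟩ := hcon g hg
        simp at h1; rw [h2, h1.1]
      have a1 : ∀ g : Dir, g = f ∨ g = f' := by
        intro g; by_cases hg : g = f
        · exact Or.inl hg
        · exact Or.inr (h g hg)
      have : (Finset.univ : Finset Dir) ⊆ {f, f'} := by
        intro g _; rcases a1 g with h | h <;> simp [h]
      have h2 := Finset.card_le_card this
      have h3 : ({f, f'} : Finset Dir).card ≤ 2 := Finset.card_le_two
      have h4 : (Finset.univ : Finset Dir).card = 6 := by simp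
      omega
  obtain ⟨g, h1, h2⟩ := this
  refine ⟨g, fun q => ?_⟩
  cases o with
  | none => simp [rspec, inp, h1]
  | some x => simp [rspec, inp, h1, h2 x.1 x.2 rfl]

def sspec (s : P3 → Option Q) (p : P3) (c : Q) : Spec Q := (c, fun f => (s (nb p f)).map (fun q => (true, q)))

def seedcfg (s : P3 → Option Q) : Config 3 := fun p => (s p).map (fun c => tileOf R1 (sspec s p c))

def AllSpecs : Set (Spec Q) := {s | (∃ r, IsRule R1 R2 r ∧ s = rspec r) ∨ ∀ f q, s.2 f ≠ some (false, q)}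

def USet : Finset (TileType 3) :=
  (Set.toFinite ((tileOf R1) '' (AllSpecs R1 R2))).toFinset

theorem mem_USet {t : TileType 3} : t ∈ USet R1 R2 ↔ ∃ s ∈ AllSpecs R1 R2, tileOf R1 s = t := by
  simp [USet]

theorem seed_stable' (s : P3 → Option Q) (hc : ConnectedSet {p | s p ≠ none}) :
    Stable 2 (seedcfg R1 s) := by
  intro A B ⟨a, ha⟩ ⟨b, hb⟩ hd hu
  have hdom : dom (seedcfg R1 s) = {p | s p ≠ none} := by
    ext p; simp [dom, seedcfg]
  rw [hdom] at hu
  have hpath := hc a (by rw [← hu]; exact Or.inl ha) b (by rw [← hu]; exact Or.inr hb)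
  have : ∃ x y, adj x y ∧ x ∈ A ∧ y ∈ B := by
    by_contra hcon
    push Not at hcon
    have : ∀ y, Relation.ReflTransGen (fun x y => adj x y ∧ x ∈ {p | s p ≠ none} ∧ y ∈ {p | s p ≠ none}) a y → y ∈ A := by
      intro y hy
      induction hy with
      | refl => exact ha
      | tail _ h2 ih =>
        have h3 := h2.2.2
        rw [← hu] at h3
        rcases h3 with h3 | h3
        · exact h3
        · exact absurd h3 (hcon _ _ h2.1 ih)
    exact Set.disjoint_left.mp hd (this b hpath) hb
  obtain ⟨x, y, hxy, hx, hy⟩ := this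
  obtain ⟨f, rfl⟩ := (adj_iff _ _).mp hxy
  refine ⟨{(x, nb x f)}, by simpa using ⟨hx, hy⟩, ?_⟩
  have hx' : s x ≠ none := by have : x ∈ A ∪ B := Or.inl hx; rw [hu] at this; exact this
  have hy' : s (nb x f) ≠ none := by have : nb x f ∈ A ∪ B := Or.inr hy; rw [hu] at this; exact this
  obtain ⟨c, hc⟩ := Option.ne_none_iff_exists'.mp hx'
  obtain ⟨c', hc'⟩ := Option.ne_none_iff_exists'.mp hy'
  simp only [Finset.sum_singleton, bondAt, seedcfg, hc, hc', Option.map_some, bond_nb]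
  unfold gb
  rw [face_tileOf, face_tileOf]
  have e1 : glue R1 (sspec s x c) f = (enc (Sum.inr (f.1, if f.2 then (c, c') else (c', c))), 2) := by
    simp [glue, sspec, hc']
  have e2 : glue R1 (sspec s (nb x f) c') (opp f) = (enc (Sum.inr (f.1, if f.2 then (c, c') else (c', c))), 2) := by
    simp [glue, sspec, nb_nb, hc]
    congr 1
    obtain ⟨f1, f2⟩ := f
    cases f2 <;> simp [opp]
  rw [e1, e2]; simp

def UT (s : P3 → Option Q) (hne : ∃ p, s p ≠ none) (hc : ConnectedSet {p | s p ≠ none})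
    (hf : {p | s p ≠ none}.Finite) : TAS 3 where
  tileset := USet R1 R2
  seed := seedcfg R1 s
  temp := 2
  temp_pos := by norm_num
  seed_nonempty := by obtain ⟨p, hp⟩ := hne; exact ⟨p, by simpa [dom, seedcfg] using hp⟩
  seed_connected := by
    have hdom : dom (seedcfg R1 s) = {p | s p ≠ none} := by ext p; simp [dom, seedcfg]
    rw [hdom]; exact hc
  seed_finite := by
    have hdom : dom (seedcfg R1 s) = {p | s p ≠ none} := by ext p; simp [dom, seedcfg]
    rw [hdom]; exact hf
  seed_tiles := by
    intro p t h
    rw [mem_USet]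
    obtain ⟨c, hc, rfl⟩ := Option.map_eq_some_iff.mp h
    refine ⟨sspec s p c, Or.inr ?_, rfl⟩
    intro f q h
    simp [sspec] at h
  seed_stable := seed_stable' R1 s hc

/-- content of a tile -/
def ct (t : TileType 3) : Option Q :=
  if h : ∃ s : Spec Q, (∃ f, ∀ q, s.2 f ≠ some (false, q)) ∧ tileOf R1 s = t then some h.choose.1 else none

theorem ct_tileOf (s : Spec Q) (hs : ∃ f, ∀ q, s.2 f ≠ some (false, q)) : ct R1 (tileOf R1 s) = some s.1 := by
  have h : ∃ s' : Spec Q, (∃ f, ∀ q, s'.2 f ≠ some (false, q)) ∧ tileOf R1 s' = tileOf R1 s := ⟨s, hs, rfl⟩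
  unfold ct
  rw [dif_pos h]
  rw [tileOf_inj R1 h.choose_spec.1 h.choose_spec.2]

theorem ct_rtile (r : Rule Q) : ct R1 (rtile R1 r) = some r.1 := ct_tileOf R1 _ (rspec_out r)

def cnt (α : Config 3) (p : P3) : Option Q := (α p).bind (ct R1)

theorem ct_sspec (s : P3 → Option Q) (p : P3) (c : Q) : ct R1 (tileOf R1 (sspec s p c)) = some c :=
  ct_tileOf R1 _ ⟨(0, true), fun q => by simp [sspec]⟩

theorem cnt_seed (s : P3 → Option Q) (p : P3) : cnt R1 (seedcfg R1 s) p = s p := by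
  unfold cnt seedcfg
  cases h : s p with
  | none => simp
  | some c => simp [ct_sspec]

def Enab (α : Config 3) (p : P3) (r : Rule Q) : Prop :=
  ∀ f q, inp r f = some q → cnt R1 α (nb p f) = some q

theorem cnt_mono {α β : Config 3} (h : Extends α β) {p : P3} {q : Q} (hq : cnt R1 α p = some q) :
    cnt R1 β p = some q := by
  unfold cnt at *
  cases h1 : α p with
  | none => simp [h1] at hq
  | some t => rw [h _ _ h1]; rwa [h1] at hq

theorem Enab_mono {α β : Config 3} (h : Extends α β) {p : P3} {r : Rule Q} (hr : Enab R1 α p r) :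
    Enab R1 β p r := fun f q hq => cnt_mono R1 h (hr f q hq)

structure WF (s : P3 → Option Q) (α : Config 3) : Prop where
  seed : Extends (seedcfg R1 s) α
  rule : ∀ p t, s p = none → α p = some t → ∃ r, IsRule R1 R2 r ∧ t = rtile R1 r ∧ Enab R1 α p r

theorem wf_seed (s : P3 → Option Q) : WF R1 R2 s (seedcfg R1 s) :=
  ⟨Ext_refl' _, fun p t h1 h2 => by simp [seedcfg, h1] at h2⟩

variable {R1 R2}

theorem WF.cnt_ne {s : P3 → Option Q} {α : Config 3} (h : WF R1 R2 s α) {p : P3} (hp : α p ≠ none) :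
    ∃ q, cnt R1 α p = some q := by
  obtain ⟨t, ht⟩ := Option.ne_none_iff_exists'.mp hp
  cases hs : s p with
  | some c =>
    exact ⟨c, cnt_mono R1 h.seed (by rw [cnt_seed, hs])⟩
  | none =>
    obtain ⟨r, _, rfl, _⟩ := h.rule p t hs ht
    exact ⟨r.1, by simp [cnt, ht, ct_rtile]⟩

theorem WF.nbr {s : P3 → Option Q} {α : Config 3} (h : WF R1 R2 s α) {p : P3} (hp : α p = none) {f : Dir}
    {t : TileType 3} (ht : α (nb p f) = some t) :
    ∃ c, cnt R1 α (nb p f) = some c ∧ face t (opp f) = (enc (Sum.inl (opp f, c)), wt R1 c (opp f)) := by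
  have hsp : s p = none := by
    cases hs : s p with
    | none => rfl
    | some c =>
      have := h.seed p (tileOf R1 (sspec s p c)) (by simp [seedcfg, hs])
      rw [hp] at this; simp at this
  cases hs : s (nb p f) with
  | some c =>
    have h1 := h.seed (nb p f) (tileOf R1 (sspec s (nb p f) c)) (by simp [seedcfg, hs])
    rw [h1] at ht
    simp only [Option.some.injEq] at ht
    subst ht
    refine ⟨c, by simp [cnt, h1, ct_sspec], ?_⟩
    rw [face_tileOf]
    simp [glue, sspec, nb_nb, hsp]
  | none =>
    obtain ⟨r, _, rfl, h3⟩ := h.rule _ _ hs ht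
    refine ⟨r.1, by simp [cnt, ht, ct_rtile], ?_⟩
    rw [rtile, face_tileOf]
    have : inp r (opp f) = none := by
      cases hi : inp r (opp f) with
      | none => rfl
      | some q =>
        have := h3 _ _ hi
        rw [nb_nb] at this
        simp [cnt, hp] at this
    simp [glue, rspec, this]

theorem WF.lb_eq {s : P3 → Option Q} {α : Config 3} (h : WF R1 R2 s α) {p : P3} (hp : α p = none) (f : Dir)
    (sp : Spec Q) :
    lb α p (tileOf R1 sp) f =
      if ∃ q, sp.2 f = some (false, q) ∧ cnt R1 α (nb p f) = some q ∧ Str R1 f q then 2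
      else if ∃ q, sp.2 f = some (false, q) ∧ cnt R1 α (nb p f) = some q then 1 else 0 := by
  unfold lb
  cases ht : α (nb p f) with
  | none =>
    have : cnt R1 α (nb p f) = none := by simp [cnt, ht]
    simp [this]
  | some t =>
    obtain ⟨c, hc, hface⟩ := h.nbr hp ht
    simp only [gb, hface, face_tileOf, hc]
    have ho := (opp_ne f).symm
    unfold glue
    rcases hf : sp.2 f with _ | ⟨_ | _, q⟩
    · have : enc (Sum.inl (f, sp.1) : Lab Q) ≠ enc (Sum.inl (opp f, c)) := by
        intro h; have := enc_inj h; simp [ho] at this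
      simp [this]
    · by_cases hqc : q = c
      · subst hqc
        simp [wt, opp_opp]
      · have : enc (Sum.inl (opp f, q) : Lab Q) ≠ enc (Sum.inl (opp f, c)) := by
          intro h; have := enc_inj h; simp [hqc] at this
        have hqc' : ¬ c = q := fun h => hqc h.symm
        simp [this, hqc']
    · have : ∀ x, enc (Sum.inr x : Lab Q) ≠ enc (Sum.inl (opp f, c)) := by
        intro x h; have := enc_inj h; simp at this
      simp [this]

theorem WF.lsum_seed {s : P3 → Option Q} {α : Config 3} (h : WF R1 R2 s α) {p : P3} (hp : α p = none)
    {sp : Spec Q} (hsp : ∀ f q, sp.2 f ≠ some (false, q)) : lsum α p (tileOf R1 sp) = 0 := by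
  refine Finset.sum_eq_zero (fun f _ => ?_)
  rw [h.lb_eq hp, if_neg, if_neg]
  · rintro ⟨q, h1, _⟩; exact hsp f q h1
  · rintro ⟨q, h1, _⟩; exact hsp f q h1

theorem WF.lsum_rule {s : P3 → Option Q} {α : Config 3} (h : WF R1 R2 s α) {p : P3} (hp : α p = none)
    {r : Rule Q} (hr : IsRule R1 R2 r) : 2 ≤ lsum α p (rtile R1 r) ↔ Enab R1 α p r := by
  obtain ⟨c, ⟨f, q⟩, o⟩ := r
  unfold lsum rtile
  cases o with
  | none =>
    have hi : ∀ g q', inp (c, (f, q), none) g = some q' ↔ g = f ∧ q' = q := by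
      intro g q'; simp [inp]; tauto
    rw [Finset.sum_eq_single f]
    · rw [h.lb_eq hp]
      have hstr : Str R1 f q := ⟨c, hr⟩
      constructor
      · intro h2
        by_cases hc : cnt R1 α (nb p f) = some q
        · intro g q' hg
          obtain ⟨rfl, rfl⟩ := (hi g q').mp hg
          exact hc
        · exfalso
          rw [if_neg, if_neg] at h2
          · omega
          · rintro ⟨q', h3, h4⟩
            simp [rspec, inp] at h3; rw [← h3] at h4; exact hc h4
          · rintro ⟨q', h3, h4, _⟩
            simp [rspec, inp] at h3; rw [← h3] at h4; exact hc h4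
      · intro he
        rw [if_pos]
        exact ⟨q, by simp [rspec, inp], he f q (by simp [inp]), hstr⟩
    · intro g _ hg
      rw [h.lb_eq hp]
      simp [rspec, inp, hg]
    · simp
  | some x =>
    obtain ⟨f', q'⟩ := x
    obtain ⟨_, hff, hs1, hs2⟩ := hr
    have hff' : f' ≠ f := fun h => hff h.symm
    have e : ∀ g, lb α p (tileOf R1 (rspec (c, (f, q), some (f', q')))) g =
        (if g = f ∧ cnt R1 α (nb p f) = some q then 1 else 0) +
        (if g = f' ∧ cnt R1 α (nb p f') = some q' then 1 else 0) := by
      intro g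
      rw [h.lb_eq hp]
      by_cases h1 : g = f
      · subst h1
        have : ∀ y, (rspec (c, (g, q), some (f', q'))).2 g = some (false, y) ↔ q = y := by
          intro y; simp [rspec, inp]
        simp only [this]
        by_cases hc : cnt R1 α (nb p g) = some q <;> simp [hc, hs1, hff]
      · by_cases h2 : g = f'
        · subst h2
          have : ∀ y, (rspec (c, (f, q), some (g, q'))).2 g = some (false, y) ↔ q' = y := by
            intro y; simp [rspec, inp, h1]
          simp only [this]
          by_cases hc : cnt R1 α (nb p g) = some q' <;> simp [hc, hs2, h1]
        · simp [rspec, inp, h1, h2]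
    simp only [e, Finset.sum_add_distrib]
    have e2 : ∀ (g : Dir) (P : Prop) [Decidable P], (∑ x : Dir, if x = g ∧ P then 1 else 0) = if P then 1 else 0 := by
      intro g P _
      by_cases hP : P <;> simp [hP]
    rw [e2, e2]
    constructor
    · intro h2
      have hc1 : cnt R1 α (nb p f) = some q := by
        by_contra hcon; rw [if_neg hcon] at h2; split_ifs at h2 <;> omega
      have hc2 : cnt R1 α (nb p f') = some q' := by
        by_contra hcon; rw [if_neg hcon] at h2; split_ifs at h2 <;> omega
      intro g y hy
      unfold inp at hy
      by_cases h1 : g = f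
      · subst h1; simp at hy; rw [← hy]; exact hc1
      · by_cases h2 : g = f'
        · subst h2; simp [h1] at hy; rw [← hy]; exact hc2
        · simp [h1, h2] at hy
    · intro he
      rw [if_pos (he f q (by simp [inp])), if_pos (he f' q' (by simp [inp, hff']))]

theorem WF.step {s : P3 → Option Q} {α : Config 3} (h : WF R1 R2 s α) {p : P3} (hp : α p = none)
    {r : Rule Q} (hr : IsRule R1 R2 r) (he : Enab R1 α p r) :
    WF R1 R2 s (Function.update α p (some (rtile R1 r))) := by
  have hx := extends_update hp (rtile R1 r)
  refine ⟨Ext_trans' h.seed hx, ?_⟩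
  intro q t hs hq
  by_cases hqp : q = p
  · subst hqp
    simp at hq
    exact ⟨r, hr, hq.symm, Enab_mono R1 hx he⟩
  · simp [hqp] at hq
    obtain ⟨r', h1, h2, h3⟩ := h.rule q t hs hq
    exact ⟨r', h1, h2, Enab_mono R1 hx h3⟩

/-- what attachment means for the universal system -/
theorem WF.attachable {s : P3 → Option Q} {α : Config 3} (h : WF R1 R2 s α) {p : P3} (hp : α p = none)
    {t : TileType 3} : (t ∈ USet R1 R2 ∧ 2 ≤ lsum α p t) ↔ ∃ r, IsRule R1 R2 r ∧ Enab R1 α p r ∧ t = rtile R1 r := by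
  constructor
  · rintro ⟨ht, hl⟩
    obtain ⟨sp, hsp, rfl⟩ := (mem_USet R1 R2).mp ht
    rcases hsp with ⟨r, hr, rfl⟩ | hsp
    · exact ⟨r, hr, (h.lsum_rule hp hr).mp hl, rfl⟩
    · rw [h.lsum_seed hp hsp] at hl; omega
  · rintro ⟨r, hr, he, rfl⟩
    exact ⟨(mem_USet R1 R2).mpr ⟨rspec r, Or.inl ⟨r, hr, rfl⟩, rfl⟩, (h.lsum_rule hp hr).mpr he⟩

theorem WF.limit {s : P3 → Option Q} {f : ℕ → Config 3} {β : Config 3} (h : ∀ n, WF R1 R2 s (f n))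
    (hl : Limit f β) : WF R1 R2 s β := by
  refine ⟨Ext_trans' (h 0).seed (limit_ext hl 0), ?_⟩
  intro p t hs hp
  obtain ⟨n, hn⟩ := (hl p t).mp hp
  obtain ⟨r, h1, h2, h3⟩ := (h n).rule p t hs hn
  exact ⟨r, h1, h2, Enab_mono R1 (limit_ext hl n) h3⟩

end TL
end IU

namespace IU

/-! ### Tables -/

abbrev Row := ℕ × ℕ × ℕ × ℕ × List (ℕ × ℕ × ℕ)

def tabL : List Row :=
  [(13, 13, 8, 0, [(1, 1, 9)]), (13, 13, 9, 0, [(1, 1, 10), (2, 1, 0)]),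
    (13, 13, 10, 0, [(1, 1, 11), (2, 1, 1)]), (13, 13, 11, 0, [(1, 1, 12), (2, 1, 2)]),
    (13, 13, 12, 0, [(1, 1, 13), (2, 1, 3)]), (13, 13, 13, 0, [(1, 1, 14), (2, 1, 4)]),
    (13, 14, 13, 0, [(1, 1, 5)]), (13, 13, 14, 0, []), (13, 14, 14, 0, [(2, 1, 6)]),
    (13, 12, 16, 0, [(1, 1, 65)]), (13, 20, 9, 0, [(1, 1, 32)]), (5, 12, 10, 0, [(1, 1, 56)]),
    (21, 12, 11, 0, [(1, 1, 44)]), (13, 4, 12, 0, [(1, 1, 78)]), (13, 12, 5, 0, [(1, 1, 28)]),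
    (13, 15, 14, 0, [(1, 1, 8)]), (13, 15, 13, 0, [(2, 0, 15)]), (13, 15, 12, 0, [(2, 0, 16)]),
    (13, 15, 11, 0, [(2, 0, 17)]), (13, 15, 10, 0, [(2, 0, 18)]), (13, 15, 9, 0, [(2, 0, 19)]),
    (13, 15, 8, 0, [(2, 0, 20)]), (13, 15, 7, 0, [(2, 0, 21)]), (13, 14, 7, 0, [(1, 0, 22)]),
    (13, 13, 7, 2, [(1, 0, 23)]), (13, 12, 7, 2, [(1, 0, 24)]), (13, 11, 7, 0, [(1, 0, 25)]),
    (13, 11, 6, 0, [(2, 0, 26)]), (13, 11, 5, 0, [(2, 0, 27)]), (13, 16, 9, 0, [(1, 1, 20)]),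
    (13, 17, 9, 2, [(1, 1, 29)]), (13, 18, 9, 0, [(1, 1, 30)]), (13, 19, 9, 0, [(1, 1, 31)]),
    (13, 14, 11, 2, [(1, 0, 18)]), (14, 14, 11, 2, [(0, 1, 33)]), (15, 14, 11, 2, [(0, 1, 34)]),
    (16, 14, 11, 2, [(0, 1, 35)]), (16, 13, 11, 2, [(1, 0, 36)]), (16, 12, 11, 2, [(1, 0, 37)]),
    (17, 12, 11, 2, [(0, 1, 38)]), (18, 12, 11, 2, [(0, 1, 39)]), (19, 12, 11, 2, [(0, 1, 40)]),
    (20, 12, 11, 2, [(0, 1, 41)]), (20, 11, 11, 2, [(1, 0, 42)]), (21, 11, 11, 2, [(0, 1, 43)]),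
    (13, 14, 10, 2, [(1, 0, 19)]), (12, 14, 10, 2, [(0, 0, 45)]), (12, 13, 10, 2, [(1, 0, 46)]),
    (11, 13, 10, 2, [(0, 0, 47)]), (10, 13, 10, 2, [(0, 0, 48)]), (10, 12, 10, 2, [(1, 0, 49)]),
    (9, 12, 10, 2, [(0, 0, 50)]), (8, 12, 10, 2, [(0, 0, 51)]), (8, 11, 10, 2, [(1, 0, 52)]),
    (7, 11, 10, 2, [(0, 0, 53)]), (6, 11, 10, 2, [(0, 0, 54)]), (5, 11, 10, 2, [(0, 0, 55)]),
    (14, 13, 11, 0, [(1, 0, 34)]), (14, 13, 12, 0, [(2, 1, 57)]), (14, 13, 13, 0, [(2, 1, 58)]),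
    (14, 13, 14, 0, [(2, 1, 59)]), (14, 13, 15, 0, [(2, 1, 60)]), (14, 13, 16, 0, [(2, 1, 61)]),
    (14, 12, 16, 0, [(1, 0, 62)]), (14, 11, 16, 2, [(1, 0, 63)]), (13, 11, 16, 2, [(0, 0, 64)]),
    (12, 12, 10, 0, [(1, 0, 47)]), (12, 11, 10, 2, [(1, 0, 66)]), (12, 10, 10, 0, [(1, 0, 67)]),
    (12, 10, 11, 0, [(2, 1, 68)]), (12, 9, 11, 0, [(1, 0, 69)]), (12, 8, 11, 2, [(1, 0, 70)]),
    (12, 7, 11, 0, [(1, 0, 71)]), (12, 6, 11, 0, [(1, 0, 72)]), (12, 6, 12, 0, [(2, 1, 73)]),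
    (12, 5, 12, 0, [(1, 0, 74)]), (12, 4, 12, 0, [(1, 0, 75)]), (12, 3, 12, 2, [(1, 0, 76)]),
    (13, 3, 12, 2, [(0, 1, 77)])]

def dirL : List (ℕ × ℕ) :=
  [(2, 0), (1, 0), (0, 1), (0, 0), (1, 1), (2, 1)]

abbrev Kind := Fin 79

def row (k : ℕ) : Row := tabL.getD k (0, 0, 0, 0, [])
def co (r : Row) (i : ℕ) : ℕ := match i with
  | 0 => r.1
  | 1 => r.2.1
  | _ => r.2.2.1
def shp (k' k i : ℕ) : ℕ :=
  match Nat.blt k 6 && Nat.ble 9 k' && dirL.getD k (0, 0) == (i, 1) with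
  | true => 1
  | false => 0
def shn (k' k i : ℕ) : ℕ :=
  match Nat.blt k 6 && Nat.ble 9 k' && dirL.getD k (0, 0) == (i, 0) with
  | true => 1
  | false => 0
def bn (b : Bool) : ℕ := match b with
  | true => 1
  | false => 0
def imp (a b : Bool) : Bool := !a || b

theorem ble_f {a b : ℕ} : Nat.ble a b = false ↔ b < a := by
  rw [← not_iff_not, Bool.not_eq_false, Nat.ble_eq]; omega
theorem shp_dock {k' : ℕ} (h : 9 ≤ k') (k i : ℕ) : shp k' k i = shp 9 k i := by
  unfold shp; rw [Nat.ble_eq.mpr h]; rfl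
theorem shn_dock {k' : ℕ} (h : 9 ≤ k') (k i : ℕ) : shn k' k i = shn 9 k i := by
  unfold shn; rw [Nat.ble_eq.mpr h]; rfl

def chkEnt (k : ℕ) (r : Row) (x : ℕ × ℕ × ℕ) : Bool :=
  let r' := row x.2.2
  let ge (i : ℕ) := co r i + 8 * shn x.2.2 k i + bn (i == x.1 && x.2.1 == 0) ==
    8 * shp x.2.2 k i + co r' i + bn (i == x.1 && x.2.1 == 1)
  ge 0 && ge 1 && ge 2 && Nat.blt x.1 3 && Nat.blt x.2.1 2 && Nat.blt x.2.2 79 &&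
  !(x.1 == r.2.2.2.1) && !(x.1 == r'.2.2.2.1) &&
  imp (Nat.ble 9 k) (Nat.ble 8 x.2.2) && imp (k == 8) (x == (2, 1, 6)) && !(k == 7) &&
  imp (k == 6) (x == (1, 1, 5)) &&
  imp (Nat.blt k 6) (x == (2, 1, k - 1) && !(k == 0) || x == (1, 1, k + 9)) &&
  imp (Nat.ble 9 k) ((co r' 0 / 8 == 1 && co r' 1 / 8 == 1 && co r' 2 / 8 == 1) ||
    (co r' 0 / 8 == co r 0 / 8 && co r' 1 / 8 == co r 1 / 8 && co r' 2 / 8 == co r 2 / 8))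

def chkRow (k : ℕ) (r : Row) : Bool :=
  (r.2.2.2.2).all (chkEnt k r) && (r.2.2.2.1 == 0 || r.2.2.2.1 == 2) &&
  imp (Nat.blt k 15) (r.2.2.2.1 == 0) &&
  imp (Nat.ble k 8) (co r 0 / 8 == 1 && co r 1 / 8 == 1 && co r 2 / 8 == 1) &&
  [(1, 1, 1), (0, 1, 1), (2, 1, 1), (1, 0, 1), (1, 2, 1), (1, 1, 0), (1, 1, 2)].contains
    (co r 0 / 8, co r 1 / 8, co r 2 / 8) &&
  imp (Nat.ble 9 k) (!(r.2.2.2.2).isEmpty) &&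
  imp (Nat.blt k 6) ((r.2.2.2.2).contains (1, 1, k + 9) &&
    [0, 1, 2].all fun i => co (row (k + 9)) i / 8 + shp 9 k i == 1 + shn 9 k i) &&
  imp (Nat.blt 0 k && Nat.blt k 6) ((r.2.2.2.2).contains (2, 1, k - 1)) &&
  imp (k == 6) ((r.2.2.2.2).contains (1, 1, 5)) && imp (k == 8) ((r.2.2.2.2).contains (2, 1, 6))

def allI (f : ℕ → Row → Bool) : ℕ → List Row → Bool
  | _, [] => true
  | n, r :: l => f n r && allI f (n + 1) l

theorem allI_get (f : ℕ → Row → Bool) : ∀ (n : ℕ) (l : List Row), allI f n l = true →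
    ∀ i (h : i < l.length), f (n + i) l[i] = true
  | _, [], _, i, h => by simp at h
  | n, r :: l, hl, 0, _ => by simp [allI] at hl; simpa using hl.1
  | n, r :: l, hl, i + 1, h => by
    simp [allI] at hl
    have := allI_get f (n + 1) l hl.2 i (by simpa using h)
    simpa [Nat.add_assoc, Nat.add_comm 1 i] using this

def allNe : List ℕ → Bool
  | [] => true
  | a :: l => (l.all fun b => !(Nat.beq a b)) && allNe l

theorem allNe_nodup : ∀ l : List ℕ, allNe l = true → l.Nodup
  | [], _ => List.nodup_nil
  | a :: l, h => by
    simp only [allNe, Bool.and_eq_true, List.all_eq_true] at h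
    refine List.nodup_cons.mpr ⟨fun hm => ?_, allNe_nodup l h.2⟩
    have := h.1 a hm
    simp at this

def code (r : Row) : ℕ := r.1 % 8 + 8 * (r.2.1 % 8) + 64 * (r.2.2.1 % 8)

set_option maxRecDepth 100000 in
theorem tab_chk : allI chkRow 0 tabL = true := by decide +kernel
set_option maxRecDepth 100000 in
theorem tab_ne : allNe (tabL.map code) = true := by decide +kernel
theorem tab_len : tabL.length = 79 := by decide +kernel

theorem row_chk (k : Kind) : chkRow k.val (row k.val) = true := by
  have h := allI_get chkRow 0 tabL tab_chk k.val (by rw [tab_len]; exact k.2)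
  have hk : k.val < tabL.length := by rw [tab_len]; exact k.2
  have e : row k.val = tabL[k.val] := by
    unfold row; rw [List.getD_eq_getElem]
  rw [e]; simpa using h

def rho (k : Kind) (i : Fin 3) : ℤ := (co (row k.val) i.val : ℤ) - 8
def pas (k : Kind) : Fin 3 := Fin.ofNat 3 (row k.val).2.2.2.1
def Ent (t : Fin 3) (e : Bool) (k' k : Kind) : Prop :=
  (t.val, bn e, k'.val) ∈ (row k.val).2.2.2.2
def dirOf (d : Fin 6) : Dir :=
  (Fin.ofNat 3 (dirL.getD d.val (0, 0)).1, (dirL.getD d.val (0, 0)).2 == 1)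
def bus (d : Fin 6) : Kind := ⟨d.val, by omega⟩
def dock (d : Fin 6) : Kind := ⟨9 + d.val, by omega⟩
def hom (k : Kind) (i : Fin 3) : ℤ := rho k i / 8
def trunk : Kind := 8
def branch : Kind := 6
def chip : Kind := 7

/-- the block displacement of the predecessor square -/
def shv (k' k : Kind) (i : Fin 3) : ℤ := shp k'.val k.val i.val - shn k'.val k.val i.val

theorem tab_mod {k k' : Kind} (h : ∀ i, rho k i % 8 = rho k' i % 8) : k = k' := by
  have hn := allNe_nodup _ tab_ne
  have hk : k.val < (tabL.map code).length := by rw [List.length_map, tab_len]; exact k.2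
  have hk' : k'.val < (tabL.map code).length := by rw [List.length_map, tab_len]; exact k'.2
  have e : ∀ (j : Kind) (hj : j.val < (tabL.map code).length), (tabL.map code)[j.val] = code (row j.val) := by
    intro j hj
    rw [List.getElem_map, row, List.getD_eq_getElem]
  apply Fin.ext
  apply (List.Nodup.getElem_inj_iff hn (hi := hk) (hj := hk')).mp
  rw [e _ hk, e _ hk']
  have h0 := h 0
  have h1 := h 1
  have h2 := h 2
  simp only [rho, co, Fin.val_zero, Fin.val_one, Fin.val_two] at h0 h1 h2
  unfold code
  omega

theorem bn_eq (b : Bool) : bn b = if b then 1 else 0 := by cases b <;> rfl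

theorem tab_geo {t e k' k} (h : Ent t e k' k) (i : Fin 3) :
    rho k i = 8 * shv k' k i + rho k' i + if i = t then sg e else 0 := by
  have := row_chk k
  simp only [chkRow, Bool.and_eq_true, List.all_eq_true] at this
  obtain ⟨⟨⟨⟨⟨⟨⟨⟨⟨h1, -⟩, -⟩, -⟩, -⟩, -⟩, -⟩, -⟩, -⟩, -⟩ := this
  have := h1 _ h
  simp only [chkEnt, Bool.and_eq_true] at this
  obtain ⟨⟨⟨⟨⟨⟨⟨⟨⟨⟨⟨⟨⟨g0, g1⟩, g2⟩, -⟩, -⟩, -⟩, -⟩, -⟩, -⟩, -⟩, -⟩, -⟩, -⟩, -⟩ := this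
  simp only [beq_iff_eq] at g0 g1 g2
  unfold rho shv
  fin_cases i <;> fin_cases t <;> cases e <;> simp [bn, sg] at g0 g1 g2 ⊢ <;> omega

theorem tab_pas (k : Kind) : pas k = 0 ∨ pas k = 2 := by
  have := row_chk k
  simp only [chkRow, Bool.and_eq_true, Bool.or_eq_true, beq_iff_eq] at this
  obtain ⟨⟨⟨⟨⟨⟨⟨⟨⟨-, h1⟩, -⟩, -⟩, -⟩, -⟩, -⟩, -⟩, -⟩, -⟩ := this
  unfold pas
  rcases h1 with h | h <;> rw [h] <;> simp

theorem tab_pas0 {k : Kind} (hk : k.val < 15) : pas k = 0 := by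
  have := row_chk k
  simp only [chkRow, Bool.and_eq_true, imp, Bool.or_eq_true, beq_iff_eq, Bool.not_eq_true'] at this
  obtain ⟨⟨⟨⟨⟨⟨⟨⟨⟨-, -⟩, h1⟩, -⟩, -⟩, -⟩, -⟩, -⟩, -⟩, -⟩ := this
  unfold pas
  rcases h1 with h | h
  · simp only [Nat.blt, ble_f] at h; omega
  · rw [h]; simp

theorem pas_val (k : Kind) : (pas k).val = (row k.val).2.2.2.1 := by
  have := row_chk k
  simp only [chkRow, Bool.and_eq_true, Bool.or_eq_true, beq_iff_eq] at this
  obtain ⟨⟨⟨⟨⟨⟨⟨⟨⟨-, h1⟩, -⟩, -⟩, -⟩, -⟩, -⟩, -⟩, -⟩, -⟩ := this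
  unfold pas
  rcases h1 with h | h <;> rw [h] <;> simp

structure EntFacts (t : Fin 3) (e : Bool) (k' k : Kind) : Prop where
  pas : t ≠ pas k
  pas' : t ≠ IU.pas k'
  tree : 9 ≤ k.val → 8 ≤ k'.val
  trunk : k = trunk → t = 2 ∧ e = true ∧ k' = branch
  chip : k ≠ chip
  branch : k = branch → t = 1 ∧ e = true ∧ k' = 5
  bus : k.val < 6 → e = true ∧ ((t = 2 ∧ k'.val + 1 = k.val) ∨ (t = 1 ∧ k'.val = k.val + 9))
  hom : 9 ≤ k.val → (∀ i, hom k' i = 0) ∨ (∀ i, IU.hom k' i = IU.hom k i)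

theorem hom_val (k : Kind) (i : Fin 3) : hom k i = ((co (row k.val) i.val / 8 : ℕ) : ℤ) - 1 := by
  unfold hom rho; omega

theorem all3 {P : Fin 3 → Prop} (h0 : P 0) (h1 : P 1) (h2 : P 2) : ∀ i, P i := by
  intro i; fin_cases i <;> assumption

theorem tab_ent {t e k' k} (h : Ent t e k' k) : EntFacts t e k' k := by
  have := row_chk k
  simp only [chkRow, Bool.and_eq_true, List.all_eq_true] at this
  obtain ⟨⟨⟨⟨⟨⟨⟨⟨⟨h1, -⟩, -⟩, -⟩, -⟩, -⟩, -⟩, -⟩, -⟩, -⟩ := this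
  have := h1 _ h
  simp only [chkEnt, Bool.and_eq_true, imp, Bool.or_eq_true, Bool.not_eq_true', beq_eq_false_iff_ne, beq_iff_eq, Prod.mk.injEq] at this
  obtain ⟨⟨⟨⟨⟨⟨⟨⟨⟨⟨⟨⟨⟨-, -⟩, -⟩, -⟩, -⟩, -⟩, p1⟩, p2⟩, c1⟩, c2⟩, c3⟩, c4⟩, c5⟩, c6⟩ := this
  have hb : bn e = 1 → e = true := by cases e <;> simp [bn]
  simp only [Nat.blt, ble_f, Nat.ble_eq] at c1 c5 c6
  refine ⟨?_, ?_, ?_, ?_, ?_, ?_, ?_, ?_⟩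
  · intro h; exact p1 (by rw [h, pas_val])
  · intro h; exact p2 (by rw [h, pas_val])
  · intro h; omega
  · intro h; subst h
    have := c2.resolve_left (by simp [trunk])
    exact ⟨Fin.ext this.1, hb this.2.1, Fin.ext this.2.2⟩
  · intro h; subst h; simp [chip] at c3
  · intro h; subst h
    have := c4.resolve_left (by simp [branch])
    exact ⟨Fin.ext this.1, hb this.2.1, Fin.ext this.2.2⟩
  · intro h
    rcases c5 with c5 | ⟨⟨c, c', c''⟩, c5⟩ | ⟨c, c', c''⟩
    · omega
    · exact ⟨hb c', Or.inl ⟨Fin.ext c, by omega⟩⟩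
    · exact ⟨hb c', Or.inr ⟨Fin.ext c, by omega⟩⟩
  · intro h
    rcases c6 with c | c | c
    · omega
    · left; apply all3 <;> rw [hom_val] <;> simp <;> omega
    · right; apply all3 <;> rw [hom_val, hom_val] <;> simp <;> omega

theorem tab_hom0 {k : Kind} (hk : k.val ≤ 8) : ∀ i, hom k i = 0 := by
  have := row_chk k
  simp only [chkRow, Bool.and_eq_true, imp, Bool.or_eq_true, beq_iff_eq, Bool.not_eq_true'] at this
  obtain ⟨⟨⟨⟨⟨⟨⟨⟨⟨-, -⟩, -⟩, h1⟩, -⟩, -⟩, -⟩, -⟩, -⟩, -⟩ := this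
  rcases h1 with h | h
  · simp only [ble_f] at h; omega
  · apply all3 <;> rw [hom_val] <;> simp <;> omega

theorem tab_hom (k : Kind) : (∀ i, hom k i = 0) ∨ ∃ f : Dir, ∀ i, hom k i = if i = f.1 then sg f.2 else 0 := by
  have := row_chk k
  simp only [chkRow, Bool.and_eq_true] at this
  obtain ⟨⟨⟨⟨⟨⟨⟨⟨⟨-, -⟩, -⟩, -⟩, h⟩, -⟩, -⟩, -⟩, -⟩, -⟩ := this
  simp only [List.contains_iff_mem, List.mem_cons, Prod.mk.injEq, List.not_mem_nil, or_false] at h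
  rcases h with h | h | h | h | h | h | h
  · left; apply all3 <;> rw [hom_val] <;> simp <;> omega
  · right; refine ⟨(0, false), ?_⟩; apply all3 <;> rw [hom_val] <;> simp [sg] <;> omega
  · right; refine ⟨(0, true), ?_⟩; apply all3 <;> rw [hom_val] <;> simp [sg] <;> omega
  · right; refine ⟨(1, false), ?_⟩; apply all3 <;> rw [hom_val] <;> simp [sg] <;> omega
  · right; refine ⟨(1, true), ?_⟩; apply all3 <;> rw [hom_val] <;> simp [sg] <;> omega
  · right; refine ⟨(2, false), ?_⟩; apply all3 <;> rw [hom_val] <;> simp [sg] <;> omega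
  · right; refine ⟨(2, true), ?_⟩; apply all3 <;> rw [hom_val] <;> simp [sg] <;> omega

theorem ent_of {k : Kind} {x : ℕ × ℕ × ℕ} (hx : x ∈ (row k.val).2.2.2.2) :
    ∃ t e k', Ent t e k' k ∧ t.val = x.1 ∧ bn e = x.2.1 ∧ k'.val = x.2.2 := by
  have := row_chk k
  simp only [chkRow, Bool.and_eq_true, List.all_eq_true] at this
  obtain ⟨⟨⟨⟨⟨⟨⟨⟨⟨h1, -⟩, -⟩, -⟩, -⟩, -⟩, -⟩, -⟩, -⟩, -⟩ := this
  have := h1 _ hx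
  simp only [chkEnt, Bool.and_eq_true, Nat.blt, Nat.ble_eq] at this
  obtain ⟨⟨⟨⟨⟨⟨⟨⟨⟨⟨⟨⟨⟨-, -⟩, -⟩, a⟩, b⟩, c⟩, -⟩, -⟩, -⟩, -⟩, -⟩, -⟩, -⟩, -⟩ := this
  obtain ⟨t, s, k'⟩ := x
  have hs : bn (s == 1) = s := by
    have : s = 0 ∨ s = 1 := by simp at b; omega
    rcases this with rfl | rfl <;> rfl
  exact ⟨⟨t, a⟩, s == 1, ⟨k', c⟩, by unfold Ent; rw [hs]; exact hx, rfl, hs, rfl⟩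

theorem tab_ex {k : Kind} (hk : 9 ≤ k.val) : ∃ t e k', Ent t e k' k := by
  have := row_chk k
  simp only [chkRow, Bool.and_eq_true, imp, Bool.or_eq_true, Bool.not_eq_true'] at this
  obtain ⟨⟨⟨⟨⟨⟨⟨⟨⟨-, -⟩, -⟩, -⟩, -⟩, h1⟩, -⟩, -⟩, -⟩, -⟩ := this
  rcases h1 with h | h
  · simp only [ble_f] at h; omega
  · obtain ⟨x, hx⟩ := List.exists_mem_of_ne_nil (row k.val).2.2.2.2 (by intro h'; rw [h'] at h; simp at h)
    obtain ⟨t, e, k', h, -⟩ := ent_of hx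
    exact ⟨t, e, k', h⟩

theorem tab_dock (d : Fin 6) : Ent 1 true (dock d) (bus d) ∧ ∀ i, hom (dock d) i = - shv (dock d) (bus d) i := by
  have := row_chk (bus d)
  simp only [chkRow, Bool.and_eq_true, imp, Bool.or_eq_true, Bool.not_eq_true'] at this
  obtain ⟨⟨⟨⟨⟨⟨⟨⟨⟨-, -⟩, -⟩, -⟩, -⟩, -⟩, h1⟩, -⟩, -⟩, -⟩ := this
  rcases h1 with h | ⟨h1, h2⟩
  · simp only [Nat.blt, ble_f, bus] at h; omega
  · refine ⟨?_, ?_⟩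
    · unfold Ent
      rw [List.contains_iff_mem] at h1
      simpa [bus, dock, bn, Nat.add_comm] using h1
    · intro i
      rw [List.all_eq_true] at h2
      have h3 := h2 i.val (by fin_cases i <;> simp)
      rw [hom_val]
      simp only [beq_iff_eq] at h3
      have e : (dock d).val = (bus d).val + 9 := by simp [dock, bus]; omega
      have e1 : shp (dock d).val (bus d).val i.val = shp 9 (bus d).val i.val := shp_dock (by simp [dock]) _ _
      have e2 : shn (dock d).val (bus d).val i.val = shn 9 (bus d).val i.val := shn_dock (by simp [dock]) _ _
      unfold shv
      rw [e1, e2, e]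
      omega

theorem tab_bus {d d' : Fin 6} (h : d.val + 1 = d'.val) : Ent 2 true (bus d) (bus d') := by
  have := row_chk (bus d')
  simp only [chkRow, Bool.and_eq_true, imp, Bool.or_eq_true, Bool.not_eq_true'] at this
  obtain ⟨⟨⟨⟨⟨⟨⟨⟨⟨-, -⟩, -⟩, -⟩, -⟩, -⟩, -⟩, h1⟩, -⟩, -⟩ := this
  rcases h1 with h1 | h1
  · simp only [Nat.blt, bus, Bool.and_eq_false_iff, ble_f] at h1; omega
  · unfold Ent
    rw [List.contains_iff_mem] at h1
    have : d.val = d'.val - 1 := by omega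
    simpa [bus, bn, this] using h1

theorem tab_branch : Ent 1 true (bus 5) branch := by
  have := row_chk branch
  simp only [chkRow, Bool.and_eq_true, imp, Bool.or_eq_true, Bool.not_eq_true'] at this
  have h1 := this.1.2
  rcases h1 with h1 | h1
  · simp [branch] at h1
  · rw [List.contains_iff_mem] at h1; exact h1

theorem tab_trunk : Ent 2 true branch trunk := by
  have := row_chk trunk
  simp only [chkRow, Bool.and_eq_true, imp, Bool.or_eq_true, Bool.not_eq_true'] at this
  have h1 := this.2
  rcases h1 with h1 | h1
  · simp [trunk] at h1
  · rw [List.contains_iff_mem] at h1; exact h1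

theorem tab_dir : (∀ d d', (dirOf d).1 = (dirOf d').1 → (dirOf d).2 = (dirOf d').2 → d = d') ∧
    ∀ (a : Fin 3) (s : Bool), ∃ d, (dirOf d).1 = a ∧ (dirOf d).2 = s := by decide +kernel

theorem dirOf_inj {d d'} (h : dirOf d = dirOf d') : d = d' := tab_dir.1 d d' (by rw [h]) (by rw [h])
theorem dirOf_surj (f : Dir) : ∃ d, dirOf d = f := by
  obtain ⟨d, h1, h2⟩ := tab_dir.2 f.1 f.2
  exact ⟨d, Prod.ext h1 h2⟩

theorem shv_bus (d : Fin 6) (i : Fin 3) : shv (dock d) (bus d) i = if i = (dirOf d).1 then sg (dirOf d).2 else 0 := by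
  have e1 : shp (dock d).val (bus d).val i.val = shp 9 (bus d).val i.val := shp_dock (by simp [dock]) _ _
  have e2 : shn (dock d).val (bus d).val i.val = shn 9 (bus d).val i.val := shn_dock (by simp [dock]) _ _
  unfold shv; rw [e1, e2]
  revert d i
  have : ∀ d i, ((shp 9 (bus d).val i.val : ℤ) - shn 9 (bus d).val i.val) = if i = (dirOf d).1 then (if (dirOf d).2 then 1 else -1) else 0 := by
    decide +kernel
  intro d i _ _; rw [this]; rfl

theorem shv_zero {k' k : Kind} (h : k.val < 6 → k'.val < 9) (i : Fin 3) : shv k' k i = 0 := by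
  have : (Nat.blt k.val 6 && Nat.ble 9 k'.val) = false := by
    by_contra hc
    simp [Nat.blt] at hc
    have := h (by omega); omega
  simp [shv, shp, shn, this]

end IU

namespace IU

/-! ### Contents and rules -/

structure Sym where
  M : Fin 6 → Bool
  D : Fin 6 → Bool
  r : Fin 6 → Bool
  dg : Bool
  uo : Bool
  xf : Bool
  xl : Bool
  xp : Bool
  vf : Bool
  vl : Bool

instance : Inhabited Sym :=
  ⟨⟨fun _ => false, fun _ => false, fun _ => false, false, false, false, false, false, false, false⟩⟩

instance : Finite Sym := Finite.of_injective
  (fun s : Sym => (s.M, s.D, s.r, s.dg, s.uo, s.xf, s.xl, s.xp, s.vf, s.vl)) (by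
    rintro ⟨⟩ ⟨⟩ h
    simp only [Prod.mk.injEq] at h
    simp only [Sym.mk.injEq]; exact h)

abbrev Dif := Set.Icc (-2 : ℤ) 2

def cl (z : ℤ) : Dif := ⟨max (-2) (min z 2), by simp⟩

theorem cl_val (z : ℤ) : (cl z).1 = max (-2) (min z 2) := rfl
theorem cl_eq {y z : ℤ} (hz : |z| ≤ 1) (h : cl y = cl z) : y = z := by
  have := congrArg Subtype.val h
  rw [cl_val, cl_val] at this
  rw [abs_le] at hz
  omega
theorem cl_add {y s : ℤ} (hs : s = 1 ∨ s = -1) (h : 0 ≤ s * (cl y).1) : cl ((cl y).1 + s) = cl (y + s) := by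
  apply Subtype.ext
  rw [cl_val] at h ⊢
  rw [cl_val, cl_val]
  rcases hs with rfl | rfl <;> omega

inductive Q where
  | sq (k : Kind) (F : Fin 3 → Sym) (D : Fin 3 → Fin 3 → Dif)
  | tok (d : Fin 6) (top l : Bool)
  | nc (ev tk l : Bool)
  | bk (win : Bool)
  | wi
  | sel (r : Fin 6 → Bool) (fst lst : Bool)
  | selodd (lst : Bool)
  | rw (r : Fin 6 → Bool)
  | fil

abbrev QT := (Kind × (Fin 3 → Sym) × (Fin 3 → Fin 3 → Dif)) ⊕ (Fin 6 × Bool × Bool) ⊕ (Bool × Bool × Bool) ⊕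
    Bool ⊕ ((Fin 6 → Bool) × Bool × Bool) ⊕ Bool ⊕ (Fin 6 → Bool) ⊕ Bool

def qcode : Q → QT
  | .sq k F D => .inl (k, F, D)
  | .tok d a b => .inr (.inl (d, a, b))
  | .nc a b c => .inr (.inr (.inl (a, b, c)))
  | .bk a => .inr (.inr (.inr (.inl a)))
  | .sel a b c => .inr (.inr (.inr (.inr (.inl (a, b, c)))))
  | .selodd a => .inr (.inr (.inr (.inr (.inr (.inl a)))))
  | .rw a => .inr (.inr (.inr (.inr (.inr (.inr (.inl a))))))
  | .wi => .inr (.inr (.inr (.inr (.inr (.inr (.inr true))))))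
  | .fil => .inr (.inr (.inr (.inr (.inr (.inr (.inr false))))))

instance : Finite Q := Finite.of_injective qcode (by
  intro a b h
  cases a <;> cases b <;> simp only [qcode, Sum.inl.injEq, Sum.inr.injEq, Prod.mk.injEq, reduceCtorEq] at h <;>
    simp_all)

/-- the remaining axis -/
def oth (p t : Fin 3) : Fin 3 := -p - t

theorem oth_ne : ∀ {p t : Fin 3}, t ≠ p → oth p t ≠ p ∧ oth p t ≠ t ∧ ∀ a, a ≠ p → a ≠ t → a = oth p t := by
  decide
theorem oth_oth : ∀ {p t : Fin 3}, oth p (oth p t) = t := by decide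

def AtE (p : Fin 3) (e : Bool) (S : Sym) : Bool :=
  if p = 0 then (if e then S.vl else S.vf) else (if e then S.xl else S.xf)

def adjS (k : Kind) (S T : Sym) : Sym :=
  if k.val < 6 then { S with r := fun _ => false } else if k = trunk then { S with r := T.r } else S

def oddS (S : Sym) : Sym := { S with dg := false, uo := true, xf := false, xl := S.xp, xp := false }

def mkq (k : Kind) (t : Fin 3) (T S : Sym) (z : ℤ) : Q :=
  .sq k (fun a => if a = t then T else if a = oth (pas k) t then S else default)
    (fun a a' => if a = t ∧ a' = oth (pas k) t then cl z else
      if a = oth (pas k) t ∧ a' = t then cl (-z) else cl 0)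

inductive R1 : Dir → Q → Q → Prop
  | diagSame (t e k' k F D) (h : Ent t (!e) k' k) (hD : D t (oth (pas k) t) = cl (sg (!e))) :
      R1 (t, e) (.sq k F D) (mkq k t (F (oth (pas k) t)) (F (oth (pas k) t)) 0)
  | diagCross (t e k' k F D S) (h : Ent t (!e) k' k) (hk : k ≠ trunk) (hF : AtE (pas k') (!e) (F t) = true)
      (hS : S = F (oth (pas k') t)) (hE : AtE (pas k) e S = true) (hu : k.val < 6 → S.uo = false) :
      R1 (t, e) (.sq k' F D) (mkq k t (adjS k S S) (adjS k S S) 0)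
  | oddcopy (k F D) (hk : k = trunk) (h : (F 1).uo = false) :
      R1 (0, false) (.sq k F D) (.sq trunk (fun a => if a = 0 then default else oddS (F a)) D)
  | tokStart (k d F D) (hk : k = dock d) (h1 : (F 1).vl = true) (h2 : (F 2).vf = true)
      (h3 : (F 1).uo = true) (h4 : (F 1).D d = true) (h5 : ∀ d' < d, (F 1).D d' = false)
      (h6 : (F 1).r d = true) : R1 (1, false) (.sq k F D) (.tok d false (F 1).xl)
  | nPass (tk l) : R1 (0, false) (.nc true tk l) (.nc false false l)
  | nTake (d l) (hd : d = 5) : R1 (2, false) (.tok d true l) (.nc false true l)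
  | bStart (tk) : R1 (1, false) (.nc false tk true) (.bk tk)
  | selOddR (r fst lst) : R1 (0, false) (.sel r fst lst) (.selodd lst)
  | selOddL (r lst) : R1 (0, true) (.sel r false lst) (.selodd false)

inductive R2 : Dir → Q → Dir → Q → Q → Prop
  | sideSame (t e k' k s ε F D F' D') (h : Ent t (!e) k' k) (hs : s = oth (pas k) t)
      (h1 : AtE (pas k) (!e) (F t) = false) (h2 : AtE (pas k) (!ε) (F' s) = false)
      (h3 : 0 ≤ sg (!ε) * (D' t s).1) :
      R2 (t, e) (.sq k F D) (s, ε) (.sq k F' D') (mkq k t (F' t) (F s) ((D' t s).1 + sg (!ε)))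
  | sideCross (t e k' k s F D F' D' S) (h : Ent t (!e) k' k) (hs : s = oth (pas k) t)
      (h1 : AtE (pas k') (!e) (F t) = true) (hS : S = F (oth (pas k') t)) (hE : AtE (pas k) e S = false)
      (hu : k.val < 6 → S.uo = false)
      (h2 : AtE (pas k) (!e) (F' s) = false) (h4 : AtE (pas k) e (F' t) = true)
      (h3 : 0 ≤ sg (!e) * (D' t s).1) :
      R2 (t, e) (.sq k' F D) (s, e) (.sq k F' D') (mkq k t (F' t) (adjS k S (F' t)) ((D' t s).1 + sg (!e)))
  | trunkDiag (r k F D S) (hk : k = branch) (h1 : (F 2).vl = true) (h2 : (F 1).vf = true)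
      (hS : S = { F 1 with r := r }) :
      R2 (1, false) (.rw r) (2, false) (.sq k F D) (mkq trunk 2 S S 0)
  | tokMove (d l k F D) (hk : k = bus d) (h1 : (F 1).vf = true) (h2 : (F 2).vf = false) :
      R2 (2, false) (.tok d false l) (0, false) (.sq k F D) (.tok d (F 2).vl l)
  | tokSkip (d d' l k F D) (hd : d.val + 1 = d'.val) (hk : k = bus d') (h1 : (F 1).vf = true)
      (h2 : (F 2).vf = true) (h3 : (F 1).D d' = false) :
      R2 (2, false) (.tok d true l) (0, false) (.sq k F D) (.tok d' false l)
  | tokDock (d d' l k F D) (hd : d.val + 1 = d'.val) (hk : k = dock d') (h1 : (F 1).vl = true)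
      (h2 : (F 2).vf = true) (h3 : (F 1).uo = true) (h4 : (F 1).D d' = true) (h6 : (F 1).r d' = true) :
      R2 (2, false) (.tok d true l) (1, false) (.sq k F D) (.tok d' false l)
  | nEv (tk k F D) (hk : k = bus 5) (hg : (F 2).vl = true) (h1 : (F 1).vf = true) :
      R2 (0, false) (.nc false tk false) (2, false) (.sq k F D) (.nc true false (F 1).xp)
  | bMove (ev tk l) : R2 (0, true) (.bk false) (1, false) (.nc ev tk l) (.bk tk)
  | wiStart (k F D) (hk : k = bus 5) (hg : (F 2).vl = true) :
      R2 (0, true) (.bk true) (2, false) (.sq k F D) .wi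
  | wiMove (k F D) (hk : k = bus 5) (hg : (F 2).vl = true) (h1 : (F 1).dg = false) :
      R2 (1, false) .wi (2, false) (.sq k F D) .wi
  | selDiag (k F D) (hk : k = bus 5) (hg : (F 2).vl = true) (h1 : (F 1).dg = true) :
      R2 (1, false) .wi (2, false) (.sq k F D) (.sel (F 1).M (F 1).xf (F 1).xp)
  | selEvR (k F D) (hk : k = bus 5) (hg : (F 2).vl = true) :
      R2 (0, false) (.selodd false) (2, false) (.sq k F D) (.sel (F 1).M (F 1).xf (F 1).xp)
  | selEvL (l k F D) (hk : k = bus 5) (hg : (F 2).vl = true) :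
      R2 (0, true) (.selodd l) (2, false) (.sq k F D) (.sel (F 1).M (F 1).xf (F 1).xp)
  | rwStart (r fst lst k F D) (hk : k = bus 5) (hg : (F 2).vl = true) (h1 : (F 1).vf = false) :
      R2 (1, false) (.sel r fst lst) (2, false) (.sq k F D) (.rw r)
  | rwMove (r k F D) (hk : k = bus 5) (hg : (F 2).vl = true) (h1 : (F 1).vf = false) :
      R2 (1, false) (.rw r) (2, false) (.sq k F D) (.rw r)

/-! ### Worlds -/

structure World where
  N : ℤ
  hN : 2 ≤ N
  Mb : ℤ → ℤ → Fin 6 → Bool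
  Db : ℤ → Fin 6 → Bool
  D0 : ∀ d, Db 0 d = false
  sd : P3 → Option ℤ
  hsd : ∀ b e, sd b = some e → 1 ≤ e ∧ e < N ∧ ∀ d, Db e d = false

def World.K (W : World) : ℤ := 2 * W.N

variable (W : World)

def Gf (ρ : ℤ → Fin 6 → Bool) (x v : ℤ) : Sym where
  M := W.Mb (x / 2) (v / 2)
  D := W.Db (x / 2)
  r := ρ x
  dg := decide (x % 2 = 0 ∧ x = v)
  uo := decide (x % 2 = 1)
  xf := decide (x = 0)
  xl := decide (x = W.K - 1)
  xp := decide (x + 2 = W.K)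
  vf := decide (v = 0)
  vl := decide (v = W.K - 1)

def pt (b : P3) (k : Kind) (c : P3) : P3 := fun i => W.K * (8 * b i + rho k i) + c i
def In (c : P3) : Prop := ∀ i, 0 ≤ c i ∧ c i < W.K

def gs (k : Kind) (g : ℤ → ℤ → Sym) (c : P3) (a : Fin 3) : Sym :=
  if pas k = 0 then g (c 0) (c a) else g (c a) (c 2)

def mk (k : Kind) (g : ℤ → ℤ → Sym) (c : P3) : Q :=
  .sq k (fun a => if a = pas k then default else gs k g c a)
    (fun a a' => if a = pas k ∨ a' = pas k then cl 0 else cl (c a' - c a))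

def en (e : Bool) : ℤ := if e then W.K - 1 else 0

theorem atE_iff {k : Kind} {a : Fin 3} (e : Bool) (ρ : ℤ → Fin 6 → Bool) (c : P3) :
    AtE (pas k) e (gs k (Gf W ρ) c a) = true ↔ c a = en W e := by
  unfold AtE gs Gf en
  split_ifs <;> simp

theorem atE_iff' {k : Kind} {a : Fin 3} (e : Bool) (ρ : ℤ → Fin 6 → Bool) (c : P3) :
    AtE (pas k) e (gs k (Gf W ρ) c a) = false ↔ c a ≠ en W e := by
  rw [← not_iff_not, Bool.not_eq_false, atE_iff, not_not]

theorem mkq_eq {k : Kind} {t : Fin 3} (ht : t ≠ pas k) {g : ℤ → ℤ → Sym} {c : P3} {T S : Sym} {z : ℤ}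
    (hT : T = gs k g c t) (hS : S = gs k g c (oth (pas k) t)) (hz : cl z = cl (c (oth (pas k) t) - c t)) :
    mkq k t T S z = mk k g c := by
  obtain ⟨o1, o2, o3⟩ := oth_ne ht
  have hz' : cl (-z) = cl (c t - c (oth (pas k) t)) := by
    have := congrArg Subtype.val hz
    apply Subtype.ext
    rw [cl_val, cl_val] at this ⊢
    omega
  generalize hs : oth (pas k) t = s at *
  unfold mkq mk
  rw [hs]
  congr 1
  · funext a
    by_cases h1 : a = t
    · subst h1; simp [ht, hT]
    · by_cases h2 : a = s
      · subst h2; simp [h1, o1, hS]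
      · have : a = pas k := by by_contra h; exact h2 (o3 a h h1)
        subst this; simp [h1, h2]
  · funext a a'
    by_cases h1 : a = t
    · subst h1
      by_cases h2 : a' = a
      · subst h2; simp [ht, o2.symm]
      · by_cases h3 : a' = s
        · subst h3; simp [ht, o1, hz]
        · have : a' = pas k := by by_contra h; exact h3 (o3 a' h h2)
          subst this; simp [h3, o2.symm]
    · by_cases h2 : a = s
      · subst h2
        by_cases h2 : a' = a
        · subst h2; simp [o1, o2]
        · by_cases h3 : a' = t
          · subst h3; simp [ht, o1, o2, hz']
          · have : a' = pas k := by by_contra h; exact h2 (o3 a' h h3)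
            subst this; simp [h3, h1]
      · have : a = pas k := by by_contra h; exact h2 (o3 a h h1)
        subst this; simp [h1, h2]

theorem gs_congr {k : Kind} {g : ℤ → ℤ → Sym} {c c' : P3} {a a' : Fin 3} (h : c a = c' a')
    (hp : c (pas k) = c' (pas k)) : gs k g c a = gs k g c' a' := by
  unfold gs
  rcases tab_pas k with h1 | h1 <;> rw [h1] at hp ⊢ <;> simp [h, hp]

theorem oth01 : oth 0 1 = 2 := rfl
theorem oth02 : oth 0 2 = 1 := rfl
theorem oth20 : oth 2 0 = 1 := rfl
theorem oth21 : oth 2 1 = 0 := rfl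

theorem gs_cross {t e k' k} (h : Ent t e k' k) {g : ℤ → ℤ → Sym} {c c' : P3} (hc : ∀ i, i ≠ t → c' i = c i) :
    gs k' g c' (oth (pas k') t) = gs k g c (oth (pas k) t) := by
  have h1 := (tab_ent h).pas
  have h2 := (tab_ent h).pas'
  have e0 := hc 0
  have e1 := hc 1
  have e2 := hc 2
  unfold gs
  rcases tab_pas k with p | p <;> rcases tab_pas k' with p' | p' <;> rw [p] at h1 ⊢ <;> rw [p'] at h2 ⊢ <;>
    fin_cases t <;> simp [oth01, oth02, oth20, oth21] at * <;> simp [*]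

theorem K_pos : 4 ≤ W.K := by have := W.hN; unfold World.K; omega

theorem pt_inj {b b' : P3} {k k' : Kind} {c c' : P3} (h : pt W b k c = pt W b' k' c') (hc : In W c) (hc' : In W c') :
    b = b' ∧ k = k' ∧ c = c' := by
  have hK := K_pos W
  have key : ∀ i, 8 * b i + rho k i = 8 * b' i + rho k' i ∧ c i = c' i := by
    intro i
    have h1 : W.K * (8 * b i + rho k i) + c i = W.K * (8 * b' i + rho k' i) + c' i := congrFun h i
    have h2 := hc i
    have h3 := hc' i
    generalize 8 * b i + rho k i = u at *
    generalize 8 * b' i + rho k' i = v at *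
    have : u = v := by
      rcases lt_trichotomy u v with h | h | h
      · nlinarith
      · exact h
      · nlinarith
    subst this
    exact ⟨rfl, by omega⟩
  have hk : k = k' := tab_mod (fun i => by have := (key i).1; omega)
  subst hk
  exact ⟨funext fun i => by have := (key i).1; omega, rfl, funext fun i => (key i).2⟩

theorem pt_nb (b : P3) (k : Kind) (c : P3) (f : Dir) : nb (pt W b k c) f = pt W b k (nb c f) := by
  funext i
  simp only [nb_apply, pt]; ring

theorem inp_same {p b : P3} {k : Kind} {c1 : P3} {f : Dir} (h : nb p f = pt W b k c1) :
    p = pt W b k (nb c1 (opp f)) := by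
  rw [← pt_nb, ← h, nb_nb]

theorem In_nb {c1 : P3} (hc : In W c1) {t : Fin 3} {e : Bool} (h : c1 t ≠ en W (!e)) : In W (nb c1 (t, !e)) := by
  intro i
  have := hc i
  rw [nb_apply]
  by_cases hi : i = t
  · subst hi
    cases e <;> simp [en, sg] at h ⊢ <;> omega
  · simpa [hi] using this

/-- block of the successor square -/
def sub (b : P3) (k' k : Kind) : P3 := fun i => b i - shv k' k i

theorem inp_cross {p b : P3} {t e k' k} (hE : Ent t (!e) k' k) {c1 : P3} (h : nb p (t, e) = pt W b k' c1) (hc : In W c1)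
    (hend : c1 t = en W (!e)) : ∃ c, p = pt W (sub b k' k) k c ∧ In W c ∧ c t = en W e ∧ ∀ i, i ≠ t → c1 i = c i := by
  have hK := K_pos W
  refine ⟨Function.update c1 t (en W e), ?_, ?_, by simp, fun i hi => by simp [hi]⟩
  · have hp := inp_same W h
    rw [hp]
    funext i
    have hg := tab_geo hE i
    simp only [pt, nb_apply, opp, sub]
    by_cases hi : i = t
    · subst hi
      simp only [if_true] at hg ⊢
      rw [hg, hend, Function.update_self]
      cases e <;> simp [en, sg] <;> ring
    · simp only [hi, if_false, Function.update_of_ne hi, not_false_eq_true, ne_eq] at hg ⊢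
      rw [hg]; ring
  · intro i
    by_cases hi : i = t
    · subst hi; cases e <;> simp [en] <;> omega
    · simpa [hi] using hc i

def Near (w : P3 → ℤ → Prop) (b : P3) : Prop := (∃ e, w b e) ∨ ∃ d e, w (nb b (dirOf d)) e

def VU (w : P3 → ℤ → Prop) (b : P3) (h : ℤ) (d : Fin 6) : Prop :=
  (∃ d' ≤ d, W.Db h d' = true) ∧
    ∀ d' ≤ d, W.Db h d' = true → ∃ e', w (nb b (dirOf d')) e' ∧ W.Mb h e' d' = true

def Valid (w : P3 → ℤ → Prop) (b : P3) (h : ℤ) : Prop := VU W w b h 5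

def Cls (w : P3 → ℤ → Prop) (b : P3) (k : Kind) (c : P3) (ρ : ℤ → Fin 6 → Bool) : Prop :=
  (8 ≤ k.val ∧ ∃ e, w b e ∧ ρ = fun x => W.Mb (x / 2) e) ∨
  (k.val ≤ 6 ∧ c 0 % 2 = 0 ∧ Near w b ∧ ρ = fun _ _ => false)

def Al (w : P3 → ℤ → Prop) (p : P3) (q : Q) : Prop :=
  match q with
  | .sq k F D => ∃ b c ρ, p = pt W b k c ∧ In W c ∧ Cls W w b k c ρ ∧ Q.sq k F D = mk k (Gf W ρ) c
  | .tok d top l => ∃ b c, p = pt W b (bus d) c ∧ In W c ∧ c 0 % 2 = 1 ∧ c 1 = 0 ∧ top = decide (c 2 = W.K - 1) ∧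
      l = decide (c 0 = W.K - 1) ∧ Near w b ∧ VU W w b (c 0 / 2) d
  | .nc ev tk l => ∃ b c, p = pt W b chip c ∧ In W c ∧ c 1 = 0 ∧ c 2 = 0 ∧ ev = decide (c 0 % 2 = 0) ∧
      l = decide (W.K - 2 ≤ c 0) ∧ (tk = true → ev = false ∧ (Valid W w b (c 0 / 2) ∨ W.sd b ≠ none)) ∧ Near w b
  | .bk win => ∃ b c e, p = pt W b chip c ∧ In W c ∧ c 1 = 1 ∧ c 2 = 0 ∧ w b e ∧ 2 * e + 1 ≤ c 0 ∧
      win = decide (c 0 = 2 * e + 1)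
  | .wi => ∃ b c e, p = pt W b chip c ∧ In W c ∧ c 0 = 2 * e ∧ 1 ≤ c 1 ∧ c 1 < 2 * e ∧ c 2 = 0 ∧ w b e
  | .sel r fst lst => ∃ b c e, p = pt W b chip c ∧ In W c ∧ c 0 % 2 = 0 ∧ c 1 = 2 * e ∧ c 2 = 0 ∧ w b e ∧
      r = W.Mb (c 0 / 2) e ∧ fst = decide (c 0 = 0) ∧ lst = decide (c 0 + 2 = W.K)
  | .selodd lst => ∃ b c e, p = pt W b chip c ∧ In W c ∧ c 0 % 2 = 1 ∧ c 1 = 2 * e ∧ c 2 = 0 ∧ w b e ∧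
      lst = decide (c 0 = W.K - 1)
  | .rw r => ∃ b c e, p = pt W b chip c ∧ In W c ∧ c 0 % 2 = 0 ∧ 2 * e < c 1 ∧ c 2 = 0 ∧ w b e ∧
      r = W.Mb (c 0 / 2) e
  | .fil => ∃ b, W.sd b ≠ none ∧ ∀ i, 8 * W.K * b i ≤ p i ∧ p i < 8 * W.K * b i + 8 * W.K

end IU

namespace IU

variable (W : World)

/-! ### Soundness of the rules -/

theorem geo_chip (i : Fin 3) : rho chip i = rho (bus 5) i + if i = 2 then sg true else 0 := by
  have : ∀ i, rho chip i = rho (bus 5) i + if i = 2 then 1 else 0 := by decide +kernel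
  rw [this]; rfl
theorem geo_trunk (i : Fin 3) : rho trunk i = rho chip i + if i = 1 then sg true else 0 := by
  have : ∀ i, rho trunk i = rho chip i + if i = 1 then 1 else 0 := by decide +kernel
  rw [this]; rfl

theorem nb_cross {k' k : Kind} {t : Fin 3} {e : Bool} (s : P3)
    (hg : ∀ i, rho k i = 8 * s i + rho k' i + if i = t then sg (!e) else 0) (b c : P3) (hc : c t = en W e) :
    nb (pt W b k c) (t, e) = pt W (fun i => b i + s i) k' (Function.update c t (en W (!e))) := by
  funext i
  simp only [pt, nb_apply]
  rw [hg i]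
  by_cases hi : i = t
  · subst hi
    simp only [if_true, Function.update_self, hc]
    cases e <;> simp [en, sg] <;> ring
  · simp only [hi, if_false, Function.update_of_ne hi]
    ring

theorem nb_cross0 {k' k : Kind} {t : Fin 3} {e : Bool}
    (hg : ∀ i, rho k i = rho k' i + if i = t then sg (!e) else 0) (b c : P3) (hc : c t = en W e) :
    nb (pt W b k c) (t, e) = pt W b k' (Function.update c t (en W (!e))) := by
  have := nb_cross W (k' := k') (k := k) (t := t) (e := e) (fun _ => 0) (by simpa using hg) b c hc
  simpa using this

theorem In_upd {c : P3} (hc : In W c) (t : Fin 3) (e : Bool) : In W (Function.update c t (en W e)) := by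
  have hK := K_pos W
  intro i
  by_cases hi : i = t
  · subst hi; cases e <;> simp [en] <;> omega
  · simpa [hi] using hc i

theorem inp_cross0 {k' k : Kind} {t : Fin 3} {e : Bool}
    (hg : ∀ i, rho k i = rho k' i + if i = t then sg (!e) else 0) {p b c1 : P3}
    (h : nb p (t, e) = pt W b k' c1) (hc : In W c1) (hend : c1 t = en W (!e)) :
    ∃ c, p = pt W b k c ∧ In W c ∧ c t = en W e ∧ ∀ i, i ≠ t → c1 i = c i := by
  refine ⟨Function.update c1 t (en W e), ?_, In_upd W hc t e, by simp, fun i hi => by simp [hi]⟩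
  have h2 := nb_cross0 W hg b (Function.update c1 t (en W e)) (by simp)
  rw [← nb_nb p (t, e), h, ← nb_nb (pt W b k _) (t, e), h2]
  congr 2
  simp [hend.symm]

theorem mkF {k : Kind} {g c F D} (h : Q.sq k F D = mk k g c) {a : Fin 3} (ha : a ≠ pas k) : F a = gs k g c a := by
  unfold mk at h
  injection h with _ h2 h3
  rw [h2]; simp [ha]

theorem mkD {k : Kind} {g c F D} (h : Q.sq k F D = mk k g c) {a a' : Fin 3} (ha : a ≠ pas k) (ha' : a' ≠ pas k) :
    D a a' = cl (c a' - c a) := by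
  unfold mk at h
  injection h with _ h2 h3
  rw [h3]; simp [ha, ha']

theorem gs0 {k : Kind} (hk : k.val < 15) (g : ℤ → ℤ → Sym) (c : P3) (a : Fin 3) : gs k g c a = g (c 0) (c a) := by
  unfold gs; rw [if_pos (tab_pas0 hk)]

theorem mkF0 {k : Kind} (hk : k.val < 15) {g c F D} (h : Q.sq k F D = mk k g c) {a : Fin 3} (ha : a ≠ 0) :
    F a = g (c 0) (c a) := by
  rw [mkF h (by rw [tab_pas0 hk]; exact ha), gs0 hk]

variable {W}

theorem Cls.move {w b} {k : Kind} {c c' ρ} (h : Cls W w b k c ρ) (hc : k.val ≤ 6 → c' 0 = c 0) : Cls W w b k c' ρ := by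
  rcases h with h | h
  · exact Or.inl h
  · right; rw [hc h.1]; exact h

theorem Cls.uniq {w b} {k : Kind} {c c' ρ ρ'} (hu : ∀ b e e', w b e → w b e' → e = e')
    (h : Cls W w b k c ρ) (h' : Cls W w b k c' ρ') : ρ = ρ' := by
  rcases h with ⟨h1, e, h2, h3⟩ | ⟨h1, _, _, h3⟩ <;> rcases h' with ⟨h1', e', h2', h3'⟩ | ⟨h1', _, _, h3'⟩
  · rw [h3, h3', hu _ _ _ h2 h2']
  · omega
  · omega
  · rw [h3, h3']

theorem sub_eq {b : P3} {k' k : Kind} (h : k.val < 6 → k'.val < 9) : sub b k' k = b := by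
  funext i; simp [sub, shv_zero h]

theorem sub_dock (b : P3) (d : Fin 6) : nb (sub b (dock d) (bus d)) (dirOf d) = b := by
  funext i; rw [nb_apply]; simp only [sub, shv_bus]; ring

theorem Cls.cross {w b} {k' k : Kind} {t e c1 c ρ} (h : Cls W w b k' c1 ρ) (hE : Ent t e k' k) (hk : k ≠ trunk)
    (hc : ∀ i, i ≠ t → c1 i = c i) (hu : k.val < 6 → c 0 % 2 = 0) : ∃ ρ', Cls W w (sub b k' k) k c ρ' := by
  have F := tab_ent hE
  have ht : k.val ≠ 8 := fun h => hk (Fin.ext h)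
  have h7 : k.val ≠ 7 := fun h => F.chip (Fin.ext h)
  have hp : k.val ≤ 6 → c1 0 = c 0 := fun h => hc 0 (by have := F.pas; rw [tab_pas0 (by omega)] at this; exact this.symm)
  rcases h with ⟨h1, e1, h2, h3⟩ | ⟨h1, h2, h3, h4⟩
  · by_cases h9 : 9 ≤ k.val
    · rw [sub_eq (by omega)]
      exact ⟨ρ, Or.inl ⟨by omega, e1, h2, h3⟩⟩
    · have h6 : k.val ≠ 6 := fun h => by have := (F.branch (Fin.ext h)).2.2; rw [this] at h1; simp at h1
      have hb := F.bus (by omega)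
      rcases hb.2 with hb2 | hb2
      · omega
      · refine ⟨_, Or.inr ⟨by omega, hu (by omega), Or.inr ⟨⟨k.val, by omega⟩, e1, ?_⟩, rfl⟩⟩
        have e1 : k' = dock ⟨k.val, by omega⟩ := Fin.ext (by simp only [dock]; omega)
        have e2 : k = bus ⟨k.val, by omega⟩ := Fin.ext rfl
        have := sub_dock b ⟨k.val, by omega⟩
        rw [← e1, ← e2] at this
        rw [this]; exact h2
  · have : k.val ≤ 6 := by by_contra h; have := F.tree (by omega); omega
    rw [sub_eq (by omega)]
    exact ⟨ρ, Or.inr ⟨this, by rw [← hp this]; exact h2, h3, h4⟩⟩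

theorem adjS_ok {w b} {k' k : Kind} {t e c1 c c' ρ ρ'} (hu : ∀ b e e', w b e → w b e' → e = e')
    (h : Cls W w b k' c1 ρ) (h' : Cls W w (sub b k' k) k c ρ') (hE : Ent t e k' k) (a : Fin 3) (T : Sym)
    (hT : k = trunk → T.r = ρ' (c' 0)) : adjS k (gs k (Gf W ρ) c' a) T = gs k (Gf W ρ') c' a := by
  have F := tab_ent hE
  unfold adjS
  split_ifs with h1 h2
  · rcases h' with h' | h'
    · omega
    · rw [h'.2.2.2, gs0 (by omega), gs0 (by omega)]; rfl
  · rw [hT h2, h2]; rfl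
  · have : ρ = ρ' := by
      have ht : k.val ≠ 8 := fun h => h2 (Fin.ext h)
      rw [sub_eq (by omega)] at h'
      rcases h with ⟨h1, e, h2, h3⟩ | ⟨h1, _, _, h3⟩ <;> rcases h' with ⟨h1', e', h2', h3'⟩ | ⟨h1', _, _, h3'⟩
      · rw [h3, h3', hu _ _ _ h2 h2']
      · have := (F.branch (Fin.ext (by simp only [branch]; change k.val = 6; omega))).2.2
        rw [this] at h1; simp at h1
      · have := F.tree (by omega); omega
      · rw [h3, h3']
    rw [this]

variable (W)

structure SH (cn : P3 → Option Q) (w : P3 → ℤ → Prop) : Prop where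
  wb : ∀ b e, w b e → 1 ≤ e ∧ e < W.N
  uniq : ∀ b e e', w b e → w b e' → e = e'
  last : ∀ b c ev tk l, In W c → c 0 = W.K - 1 → c 1 = 0 → c 2 = 0 → cn (pt W b chip c) = some (.nc ev tk l) → ∃ e, w b e
  win : ∀ b e c ev tk l, w b e → In W c → c 1 = 0 → c 2 = 0 → cn (pt W b chip c) = some (.nc ev tk l) → 2 * e + 1 ≤ c 0 →
    tk = decide (c 0 = 2 * e + 1)

variable {W}

theorem bus_par {w b ρ c} {k : Kind} (hk : k.val ≤ 6) (h : Cls W w b k c ρ) : c 0 % 2 = 0 ∧ Near w b := by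
  rcases h with h | h
  · omega
  · exact ⟨h.2.1, h.2.2.1⟩

theorem R1_sound {cn w p f q q'} (H : SH W cn w) (h : R1 f q q') (hc : cn (nb p f) = some q)
    (hq : Al W w (nb p f) q) : Al W w p q' := by
  have hK := K_pos W
  have hKN : W.K = 2 * W.N := rfl
  cases h with
  | diagSame t e k' k F D h hD =>
    obtain ⟨b, c1, ρ, hp, hin, hcls, hmk⟩ := hq
    have ht := (tab_ent h).pas
    obtain ⟨o1, o2, o3⟩ := oth_ne ht
    rw [mkD hmk ht o1] at hD
    have hD' := cl_eq (by cases e <;> simp [sg]) hD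
    have hc0 : ∀ i, i ≠ t → nb c1 (t, !e) i = c1 i := fun i hi => by rw [nb_apply]; simp [hi]
    have hct : nb c1 (t, !e) t = c1 (oth (pas k) t) := by rw [nb_apply]; simp; omega
    refine ⟨b, nb c1 (t, !e), ρ, inp_same W hp, ?_, hcls.move ?_, ?_⟩
    · intro i
      by_cases hi : i = t
      · subst hi; rw [hct]; exact hin _
      · rw [hc0 i hi]; exact hin i
    · intro hk
      refine hc0 0 ?_
      rw [tab_pas0 (by omega)] at ht; exact ht.symm
    · refine mkq_eq ht ?_ ?_ ?_
      · rw [mkF hmk o1]; exact gs_congr hct.symm (hc0 _ ht.symm).symm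
      · rw [mkF hmk o1]; exact gs_congr (hc0 _ o2).symm (hc0 _ ht.symm).symm
      · rw [hct, hc0 _ o2, sub_self]
  | diagCross t e k' k F D S h hk hF hS hE hu =>
    obtain ⟨b, c1, ρ, hp, hin, hcls, hmk⟩ := hq
    have ht := (tab_ent h).pas
    have ht' := (tab_ent h).pas'
    obtain ⟨o1, o2, o3⟩ := oth_ne ht
    rw [mkF hmk ht', atE_iff] at hF
    obtain ⟨c, hpc, hinc, hct, hcc⟩ := inp_cross W h hp hin hF
    rw [mkF hmk (oth_ne ht').1, gs_cross h hcc] at hS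
    have hcs : c (oth (pas k) t) = en W e := by rw [hS, atE_iff] at hE; exact hE
    obtain ⟨ρ', hcls'⟩ := hcls.cross h hk hcc (fun h6 => by
      have := hu h6
      rw [hS, gs0 (by omega)] at this
      simp [Gf] at this; omega)
    refine ⟨_, c, ρ', hpc, hinc, hcls', ?_⟩
    have hA : adjS k S S = gs k (Gf W ρ') c (oth (pas k) t) := by
      conv_lhs => rw [hS]
      exact adjS_ok H.uniq hcls hcls' h _ _ (fun h => absurd h hk)
    refine mkq_eq ht ?_ hA (by rw [hct, hcs, sub_self])
    rw [hA]; exact gs_congr (by rw [hct, hcs]) rfl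
  | oddcopy k F D hk h =>
    obtain ⟨b, c1, ρ, hp, hin, hcls, hmk⟩ := hq
    subst hk
    have h15 : (trunk : Kind).val < 15 := by decide
    have hF : ∀ a, a ≠ 0 → F a = Gf W ρ (c1 0) (c1 a) := fun a ha => mkF0 h15 hmk ha
    rw [hF 1 (by decide)] at h
    have hx : c1 0 % 2 = 0 := by simpa [Gf] using h
    have h0 : nb c1 (0, true) 0 = c1 0 + 1 := by rw [nb_apply]; simp [sg]
    have hc0 : ∀ i, i ≠ 0 → nb c1 (0, true) i = c1 i := fun i hi => by rw [nb_apply]; simp [hi]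
    have hcls' : ∃ e, w b e ∧ ρ = fun x => W.Mb (x / 2) e := by
      rcases hcls with hcls | hcls
      · exact hcls.2
      · have : (8 : ℕ) ≤ 6 := hcls.1
        omega
    refine ⟨b, nb c1 (0, true), ρ, inp_same W hp, ?_, Or.inl ⟨le_refl 8, hcls'⟩, ?_⟩
    · intro i
      by_cases hi : i = 0
      · subst hi; rw [h0]; have := hin 0; omega
      · rw [hc0 i hi]; exact hin i
    · have hpas : pas trunk = 0 := tab_pas0 h15
      unfold mk
      rw [hpas]
      congr 1
      · funext a
        by_cases ha : a = 0
        · simp [ha]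
        · simp only [ha, if_false]
          rw [gs0 h15, h0, hc0 a ha, hF a ha]
          obtain ⟨e, _, hρ⟩ := hcls'
          have d2 : (c1 0 + 1) / 2 = c1 0 / 2 := by omega
          have hin0 := hin 0
          simp only [oddS, Gf, hρ, d2]
          congr 1
          all_goals simp only [eq_comm (a := true), eq_comm (a := false), decide_eq_true_eq, decide_eq_false_iff_not, decide_eq_decide]; omega
      · unfold mk at hmk
        injection hmk with _ _ h3
        rw [h3, hpas]
        funext a a'
        by_cases ha : a = 0 ∨ a' = 0
        · simp [ha]
        · simp only [ha, if_false]
          push Not at ha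
          rw [hc0 a ha.1, hc0 a' ha.2]
  | tokStart k d F D hk h1 h2 h3 h4 h5 h6 =>
    obtain ⟨b, c1, ρ, hp, hin, hcls, hmk⟩ := hq
    subst hk
    have h15 : (dock d).val < 15 := by simp only [dock]; omega
    have f1 := mkF0 h15 hmk (a := 1) (by decide)
    have f2 := mkF0 h15 hmk (a := 2) (by decide)
    rw [f1] at h1 h3 h4 h6
    rw [f2] at h2
    simp only [Gf, decide_eq_true_eq] at h1 h2 h3 h4 h6
    have hcls' : ∃ e, w b e ∧ ρ = fun x => W.Mb (x / 2) e := by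
      rcases hcls with hcls | hcls
      · exact hcls.2
      · have : (dock d).val ≤ 6 := hcls.1
        simp only [dock] at this; omega
    obtain ⟨e, he, hρ⟩ := hcls'
    obtain ⟨c, hpc, hinc, hct, hcc⟩ := inp_cross W (e := false) (tab_dock d).1 hp hin (by rw [h1]; rfl)
    have e0 := hcc 0 (by decide)
    have e2 := hcc 2 (by decide)
    rw [hρ] at h6
    refine ⟨_, c, hpc, hinc, by omega, by rw [hct]; rfl, ?_, ?_, Or.inr ⟨d, e, ?_⟩, ⟨d, le_refl _, ?_⟩, ?_⟩
    · rw [eq_comm, decide_eq_false_iff_not]; omega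
    · rw [f1]; simp only [Gf, e0]
    · rw [sub_dock]; exact he
    · rw [← e0]; exact h4
    · intro d' hd' hD
      rcases lt_or_eq_of_le hd' with hl | rfl
      · have := h5 d' hl
        rw [f1] at this
        simp only [Gf] at this
        rw [← e0, this] at hD
        simp at hD
      · exact ⟨e, by rw [sub_dock]; exact he, by rw [← e0]; exact h6⟩
  | nPass tk l =>
    obtain ⟨b, c1, hp, hin, h1, h2, h3, h4, h5, h6⟩ := hq
    have h0 : nb c1 (0, true) 0 = c1 0 + 1 := by rw [nb_apply]; simp [sg]
    have hc0 : ∀ i, i ≠ 0 → nb c1 (0, true) i = c1 i := fun i hi => by rw [nb_apply]; simp [hi]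
    have hin0 := hin 0
    have hev : c1 0 % 2 = 0 := by simpa using h3.symm
    refine ⟨b, nb c1 (0, true), inp_same W hp, In_nb W (e := false) hin (by simp [en]; omega), by rw [hc0 1 (by decide), h1],
      by rw [hc0 2 (by decide), h2], ?_, ?_, by simp, h6⟩
    · rw [h0, eq_comm, decide_eq_false_iff_not]; omega
    · rw [h0, h4, decide_eq_decide]; omega
  | nTake d l hd =>
    obtain ⟨b, c1, hp, hin, h1, h2, h3, h4, h5, h6⟩ := hq
    subst hd
    have h3' : c1 2 = W.K - 1 := by simpa using h3.symm
    obtain ⟨c, hpc, hinc, hct, hcc⟩ := inp_cross0 W (e := false) geo_chip hp hin (by rw [h3']; rfl)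
    have e0 := hcc 0 (by decide)
    have e1 := hcc 1 (by decide)
    have := hinc 0
    refine ⟨b, c, hpc, hinc, by omega, by rw [hct]; rfl, ?_, ?_, ?_, h5⟩
    · rw [eq_comm, decide_eq_false_iff_not]; omega
    · rw [h4, decide_eq_decide]; omega
    · intro _; exact ⟨rfl, Or.inl (by rw [← e0]; exact h6)⟩
  | bStart tk =>
    obtain ⟨b, c1, hp, hin, h1, h2, h3, h4, h5, h6⟩ := hq
    have hod : ¬ c1 0 % 2 = 0 := by rw [eq_comm, decide_eq_false_iff_not] at h3; exact h3
    have hl : W.K - 2 ≤ c1 0 := by simpa using h4.symm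
    have hin0 := hin 0
    rw [hp] at hc
    obtain ⟨e, he⟩ := H.last b c1 _ _ _ hin (by omega) h1 h2 hc
    have hb := H.wb b e he
    have htk := H.win b e c1 _ _ _ he hin h1 h2 hc (by omega)
    have h0 : nb c1 (1, true) 1 = c1 1 + 1 := by rw [nb_apply]; simp [sg]
    have hc0 : ∀ i, i ≠ 1 → nb c1 (1, true) i = c1 i := fun i hi => by rw [nb_apply]; simp [hi]
    refine ⟨b, nb c1 (1, true), e, inp_same W hp, In_nb W (e := false) hin (by simp [en]; omega), by omega, by rw [hc0 2 (by decide), h2],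
      he, ?_, ?_⟩
    · rw [hc0 0 (by decide)]; omega
    · rw [hc0 0 (by decide)]; exact htk
  | selOddR r fst lst =>
    obtain ⟨b, c1, e, hp, hin, h1, h2, h3, h4, h5, h6, h7⟩ := hq
    have h0 : nb c1 (0, true) 0 = c1 0 + 1 := by rw [nb_apply]; simp [sg]
    have hc0 : ∀ i, i ≠ 0 → nb c1 (0, true) i = c1 i := fun i hi => by rw [nb_apply]; simp [hi]
    have hin0 := hin 0
    refine ⟨b, nb c1 (0, true), e, inp_same W hp, In_nb W (e := false) hin (by simp [en]; omega), by omega, by rw [hc0 1 (by decide), h2],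
      by rw [hc0 2 (by decide), h3], h4, ?_⟩
    rw [h0, h7, decide_eq_decide]; omega
  | selOddL r lst =>
    obtain ⟨b, c1, e, hp, hin, h1, h2, h3, h4, h5, h6, h7⟩ := hq
    have h0 : nb c1 (0, false) 0 = c1 0 - 1 := by rw [nb_apply]; simp [sg]; ring
    have hc0 : ∀ i, i ≠ 0 → nb c1 (0, false) i = c1 i := fun i hi => by rw [nb_apply]; simp [hi]
    have hin0 := hin 0
    have h6' : ¬ c1 0 = 0 := by rw [eq_comm, decide_eq_false_iff_not] at h6; exact h6
    refine ⟨b, nb c1 (0, false), e, inp_same W hp, In_nb W (e := true) hin (by simp [en]; omega), by omega, by rw [hc0 1 (by decide), h2],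
      by rw [hc0 2 (by decide), h3], h4, ?_⟩
    rw [h0, eq_comm, decide_eq_false_iff_not]; omega

end IU

namespace IU

variable {W : World}

/-- a chip cell lying over a cell of the last bus square -/
theorem over_bus {w p F D} {k : Kind} (hk : k = bus 5) (hq : Al W w (nb p (2, false)) (.sq k F D)) (hg : (F 2).vl = true) :
    ∃ b c, p = pt W b chip c ∧ In W c ∧ c 2 = 0 ∧ c 0 % 2 = 0 ∧ Near w b ∧ F 1 = Gf W (fun _ _ => false) (c 0) (c 1) := by
  obtain ⟨b, c1, ρ, hp, hin, hcls, hmk⟩ := hq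
  subst hk
  have f1 := mkF0 (by decide) hmk (a := 1) (by decide)
  have f2 := mkF0 (by decide) hmk (a := 2) (by decide)
  rw [f2] at hg
  simp only [Gf, decide_eq_true_eq] at hg
  obtain ⟨c, hpc, hinc, hct, hcc⟩ := inp_cross0 W (e := false) geo_chip hp hin (by rw [hg]; rfl)
  have e0 := hcc 0 (by decide)
  have e1 := hcc 1 (by decide)
  have hb := bus_par (by decide) hcls
  have hρ : ρ = fun _ _ => false := by
    rcases hcls with h | h
    · exact absurd h.1 (by decide)
    · exact h.2.2.2
  refine ⟨b, c, hpc, hinc, by rw [hct]; rfl, by omega, hb.2, by rw [f1, e0, e1, hρ]⟩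

theorem nbc (c : P3) (t : Fin 3) (e : Bool) : nb c (t, e) t = c t + sg e := by rw [nb_apply]; simp
theorem nbo (c : P3) (t : Fin 3) (e : Bool) {i : Fin 3} (hi : i ≠ t) : nb c (t, e) i = c i := by
  rw [nb_apply]; simp [hi]

theorem R2_sound {cn w p f q g q2 q'} (H : SH W cn w) (h : R2 f q g q2 q')
    (hc2 : cn (nb p g) = some q2)
    (hq : Al W w (nb p f) q) (hq2 : Al W w (nb p g) q2) : Al W w p q' := by
  have hK := K_pos W
  have hKN : W.K = 2 * W.N := rfl
  have hst : sg true = 1 := rfl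
  have hsf : sg false = -1 := rfl
  cases h with
  | sideSame t e k' k s ε F D F' D' h hs h1 h2 h3 =>
    obtain ⟨b, c1, ρ, hp, hin, hcls, hmk⟩ := hq
    obtain ⟨b2, c2, ρ2, hp2, hin2, hcls2, hmk2⟩ := hq2
    have ht := (tab_ent h).pas
    obtain ⟨o1, o2, o3⟩ := oth_ne ht
    rw [← hs] at o1 o2 o3
    rw [mkF hmk ht, atE_iff'] at h1
    rw [mkF hmk2 o1, atE_iff'] at h2
    have i1 := In_nb W hin h1
    have i2 := In_nb W hin2 h2
    have p1 : p = pt W b k (nb c1 (t, !e)) := inp_same W hp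
    have p2 : p = pt W b2 k (nb c2 (s, !ε)) := inp_same W hp2
    obtain ⟨rfl, -, hcc⟩ := pt_inj W (p1.symm.trans p2) i1 i2
    have hρ := Cls.uniq H.uniq hcls hcls2
    subst hρ
    refine ⟨b, nb c1 (t, !e), ρ, p1, i1, hcls.move ?_, ?_⟩
    · intro hk
      refine nbo _ _ _ ?_
      rw [tab_pas0 (by omega)] at ht; exact ht.symm
    · refine mkq_eq ht ?_ ?_ ?_
      · rw [mkF hmk2 ht, hcc]; exact gs_congr (nbo _ _ _ o2.symm).symm (nbo _ _ _ o1.symm).symm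
      · rw [← hs, mkF hmk o1]; exact gs_congr (nbo _ _ _ o2).symm (nbo _ _ _ ht.symm).symm
      · rw [← hs, hcc]
        rw [mkD hmk2 ht o1] at h3 ⊢
        rw [cl_add (by cases ε <;> simp [sg]) h3, nbc, nbo _ _ _ o2.symm]
        congr 1; ring
  | sideCross t e k' k s F D F' D' S h hs h1 hS hE hu h2 h4 h3 =>
    obtain ⟨b, c1, ρ, hp, hin, hcls, hmk⟩ := hq
    obtain ⟨b2, c2, ρ2, hp2, hin2, hcls2, hmk2⟩ := hq2
    have ht := (tab_ent h).pas
    have ht' := (tab_ent h).pas'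
    obtain ⟨o1, o2, o3⟩ := oth_ne ht
    rw [← hs] at o1 o2 o3
    rw [mkF hmk ht', atE_iff] at h1
    rw [mkF hmk2 o1, atE_iff'] at h2
    rw [mkF hmk2 ht, atE_iff] at h4
    obtain ⟨c, hpc, hinc, hct, hcc⟩ := inp_cross W h hp hin h1
    rw [mkF hmk (oth_ne ht').1, gs_cross h hcc, ← hs] at hS
    have i2 := In_nb W hin2 h2
    have p2 : p = pt W b2 k (nb c2 (s, !e)) := inp_same W hp2
    obtain ⟨hb, -, hce⟩ := pt_inj W (hpc.symm.trans p2) hinc i2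
    have hcls3 : Cls W w (sub b k' k) k c ρ2 := by
      rw [hb, hce]
      refine hcls2.move (fun hk => nbo _ _ _ ?_)
      rw [tab_pas0 (by omega)] at o1; exact o1.symm
    refine ⟨_, c, ρ2, hpc, hinc, hcls3, ?_⟩
    refine mkq_eq ht ?_ ?_ ?_
    · rw [mkF hmk2 ht, hce]; exact gs_congr (nbo _ _ _ o2.symm).symm (nbo _ _ _ o1.symm).symm
    · rw [hS, ← hs]
      refine adjS_ok H.uniq hcls hcls3 h _ _ ?_
      rintro rfl
      rw [mkF hmk2 ht, gs0 (by decide), hce, nbo]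
      · rfl
      · rw [tab_pas0 (by decide)] at o1; exact o1.symm
    · rw [← hs, hce]
      rw [mkD hmk2 ht o1] at h3 ⊢
      rw [cl_add (by cases e <;> simp [sg]) h3, nbc, nbo _ _ _ o2.symm]
      congr 1; ring
  | trunkDiag r k F D S hk h1 h2 hS =>
    subst hk
    obtain ⟨b, c1, e, hp, hin, a1, a2, a3, a4, a5⟩ := hq
    obtain ⟨b2, c2, ρ2, hp2, hin2, hcls2, hmk2⟩ := hq2
    have f1 := mkF0 (by decide) hmk2 (a := 1) (by decide)
    have f2 := mkF0 (by decide) hmk2 (a := 2) (by decide)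
    rw [f1] at h2 hS
    rw [f2] at h1
    simp only [Gf, decide_eq_true_eq] at h1 h2
    obtain ⟨c, hpc, hinc, hct, hcc⟩ := inp_cross W (e := false) tab_trunk hp2 hin2 (by rw [h1]; rfl)
    have e0 := hcc 0 (by decide)
    have e1 := hcc 1 (by decide)
    rw [sub_eq (by decide)] at hpc
    have hn := nb_cross0 W (e := false) geo_trunk b2 c (by rw [← e1, h2]; rfl)
    rw [← hpc] at hn
    obtain ⟨rfl, -, hcd⟩ := pt_inj W (hp.symm.trans hn) hin (In_upd W hinc _ _)
    have e3 : c1 0 = c 0 := by rw [hcd]; simp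
    have hc2' : c 2 = 0 := by rw [hct]; rfl
    refine ⟨b, c, fun x => W.Mb (x / 2) e, hpc, hinc, Or.inl ⟨le_refl 8, e, a4, rfl⟩, ?_⟩
    have hpas : pas trunk = 0 := tab_pas0 (by decide)
    have hSS : S = Gf W (fun x => W.Mb (x / 2) e) (c 0) 0 := by
      rw [hS, e0, h2, a5, e3]; rfl
    refine mkq_eq (by rw [hpas]; decide) ?_ ?_ ?_
    · rw [hSS, gs0 (by decide), hc2']
    · rw [hpas, oth02, hSS, gs0 (by decide), ← e1, h2]
    · rw [hpas, oth02, hc2', ← e1, h2, sub_zero]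
  | tokMove d l k F D hk h1 h2 =>
    subst hk
    have h15 : (bus d).val < 15 := by simp only [bus]; omega
    obtain ⟨b, c1, hp, hin, a1, a2, a3, a4, a5, a6⟩ := hq
    obtain ⟨b2, c2, ρ2, hp2, hin2, hcls2, hmk2⟩ := hq2
    have f2 := mkF0 h15 hmk2 (a := 2) (by decide)
    have a3' : ¬ c1 2 = W.K - 1 := by rw [eq_comm, decide_eq_false_iff_not] at a3; exact a3
    have hpar := (bus_par (by simp only [bus]; omega) hcls2).1
    have i1 := In_nb W (t := 2) (e := false) hin (by simpa [en] using a3')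
    have i2 := In_nb W (t := 0) (e := false) hin2 (by simp [en]; omega)
    have p1 : p = pt W b (bus d) (nb c1 (2, true)) := inp_same W hp
    have p2 : p = pt W b2 (bus d) (nb c2 (0, true)) := inp_same W hp2
    obtain ⟨rfl, -, hcc⟩ := pt_inj W (p1.symm.trans p2) i1 i2
    have n0 : nb c1 (2, true) 0 = c1 0 := nbo _ _ _ (by decide)
    have n1 : nb c1 (2, true) 1 = c1 1 := nbo _ _ _ (by decide)
    refine ⟨b, nb c1 (2, true), p1, i1, by rw [n0, a1], by rw [n1, a2], ?_, by rw [n0, a4], a5, by rw [n0]; exact a6⟩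
    rw [f2, hcc, nbo _ _ _ (by decide)]; rfl
  | tokSkip d d' l k F D hd hk h1 h2 h3 =>
    subst hk
    have h15 : (bus d').val < 15 := by simp only [bus]; omega
    obtain ⟨b, c1, hp, hin, a1, a2, a3, a4, a5, a6⟩ := hq
    obtain ⟨b2, c2, ρ2, hp2, hin2, hcls2, hmk2⟩ := hq2
    have f1 := mkF0 h15 hmk2 (a := 1) (by decide)
    have a3' : c1 2 = W.K - 1 := by simpa using a3.symm
    have hpar := (bus_par (by simp only [bus]; omega) hcls2).1
    obtain ⟨c, hpc, hinc, hct, hcc⟩ := inp_cross W (e := false) (tab_bus hd) hp hin (by rw [a3']; rfl)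
    rw [sub_eq (by simp only [bus]; omega)] at hpc
    have i2 := In_nb W (t := 0) (e := false) hin2 (by simp [en]; omega)
    have p2 : p = pt W b2 (bus d') (nb c2 (0, true)) := inp_same W hp2
    obtain ⟨rfl, -, hce⟩ := pt_inj W (hpc.symm.trans p2) hinc i2
    have e0 := hcc 0 (by decide)
    have e1 := hcc 1 (by decide)
    have hc2' : c 2 = 0 := by rw [hct]; rfl
    have h0 : c 0 = c2 0 + 1 := by rw [hce, nbc]; rfl
    refine ⟨b, c, hpc, hinc, by omega, by omega, ?_, by rw [← e0, a4], a5, ?_⟩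
    · rw [eq_comm, decide_eq_false_iff_not]; omega
    · rw [f1] at h3
      simp only [Gf] at h3
      have hx : c1 0 / 2 = c 0 / 2 := by omega
      have hx2 : c2 0 / 2 = c 0 / 2 := by omega
      rw [hx] at a6
      rw [hx2] at h3
      obtain ⟨⟨u, hu, hu'⟩, hv⟩ := a6
      refine ⟨⟨u, by rw [Fin.le_def] at hu ⊢; omega, hu'⟩, ?_⟩
      intro v hv1 hv2
      by_cases hvd : v = d'
      · rw [hvd, h3] at hv2; simp at hv2
      · refine hv v ?_ hv2
        have : v.val ≠ d'.val := fun h => hvd (Fin.ext h)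
        rw [Fin.le_def] at hv1 ⊢; omega
  | tokDock d d' l k F D hd hk h1 h2 h3 h4 h6 =>
    subst hk
    have h15 : (dock d').val < 15 := by simp only [dock]; omega
    obtain ⟨b, c1, hp, hin, a1, a2, a3, a4, a5, a6⟩ := hq
    obtain ⟨b2, c2, ρ2, hp2, hin2, hcls2, hmk2⟩ := hq2
    have f1 := mkF0 h15 hmk2 (a := 1) (by decide)
    have a3' : c1 2 = W.K - 1 := by simpa using a3.symm
    obtain ⟨c, hpc, hinc, hct, hcc⟩ := inp_cross W (e := false) (tab_bus hd) hp hin (by rw [a3']; rfl)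
    rw [sub_eq (by simp only [bus]; omega)] at hpc
    rw [f1] at h1 h4 h6
    simp only [Gf, decide_eq_true_eq] at h1 h4 h6
    obtain ⟨c', hpc', hinc', hct', hcc'⟩ := inp_cross W (e := false) (tab_dock d').1 hp2 hin2 (by rw [h1]; rfl)
    obtain ⟨hb, -, hce⟩ := pt_inj W (hpc.symm.trans hpc') hinc hinc'
    have e0 := hcc 0 (by decide)
    have e1 := hcc 1 (by decide)
    have e0' := hcc' 0 (by decide)
    have hc2' : c 2 = 0 := by rw [hct]; rfl
    have hcls' : ∃ e, w b2 e ∧ ρ2 = fun x => W.Mb (x / 2) e := by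
      rcases hcls2 with hcls | hcls
      · exact hcls.2
      · have : (dock d').val ≤ 6 := hcls.1
        simp only [dock] at this; omega
    obtain ⟨e, he, hρ⟩ := hcls'
    rw [hρ, e0', ← hce] at h6
    rw [e0', ← hce] at h4
    rw [e0] at a6
    refine ⟨b, c, hpc, hinc, by omega, by omega, ?_, by rw [← e0, a4], a5, ⟨d', le_refl _, h4⟩, ?_⟩
    · rw [eq_comm, decide_eq_false_iff_not]; omega
    · intro v hv1 hv2
      by_cases hvd : v = d'
      · subst hvd
        refine ⟨e, ?_, h6⟩
        rw [hb, sub_dock]; exact he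
      · refine a6.2 v ?_ hv2
        have : v.val ≠ d'.val := fun h => hvd (Fin.ext h)
        rw [Fin.le_def] at hv1 ⊢; omega
  | nEv tk k F D hk hg h1 =>
    obtain ⟨b2, c, hpc, hinc, z2, z0, hN, f1⟩ := over_bus hk hq2 hg
    obtain ⟨b, c1, hp, hin, a1, a2, a3, a4, a5, a6⟩ := hq
    have a4' : ¬ W.K - 2 ≤ c1 0 := by rw [eq_comm, decide_eq_false_iff_not] at a4; exact a4
    have i1 := In_nb W (t := 0) (e := false) hin (by simp [en]; omega)
    obtain ⟨rfl, -, hce⟩ := pt_inj W (hpc.symm.trans (inp_same W hp)) hinc i1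
    have c0 := hinc 0
    have hc1 : c 1 = 0 := by rw [hce, ← a1]; exact nbo _ _ _ (by decide)
    refine ⟨b2, c, hpc, hinc, hc1, z2, by simpa using z0, ?_, by simp, hN⟩
    rw [f1]; simp only [Gf, decide_eq_decide]; omega
  | bMove ev tk l =>
    obtain ⟨b, c1, e, hp, hin, a1, a2, a3, a4, a5⟩ := hq
    obtain ⟨b2, c2, hp2, hin2, d1, d2, d3, d4, d5, d6⟩ := hq2
    have hb := H.wb b e a3
    have i1 := In_nb W (t := 0) (e := true) hin (by simp [en]; omega)
    have i2 := In_nb W (t := 1) (e := false) hin2 (by simp [en]; omega)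
    have p1 : p = pt W b chip (nb c1 (0, false)) := inp_same W hp
    have p2 : p = pt W b2 chip (nb c2 (1, true)) := inp_same W hp2
    obtain ⟨rfl, -, hce⟩ := pt_inj W (p1.symm.trans p2) i1 i2
    have n0 : nb c1 (0, false) 0 = c1 0 - 1 := by rw [nbc]; rfl
    have n0' : nb c2 (1, true) 0 = c2 0 := nbo _ _ _ (by decide)
    rw [← hce] at n0'
    rw [hp2] at hc2
    have a5' : ¬ c1 0 = 2 * e + 1 := by rw [eq_comm, decide_eq_false_iff_not] at a5; exact a5
    have hw := H.win b e c2 _ _ _ a3 hin2 d1 d2 hc2 (by omega)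
    refine ⟨b, _, e, p1, i1, by rw [nbo _ _ _ (by decide), a1], by rw [nbo _ _ _ (by decide), a2], a3, by omega, ?_⟩
    rw [n0', hw]
  | wiStart k F D hk hg =>
    obtain ⟨b, c1, e, hp, hin, a1, a2, a3, a4, a5⟩ := hq
    have hb := H.wb b e a3
    have i1 := In_nb W (t := 0) (e := true) hin (by simp [en]; omega)
    have n0 : nb c1 (0, false) 0 = c1 0 - 1 := by rw [nbc]; rfl
    have n1 : nb c1 (0, false) 1 = c1 1 := nbo _ _ _ (by decide)
    have a5' : c1 0 = 2 * e + 1 := by simpa using a5.symm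
    exact ⟨b, _, e, inp_same W hp, i1, by change nb c1 (0, false) 0 = _; omega, by change 1 ≤ nb c1 (0, false) 1; omega,
      by change nb c1 (0, false) 1 < _; omega, by rw [← a2]; exact nbo _ _ _ (by decide), a3⟩
  | wiMove k F D hk hg h1 =>
    obtain ⟨b2, c, hpc, hinc, z2, z0, hN, f1⟩ := over_bus hk hq2 hg
    obtain ⟨b, c1, e, hp, hin, a1, a2, a3, a4, a5⟩ := hq
    have hb := H.wb b e a5
    have i1 := In_nb W (t := 1) (e := false) hin (by simp [en]; omega)
    obtain ⟨rfl, -, hce⟩ := pt_inj W (hpc.symm.trans (inp_same W hp)) hinc i1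
    have n1 : c 1 = c1 1 + 1 := by rw [hce]; exact nbc _ _ _
    have n0 : c 0 = c1 0 := by rw [hce]; exact nbo _ _ _ (by decide)
    rw [f1] at h1
    simp only [Gf, decide_eq_false_iff_not] at h1
    exact ⟨b2, c, e, hpc, hinc, by omega, by omega, by omega, z2, a5⟩
  | selDiag k F D hk hg h1 =>
    obtain ⟨b2, c, hpc, hinc, z2, z0, hN, f1⟩ := over_bus hk hq2 hg
    obtain ⟨b, c1, e, hp, hin, a1, a2, a3, a4, a5⟩ := hq
    have hb := H.wb b e a5
    have i1 := In_nb W (t := 1) (e := false) hin (by simp [en]; omega)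
    obtain ⟨rfl, -, hce⟩ := pt_inj W (hpc.symm.trans (inp_same W hp)) hinc i1
    have n0 : c 0 = c1 0 := by rw [hce]; exact nbo _ _ _ (by decide)
    rw [f1] at h1 ⊢
    simp only [Gf, decide_eq_true_eq] at h1
    have hv : c 1 = 2 * e := by omega
    refine ⟨b2, c, e, hpc, hinc, z0, hv, z2, a5, ?_, rfl, rfl⟩
    have : c 1 / 2 = e := by omega
    simp only [Gf, this]
  | selEvR k F D hk hg =>
    obtain ⟨b2, c, hpc, hinc, z2, z0, hN, f1⟩ := over_bus hk hq2 hg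
    obtain ⟨b, c1, e, hp, hin, a1, a2, a3, a4, a5⟩ := hq
    have a5' : ¬ c1 0 = W.K - 1 := by rw [eq_comm, decide_eq_false_iff_not] at a5; exact a5
    have i1 := In_nb W (t := 0) (e := false) hin (by simpa [en] using a5')
    obtain ⟨rfl, -, hce⟩ := pt_inj W (hpc.symm.trans (inp_same W hp)) hinc i1
    have n1 : c 1 = c1 1 := by rw [hce]; exact nbo _ _ _ (by decide)
    rw [f1]
    refine ⟨b2, c, e, hpc, hinc, z0, by omega, z2, a4, ?_, rfl, rfl⟩
    have : c 1 / 2 = e := by omega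
    simp only [Gf, this]
  | selEvL l k F D hk hg =>
    obtain ⟨b2, c, hpc, hinc, z2, z0, hN, f1⟩ := over_bus hk hq2 hg
    obtain ⟨b, c1, e, hp, hin, a1, a2, a3, a4, a5⟩ := hq
    have i1 := In_nb W (t := 0) (e := true) hin (by simp [en]; omega)
    obtain ⟨rfl, -, hce⟩ := pt_inj W (hpc.symm.trans (inp_same W hp)) hinc i1
    have n1 : c 1 = c1 1 := by rw [hce]; exact nbo _ _ _ (by decide)
    rw [f1]
    refine ⟨b2, c, e, hpc, hinc, z0, by omega, z2, a4, ?_, rfl, rfl⟩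
    have : c 1 / 2 = e := by omega
    simp only [Gf, this]
  | rwStart r fst lst k F D hk hg h1 =>
    obtain ⟨b2, c, hpc, hinc, z2, z0, hN, f1⟩ := over_bus hk hq2 hg
    obtain ⟨b, c1, e, hp, hin, a1, a2, a3, a4, a5, a6, a7⟩ := hq
    have hb := H.wb b e a4
    have i1 := In_nb W (t := 1) (e := false) hin (by simp [en]; omega)
    obtain ⟨rfl, -, hce⟩ := pt_inj W (hpc.symm.trans (inp_same W hp)) hinc i1
    have n1 : c 1 = c1 1 + 1 := by rw [hce]; exact nbc _ _ _
    have n0 : c 0 = c1 0 := by rw [hce]; exact nbo _ _ _ (by decide)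
    exact ⟨b2, c, e, hpc, hinc, z0, by omega, z2, a4, by rw [n0]; exact a5⟩
  | rwMove r k F D hk hg h1 =>
    obtain ⟨b2, c, hpc, hinc, z2, z0, hN, f1⟩ := over_bus hk hq2 hg
    obtain ⟨b, c1, e, hp, hin, a1, a2, a3, a4, a5⟩ := hq
    rw [f1] at h1
    simp only [Gf, decide_eq_false_iff_not] at h1
    have i1 := In_nb W (t := 1) (e := true) hinc (by simpa [en] using h1)
    have hn : nb p (1, false) = pt W b2 chip (nb c (1, false)) := by rw [hpc, pt_nb]
    obtain ⟨rfl, -, hce⟩ := pt_inj W (hn.symm.trans hp) i1 hin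
    have n1 : c1 1 = c 1 - 1 := by rw [← hce, nbc]; rfl
    have n0 : c1 0 = c 0 := by rw [← hce]; exact nbo _ _ _ (by decide)
    exact ⟨b2, c, e, hpc, hinc, z0, by omega, z2, a4, by rw [← n0]; exact a5⟩

end IU

namespace IU

variable (W : World)

/-! ### Winners, seed contents and the invariant -/

def ax (x : ℤ) : P3 := fun i => if i = 0 then x else 0
theorem ax0 (x : ℤ) : ax x 0 = x := rfl
theorem ax1 (x : ℤ) : ax x 1 = 0 := rfl
theorem ax2 (x : ℤ) : ax x 2 = 0 := rfl
theorem ax_eq {c : P3} (h1 : c 1 = 0) (h2 : c 2 = 0) : c = ax (c 0) := by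
  funext i; fin_cases i
  · rfl
  · exact h1
  · exact h2
theorem In_ax {x : ℤ} (h0 : 0 ≤ x) (h1 : x < W.K) : In W (ax x) := by
  have := K_pos W
  intro i; unfold ax; split_ifs <;> omega

def ch (b : P3) (x : ℤ) : P3 := pt W b chip (ax x)

def Win (cn : P3 → Option Q) (b : P3) (e : ℤ) : Prop :=
  1 ≤ e ∧ e < W.N ∧ (∃ l, cn (ch W b (2 * e + 1)) = some (.nc false true l)) ∧
    ∀ x, 2 * e + 1 < x → x < W.K → ∃ ev l, cn (ch W b x) = some (.nc ev false l)

variable {W}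

theorem Win.uniq {cn b e e'} (h : Win W cn b e) (h' : Win W cn b e') : e = e' := by
  have key : ∀ e e', Win W cn b e → Win W cn b e' → ¬ e < e' := by
    rintro e e' ⟨h1, h2, h3, h4⟩ ⟨h1', h2', ⟨l, h3'⟩, h4'⟩ hlt
    have hKN : W.K = 2 * W.N := rfl
    obtain ⟨ev, l', hh⟩ := h4 (2 * e' + 1) (by omega) (by omega)
    rw [h3'] at hh; simp at hh
  have := key e e' h h'
  have := key e' e h' h
  omega

theorem Win.mono {cn cn' : P3 → Option Q} (hm : ∀ p q, cn p = some q → cn' p = some q) {b e} (h : Win W cn b e) :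
    Win W cn' b e := by
  obtain ⟨h1, h2, ⟨l, h3⟩, h4⟩ := h
  refine ⟨h1, h2, ⟨l, hm _ _ h3⟩, fun x hx hx' => ?_⟩
  obtain ⟨ev, l, h⟩ := h4 x hx hx'
  exact ⟨ev, l, hm _ _ h⟩

theorem Near.mono {w w' : P3 → ℤ → Prop} (hm : ∀ b e, w b e → w' b e) {b} (h : Near w b) : Near w' b := by
  rcases h with ⟨e, h⟩ | ⟨d, e, h⟩
  · exact Or.inl ⟨e, hm _ _ h⟩
  · exact Or.inr ⟨d, e, hm _ _ h⟩

theorem VU.mono {w w' : P3 → ℤ → Prop} (hm : ∀ b e, w b e → w' b e) {b h d} (hv : VU W w b h d) : VU W w' b h d := by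
  refine ⟨hv.1, fun d' h1 h2 => ?_⟩
  obtain ⟨e', h3, h4⟩ := hv.2 d' h1 h2
  exact ⟨e', hm _ _ h3, h4⟩

theorem Al.mono {w w' : P3 → ℤ → Prop} (hm : ∀ b e, w b e → w' b e) {p q} (h : Al W w p q) : Al W w' p q := by
  cases q with
  | sq k F D =>
    obtain ⟨b, c, ρ, h1, h2, h3, h4⟩ := h
    refine ⟨b, c, ρ, h1, h2, ?_, h4⟩
    rcases h3 with ⟨h3, e, h5, h6⟩ | ⟨h3, h5, h6, h7⟩
    · exact Or.inl ⟨h3, e, hm _ _ h5, h6⟩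
    · exact Or.inr ⟨h3, h5, h6.mono hm, h7⟩
  | tok d t l =>
    obtain ⟨b, c, h1, h2, h3, h4, h5, h6, h7, h8⟩ := h
    exact ⟨b, c, h1, h2, h3, h4, h5, h6, h7.mono hm, h8.mono hm⟩
  | nc ev tk l =>
    obtain ⟨b, c, h1, h2, h3, h4, h5, h6, h7, h8⟩ := h
    refine ⟨b, c, h1, h2, h3, h4, h5, h6, fun ht => ?_, h8.mono hm⟩
    refine ⟨(h7 ht).1, ?_⟩
    rcases (h7 ht).2 with h | h
    · exact Or.inl (VU.mono hm h)
    · exact Or.inr h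
  | bk win =>
    obtain ⟨b, c, e, h1, h2, h3, h4, h5, h6⟩ := h
    exact ⟨b, c, e, h1, h2, h3, h4, hm _ _ h5, h6⟩
  | wi =>
    obtain ⟨b, c, e, h1, h2, h3, h4, h5, h6, h7⟩ := h
    exact ⟨b, c, e, h1, h2, h3, h4, h5, h6, hm _ _ h7⟩
  | sel r f l =>
    obtain ⟨b, c, e, h1, h2, h3, h4, h5, h6, h7⟩ := h
    exact ⟨b, c, e, h1, h2, h3, h4, h5, hm _ _ h6, h7⟩
  | selodd l =>
    obtain ⟨b, c, e, h1, h2, h3, h4, h5, h6, h7⟩ := h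
    exact ⟨b, c, e, h1, h2, h3, h4, h5, hm _ _ h6, h7⟩
  | rw r =>
    obtain ⟨b, c, e, h1, h2, h3, h4, h5, h6, h7⟩ := h
    exact ⟨b, c, e, h1, h2, h3, h4, h5, hm _ _ h6, h7⟩
  | fil => exact h

variable (W)

def blk (p : P3) : P3 := fun i => p i / (8 * W.K)

theorem blk_pt {b : P3} {k : Kind} {c : P3} (hc : In W c) : blk W (pt W b k c) = fun i => b i + hom k i := by
  have hK := K_pos W
  funext i
  have h := hc i
  unfold blk pt hom
  have e1 : rho k i = 8 * (rho k i / 8) + rho k i % 8 := by omega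
  have e2 : 0 ≤ rho k i % 8 ∧ rho k i % 8 ≤ 7 := by omega
  generalize rho k i / 8 = u at *
  generalize rho k i % 8 = v at *
  rw [e1, Int.ediv_eq_iff_of_pos (by omega)]
  constructor <;> nlinarith [mul_nonneg (show (0:ℤ) ≤ W.K by omega) e2.1, mul_nonneg (show (0:ℤ) ≤ W.K by omega) (show 0 ≤ 7 - v by omega)]

theorem blk_pt0 {b : P3} {k : Kind} (hk : k.val ≤ 8) {c : P3} (hc : In W c) : blk W (pt W b k c) = b := by
  rw [blk_pt W hc]; funext i; rw [tab_hom0 hk]; ring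

theorem blk_ch {b : P3} {x : ℤ} (h0 : 0 ≤ x) (h1 : x < W.K) : blk W (ch W b x) = b :=
  blk_pt0 W (by decide) (In_ax W h0 h1)

def sc (b : P3) (e : ℤ) (p : P3) : Q :=
  if h : ∃ x : Kind × P3, 8 ≤ x.1.val ∧ In W x.2 ∧ p = pt W b x.1 x.2 then
    mk h.choose.1 (Gf W (fun x => W.Mb (x / 2) e)) h.choose.2
  else if h : ∃ x, 2 * e + 1 ≤ x ∧ x < W.K ∧ p = ch W b x then
    .nc (decide (h.choose % 2 = 0)) (decide (h.choose = 2 * e + 1)) (decide (W.K - 2 ≤ h.choose))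
  else .fil

def seedS (p : P3) : Option Q := (W.sd (blk W p)).map (fun e => sc W (blk W p) e p)

theorem sc_tree {b : P3} {e : ℤ} {k : Kind} {c : P3} (hk : 8 ≤ k.val) (hc : In W c) :
    sc W b e (pt W b k c) = mk k (Gf W (fun x => W.Mb (x / 2) e)) c := by
  have h : ∃ x : Kind × P3, 8 ≤ x.1.val ∧ In W x.2 ∧ pt W b k c = pt W b x.1 x.2 := ⟨(k, c), hk, hc, rfl⟩
  unfold sc
  rw [dif_pos h]
  obtain ⟨-, h1, h2⟩ := pt_inj W h.choose_spec.2.2 hc h.choose_spec.2.1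
  rw [← h1, ← h2]

theorem ch_inj {b b' : P3} {x x' : ℤ} (h : ch W b x = ch W b' x') (h0 : 0 ≤ x) (h1 : x < W.K) (h0' : 0 ≤ x')
    (h1' : x' < W.K) : b = b' ∧ x = x' := by
  obtain ⟨h1, -, h2⟩ := pt_inj W h (In_ax W h0 h1) (In_ax W h0' h1')
  exact ⟨h1, congrFun h2 0⟩

theorem sc_nc {b : P3} {e x : ℤ} (he : 0 ≤ e) (hx : 2 * e + 1 ≤ x) (hK : x < W.K) :
    sc W b e (ch W b x) = .nc (decide (x % 2 = 0)) (decide (x = 2 * e + 1)) (decide (W.K - 2 ≤ x)) := by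
  have h : ∃ x', 2 * e + 1 ≤ x' ∧ x' < W.K ∧ ch W b x = ch W b x' := ⟨x, hx, hK, rfl⟩
  unfold sc
  rw [dif_neg, dif_pos h]
  · have h2 := (ch_inj W h.choose_spec.2.2 (by omega) hK (by have := h.choose_spec.1; omega) h.choose_spec.2.1).2
    rw [← h2]
  · rintro ⟨⟨k, c⟩, h1, h2, h3⟩
    obtain ⟨-, h4, -⟩ := pt_inj W h3 (In_ax W (by omega) hK) h2
    dsimp only at h1 h4
    rw [← h4] at h1
    revert h1; decide

theorem seed_win {b : P3} {e : ℤ} (h : W.sd b = some e) : Win W (seedS W) b e := by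
  obtain ⟨h1, h2, -⟩ := W.hsd b e h
  have hKN : W.K = 2 * W.N := rfl
  have key : ∀ x, 2 * e + 1 ≤ x → x < W.K → seedS W (ch W b x) = some (.nc (decide (x % 2 = 0)) (decide (x = 2 * e + 1)) (decide (W.K - 2 ≤ x))) := by
    intro x hx hx'
    unfold seedS
    rw [blk_ch W (by omega) hx', h]
    simp only [Option.map_some]
    rw [sc_nc W (by omega) hx hx']
  refine ⟨h1, h2, ⟨decide (W.K - 2 ≤ 2 * e + 1), ?_⟩, fun x hx hx' => ⟨decide (x % 2 = 0), decide (W.K - 2 ≤ x), ?_⟩⟩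
  · rw [key _ (by omega) (by omega), decide_eq_true (show 2 * e + 1 = 2 * e + 1 from rfl),
      decide_eq_false (show ¬ (2 * e + 1) % 2 = 0 by omega)]
  · rw [key _ (by omega) (by omega), decide_eq_false (show ¬ x = 2 * e + 1 by omega)]

theorem seed_al {p : P3} {q : Q} (h : seedS W p = some q) : Al W (Win W (seedS W)) p q := by
  unfold seedS at h
  cases hs : W.sd (blk W p) with
  | none => rw [hs] at h; simp at h
  | some e =>
    rw [hs] at h
    simp only [Option.map_some, Option.some.injEq] at h
    have hw := seed_win W hs
    obtain ⟨h1, h2, -⟩ := W.hsd _ e hs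
    set b := blk W p with hb
    have hK := K_pos W
    have hKN : W.K = 2 * W.N := rfl
    by_cases hA : ∃ x : Kind × P3, 8 ≤ x.1.val ∧ In W x.2 ∧ p = pt W b x.1 x.2
    · obtain ⟨⟨k, c⟩, a1, a2, a3⟩ := hA
      dsimp only at a1 a2 a3
      rw [a3, sc_tree W a1 a2] at h
      rw [← h]
      exact ⟨b, c, _, a3, a2, Or.inl ⟨a1, e, hw, rfl⟩, rfl⟩
    · by_cases hB : ∃ x, 2 * e + 1 ≤ x ∧ x < W.K ∧ p = ch W b x
      · obtain ⟨x, a1, a2, a3⟩ := hB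
        rw [a3, sc_nc W (by omega) a1 a2] at h
        rw [← h]
        refine ⟨b, ax x, a3, In_ax W (by omega) a2, rfl, rfl, rfl, rfl, fun ht => ?_, Or.inl ⟨e, hw⟩⟩
        have : x = 2 * e + 1 := by simpa using ht
        refine ⟨?_, Or.inr (by rw [hs]; simp)⟩
        rw [decide_eq_false_iff_not]; omega
      · unfold sc at h
        rw [dif_neg hA, dif_neg hB] at h
        rw [← h]
        refine ⟨b, by rw [hs]; simp, fun i => ?_⟩
        have e1 : b i = p i / (8 * W.K) := rfl
        rw [e1]
        have := Int.emod_add_mul_ediv (p i) (8 * W.K)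
        have := Int.emod_nonneg (p i) (show 8 * W.K ≠ 0 by omega)
        have := Int.emod_lt_of_pos (p i) (show 0 < 8 * W.K by omega)
        constructor <;> linarith

inductive Just (w : P3 → ℤ → Prop) : P3 → ℤ → Prop
  | seed (b e) (hs : W.sd b = some e) (hw : w b e) : Just w b e
  | step (b e) (hs : W.sd b = none) (hw : w b e) (f : Fin 6 → ℤ) (h1 : ∃ d, W.Db e d = true)
      (h2 : ∀ d, W.Db e d = true → Just w (nb b (dirOf d)) (f d)) (h3 : ∀ d, W.Db e d = true → W.Mb e (f d) d = true) :
      Just w b e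

variable {W}

theorem Just.w {w b e} (h : Just W w b e) : w b e := by cases h <;> assumption

theorem Just.mono {w w' : P3 → ℤ → Prop} (hm : ∀ b e, w b e → w' b e) {b e} (h : Just W w b e) : Just W w' b e := by
  induction h with
  | seed b e hs hw => exact .seed b e hs (hm _ _ hw)
  | step b e hs hw f h1 h2 h3 ih => exact .step b e hs (hm _ _ hw) f h1 ih h3

abbrev cn (α : Config 3) : P3 → Option Q := cnt R1 α
abbrev win (W : World) (α : Config 3) : P3 → ℤ → Prop := Win W (cn α)

structure Inv (W : World) (α : Config 3) : Prop where
  wf : WF R1 R2 (seedS W) α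
  al : ∀ p q, cn α p = some q → Al W (win W α) p q
  just : ∀ b e, win W α b e → Just W (win W α) b e

theorem win_mono {α β : Config 3} (h : Extends α β) (b e) (hw : win W α b e) : win W β b e :=
  Win.mono (fun _ _ => cnt_mono R1 h) hw

theorem rule_r1 {r : Rule Q} {α : Config 3} {p} (h : IsRule R1 R2 r) (he : Enab R1 α p r) :
    (∃ f q, R1 f q r.1 ∧ cn α (nb p f) = some q) ∨
    (∃ f q g q2, R2 f q g q2 r.1 ∧ cn α (nb p f) = some q ∧ cn α (nb p g) = some q2) := by
  obtain ⟨c, ⟨f, q⟩, o⟩ := r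
  have h1 : cn α (nb p f) = some q := he f q (by simp [inp])
  cases o with
  | none => exact Or.inl ⟨f, q, h, h1⟩
  | some x =>
    obtain ⟨g, q2⟩ := x
    obtain ⟨h2, h3, -⟩ := h
    refine Or.inr ⟨f, q, g, q2, h2, h1, he g q2 ?_⟩
    simp [inp, Ne.symm h3]

theorem seed_cn {α : Config 3} (h : WF R1 R2 (seedS W) α) {p q} (hq : seedS W p = some q) : cn α p = some q :=
  cnt_mono R1 h.seed (by rw [cnt_seed]; exact hq)

theorem cell_rule {α : Config 3} (h : WF R1 R2 (seedS W) α) {p q} (hs : W.sd (blk W p) = none) (hq : cn α p = some q) :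
    ∃ r : Rule Q, IsRule R1 R2 r ∧ Enab R1 α p r ∧ r.1 = q := by
  have hn : seedS W p = none := by unfold seedS; rw [hs]; rfl
  cases ht : α p with
  | none => simp [cn, cnt, ht] at hq
  | some t =>
    obtain ⟨r, h1, h2, h3⟩ := h.rule p t hn ht
    refine ⟨r, h1, h3, ?_⟩
    simp only [cn, cnt, ht, Option.bind_some] at hq
    rw [h2, ct_rtile] at hq
    simpa using hq

theorem ndown {α : Config 3} (h : WF R1 R2 (seedS W) α) {w} (hal : ∀ p q, cn α p = some q → Al W w p q) {b : P3} {x : ℤ}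
    (hb : W.sd b = none) (h0 : 0 ≤ x) (h1 : x < W.K) {ev l} (hc : cn α (ch W b x) = some (.nc ev false l)) :
    1 ≤ x ∧ ∃ ev tk l, cn α (ch W b (x - 1)) = some (.nc ev tk l) := by
  obtain ⟨r, hr, he, hq⟩ := cell_rule h (by rw [blk_ch W h0 h1]; exact hb) hc
  have hKN : W.K = 2 * W.N := rfl
  have key : ∀ ev' tk' l', cn α (nb (ch W b x) (0, false)) = some (.nc ev' tk' l') → (ev' = true ∨ l' = false) →
      1 ≤ x ∧ ∃ ev tk l, cn α (ch W b (x - 1)) = some (.nc ev tk l) := by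
    intro ev' tk' l' hc hor
    obtain ⟨b', c1, hp, hin, a1, a2, a3, a4, -⟩ := hal _ _ hc
    have hin0 := hin 0
    have hne : c1 0 ≠ W.K - 1 := by
      rcases hor with rfl | rfl
      · have : c1 0 % 2 = 0 := by simpa using a3.symm
        omega
      · have : ¬ W.K - 2 ≤ c1 0 := by rw [eq_comm, decide_eq_false_iff_not] at a4; exact a4
        omega
    have i1 := In_nb W (t := 0) (e := false) hin (by simpa [en] using hne)
    obtain ⟨rfl, -, hcc⟩ := pt_inj W (inp_same W hp) (In_ax W h0 h1) i1
    have e0 := congrFun hcc 0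
    rw [ax0] at e0
    change x = nb c1 (0, true) 0 at e0
    rw [nbc] at e0
    change x = c1 0 + 1 at e0
    refine ⟨by omega, ev', tk', l', ?_⟩
    rw [hp, ax_eq a1 a2] at hc
    rw [show x - 1 = c1 0 by omega]
    exact hc
  rcases rule_r1 hr he with ⟨f, q, hh, hc1⟩ | ⟨f, q, g, q2, hh, hc1, hc2⟩
  · rw [hq] at hh
    cases hh with
    | nPass tk => exact key _ _ _ hc1 (Or.inl rfl)
  · rw [hq] at hh
    cases hh with
    | nEv tk k F D hk hg h1 => exact key _ _ _ hc1 (Or.inr rfl)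

theorem exists_win {α : Config 3} (h : WF R1 R2 (seedS W) α) {w} (hal : ∀ p q, cn α p = some q → Al W w p q) {b : P3}
    (hb : W.sd b = none) (n : ℕ) : ∀ x : ℤ, x = n → x < W.K → (∃ ev tk l, cn α (ch W b x) = some (.nc ev tk l)) →
    (∀ y, x < y → y < W.K → ∃ ev l, cn α (ch W b y) = some (.nc ev false l)) → ∃ e, win W α b e := by
  induction n with
  | zero =>
    rintro x hx hK ⟨ev, tk, l, hc⟩ hy
    cases tk with
    | false => have := (ndown h hal hb (by omega) hK hc).1; push_cast at hx; omega
    | true =>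
      obtain ⟨b', c1, hp, hin, a1, a2, a3, a4, a5, -⟩ := hal _ _ hc
      obtain ⟨-, -, hcc⟩ := pt_inj W hp (In_ax W (by omega) hK) hin
      have h1 := (a5 rfl).1
      rw [h1, eq_comm, decide_eq_false_iff_not, ← hcc, ax0] at a3
      push_cast at hx; omega
  | succ n ih =>
    rintro x hx hK ⟨ev, tk, l, hc⟩ hy
    push_cast at hx
    cases tk with
    | false =>
      refine ih (x - 1) (by omega) (by omega) (ndown h hal hb (by omega) hK hc).2 ?_
      intro y h1 h2
      by_cases hyx : y = x
      · rw [hyx]; exact ⟨ev, l, hc⟩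
      · exact hy y (by omega) h2
    | true =>
      obtain ⟨b', c1, hp, hin, a1, a2, a3, a4, a5, -⟩ := hal _ _ hc
      obtain ⟨rfl, -, hcc⟩ := pt_inj W hp (In_ax W (by omega) hK) hin
      have h1 := (a5 rfl).1
      have h2 : c1 0 = x := by rw [← hcc, ax0]
      rw [h1] at hc
      rw [h1, eq_comm, decide_eq_false_iff_not, h2] at a3
      have hKN : W.K = 2 * W.N := rfl
      have hx2 : x = 2 * (x / 2) + 1 := by omega
      refine ⟨x / 2, ?_, by omega, ⟨l, by rw [← hx2]; exact hc⟩, fun y hy1 hy2 => hy y (by omega) hy2⟩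
      rcases (a5 rfl).2 with hv | hv
      · obtain ⟨d, -, hd⟩ := hv.1
        rw [h2] at hd
        by_contra hlt
        have : x / 2 = 0 := by omega
        rw [this, W.D0] at hd; simp at hd
      · exact absurd hb hv

theorem inv_SH {α : Config 3} (h : WF R1 R2 (seedS W) α) {w} (hal : ∀ p q, cn α p = some q → Al W w p q) :
    SH W (cn α) (win W α) := by
  have hKN : W.K = 2 * W.N := rfl
  have hK := K_pos W
  refine ⟨fun b e hw => ⟨hw.1, hw.2.1⟩, fun b e e' h h' => h.uniq h', ?_, ?_⟩
  · intro b c ev tk l hin h0 h1 h2 hc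
    rw [ax_eq h1 h2] at hc
    cases hs : W.sd b with
    | some e => exact ⟨e, Win.mono (fun _ _ => seed_cn h) (seed_win W hs)⟩
    | none =>
      refine exists_win h hal hs (c 0).toNat (c 0) (by omega) (by omega) ⟨ev, tk, l, hc⟩ ?_
      intro y h1 h2; omega
  · intro b e c ev tk l hw hin h1 h2 hc hge
    rw [ax_eq h1 h2] at hc
    obtain ⟨-, -, ⟨l', h3⟩, h4⟩ := hw
    by_cases he : c 0 = 2 * e + 1
    · rw [← he] at h3
      change cn α (ch W b (c 0)) = _ at hc
      rw [h3] at hc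
      simp at hc
      simp [he, hc.2.1.symm]
    · obtain ⟨ev', l'', h5⟩ := h4 (c 0) (by omega) (hin 0).2
      change cn α (ch W b (c 0)) = _ at hc
      rw [h5] at hc
      simp at hc
      simp [he, hc.2.1.symm]

theorem cn_update {α : Config 3} {p : P3} {r : Rule Q} {p' q}
    (h : cn (Function.update α p (some (rtile R1 r))) p' = some q) : cn α p' = some q ∨ (p' = p ∧ q = r.1) := by
  by_cases hp' : p' = p
  · subst hp'
    right
    simp only [cn, cnt, Function.update_self, Option.bind_some, ct_rtile] at h
    exact ⟨rfl, by simpa using h.symm⟩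
  · left; simpa [cn, cnt, hp'] using h

theorem Inv.sound {α : Config 3} (h : Inv W α) {p : P3} {r : Rule Q} (hr : IsRule R1 R2 r)
    (he : Enab R1 α p r) : Al W (win W α) p r.1 := by
  have H := inv_SH h.wf h.al
  rcases rule_r1 hr he with ⟨f, q, hh, hc1⟩ | ⟨f, q, g, q2, hh, hc1, hc2⟩
  · exact R1_sound H hh hc1 (h.al _ _ hc1)
  · exact R2_sound H hh hc2 (h.al _ _ hc1) (h.al _ _ hc2)

/-- a newly resolved block is justified -/
theorem Inv.new {α : Config 3} (h : Inv W α) {p : P3} (hp : α p = none) {r : Rule Q} (hr : IsRule R1 R2 r)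
    (he : Enab R1 α p r) {b e} (hw : win W (Function.update α p (some (rtile R1 r))) b e) :
    win W α b e ∨ (W.sd b = none ∧ (∀ e, ¬ win W α b e) ∧ 1 ≤ e ∧ e < W.N ∧ Valid W (win W α) b e) := by
  by_cases hb : ∃ e', win W α b e'
  · obtain ⟨e', h'⟩ := hb
    have := Win.uniq (win_mono (extends_update hp _) _ _ h') hw
    rw [← this]; exact Or.inl h'
  · push Not at hb
    right
    have hs : W.sd b = none := by
      cases hs : W.sd b with
      | none => rfl
      | some e => exact absurd (Win.mono (fun _ _ => seed_cn h.wf) (seed_win W hs)) (hb e)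
    refine ⟨hs, hb, hw.1, hw.2.1, ?_⟩
    obtain ⟨l, hl⟩ := hw.2.2.1
    have hal : Al W (win W α) (ch W b (2 * e + 1)) (.nc false true l) := by
      rcases cn_update hl with h1 | ⟨h1, h2⟩
      · exact h.al _ _ h1
      · rw [h1, h2]; exact h.sound hr he
    have hKN : W.K = 2 * W.N := rfl
    have b1 := hw.1
    have b2 := hw.2.1
    obtain ⟨b', c1, hp, hin, a1, a2, a3, a4, a5, -⟩ := hal
    obtain ⟨rfl, -, hcc⟩ := pt_inj W hp (In_ax W (by omega) (by omega)) hin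
    rcases (a5 rfl).2 with hv | hv
    · have : c1 0 / 2 = e := by rw [← hcc, ax0]; omega
      rw [this] at hv; exact hv
    · exact absurd hs hv

theorem Inv.step {α : Config 3} (h : Inv W α) {p : P3} (hp : α p = none) {r : Rule Q} (hr : IsRule R1 R2 r)
    (he : Enab R1 α p r) : Inv W (Function.update α p (some (rtile R1 r))) := by
  have hm : ∀ b e, win W α b e → win W (Function.update α p (some (rtile R1 r))) b e :=
    win_mono (extends_update hp _)
  refine ⟨h.wf.step hp hr he, ?_, ?_⟩
  · intro p' q hq
    rcases cn_update hq with h1 | ⟨h1, h2⟩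
    · exact (h.al _ _ h1).mono hm
    · rw [h1, h2]; exact (h.sound hr he).mono hm
  · intro b e hw
    rcases h.new hp hr he hw with h1 | ⟨h1, h2, h3, h4, h5⟩
    · exact (h.just _ _ h1).mono hm
    · have : ∀ d, ∃ e', W.Db e d = true → win W α (nb b (dirOf d)) e' ∧ W.Mb e e' d = true := by
        intro d
        by_cases hd : W.Db e d = true
        · obtain ⟨e', h6⟩ := h5.2 d (by omega) hd
          exact ⟨e', fun _ => h6⟩
        · exact ⟨0, fun h => absurd h hd⟩
      choose f hf using this
      obtain ⟨d, -, hd⟩ := h5.1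
      exact .step b e h1 hw f ⟨d, hd⟩ (fun d hd => (h.just _ _ (hf d hd).1).mono hm) (fun d hd => (hf d hd).2)

theorem inv_seed : Inv W (seedcfg R1 (seedS W)) := by
  have e : cn (seedcfg R1 (seedS W)) = seedS W := by funext p; exact cnt_seed R1 _ p
  refine ⟨wf_seed R1 R2 _, ?_, ?_⟩
  · intro p q hq
    rw [e] at hq
    unfold win; rw [e]; exact seed_al W hq
  · intro b e' hw
    have hw' := hw
    unfold win at hw'; rw [e] at hw'
    cases hs : W.sd b with
    | some e2 =>
      have := Win.uniq hw' (seed_win W hs)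
      rw [this] at hw ⊢
      exact .seed b e2 hs hw
    | none =>
      exfalso
      have hKN : W.K = 2 * W.N := rfl
      obtain ⟨h1, h2, ⟨l, h3⟩, -⟩ := hw'
      unfold seedS at h3
      rw [blk_ch W (by omega) (by omega), hs] at h3
      simp at h3

theorem win_limit {f : ℕ → Config 3} (hm : ∀ n m, n ≤ m → Extends (f n) (f m)) {β : Config 3} (hl : Limit f β) {b e}
    (hw : win W β b e) : ∃ n, win W (f n) b e := by
  obtain ⟨h1, h2, ⟨l, h3⟩, h4⟩ := hw
  have key : ∀ p q, cn β p = some q → ∃ n, cn (f n) p = some q := by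
    intro p q hq
    cases ht : β p with
    | none => simp [cn, cnt, ht] at hq
    | some t =>
      obtain ⟨n, hn⟩ := (hl p t).mp ht
      exact ⟨n, by simpa [cn, cnt, ht, hn] using hq⟩
  obtain ⟨n0, hn0⟩ := key _ _ h3
  have : ∀ j : ℕ, ∃ n, ∀ x, 2 * e + 1 < x → x < W.K → x < j → ∃ ev l, cn (f n) (ch W b x) = some (.nc ev false l) := by
    intro j
    induction j with
    | zero => exact ⟨0, fun x hx _ h => by push_cast at h; omega⟩
    | succ j ih =>
      obtain ⟨n, hn⟩ := ih
      by_cases hj : 2 * e + 1 < (j : ℤ) ∧ (j : ℤ) < W.K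
      · obtain ⟨ev, l, h5⟩ := h4 j hj.1 hj.2
        obtain ⟨n1, hn1⟩ := key _ _ h5
        refine ⟨max n n1, fun x hx hx' hxj => ?_⟩
        by_cases hxe : x = j
        · rw [hxe]; exact ⟨ev, l, cnt_mono R1 (hm _ _ (le_max_right _ _)) hn1⟩
        · obtain ⟨ev, l, h6⟩ := hn x hx hx' (by push_cast at hxj; omega)
          exact ⟨ev, l, cnt_mono R1 (hm _ _ (le_max_left _ _)) h6⟩
      · refine ⟨n, fun x hx hx' hxj => hn x hx hx' ?_⟩
        push_cast at hxj
        by_contra hh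
        have : x = j := by omega
        rw [this] at hx hx'
        exact hj ⟨hx, hx'⟩
  obtain ⟨n1, hn1⟩ := this W.K.toNat
  refine ⟨max n0 n1, h1, h2, ⟨l, cnt_mono R1 (hm _ _ (le_max_left _ _)) hn0⟩, fun x hx hx' => ?_⟩
  obtain ⟨ev, l, h6⟩ := hn1 x hx hx' (by omega)
  exact ⟨ev, l, cnt_mono R1 (hm _ _ (le_max_right _ _)) h6⟩

theorem inv_limit {f : ℕ → Config 3} (hm : ∀ n m, n ≤ m → Extends (f n) (f m)) {β : Config 3} (hl : Limit f β)
    (h : ∀ n, Inv W (f n)) : Inv W β := by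
  have hmw : ∀ n b e, win W (f n) b e → win W β b e := fun n => win_mono (limit_ext hl n)
  refine ⟨WF.limit (fun n => (h n).wf) hl, ?_, ?_⟩
  · intro p q hq
    cases ht : β p with
    | none => simp [cn, cnt, ht] at hq
    | some t =>
      obtain ⟨n, hn⟩ := (hl p t).mp ht
      exact ((h n).al p q (by simpa [cn, cnt, ht, hn] using hq)).mono (hmw n)
  · intro b e hw
    obtain ⟨n, hn⟩ := win_limit hm hl hw
    exact ((h n).just _ _ hn).mono (hmw n)

end IU

namespace IU

variable {W : World}

/-! ### Liveness -/

structure Live (W : World) (δ : Config 3) : Prop where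
  inv : Inv W δ
  closed : ∀ p, δ p = none → ∀ r : Rule Q, IsRule R1 R2 r → Enab R1 δ p r → ∃ ev tk l, r.1 = .nc ev tk l

def Pres (δ : Config 3) (p : P3) : Prop := ∃ q, cn δ p = some q ∧ q ≠ .fil

theorem rule_fil {r : Rule Q} (h : IsRule R1 R2 r) : r.1 ≠ .fil := by
  obtain ⟨c, ⟨f, q⟩, o⟩ := r
  cases o with
  | none =>
    change R1 f q c at h
    rintro rfl
    cases h
  | some x =>
    obtain ⟨g, q2⟩ := x
    have h1 : R2 f q g q2 c := h.1
    rintro rfl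
    cases h1

theorem Live.pres_rule {δ : Config 3} (h : Live W δ) {p : P3} (hs : W.sd (blk W p) = none) {r : Rule Q}
    (hr : IsRule R1 R2 r) (he : Enab R1 δ p r) (hn : ∀ ev tk l, r.1 ≠ .nc ev tk l) : Pres δ p := by
  by_cases hp : δ p = none
  · obtain ⟨ev, tk, l, h1⟩ := h.closed p hp r hr he
    exact absurd h1 (hn _ _ _)
  · obtain ⟨q, hq⟩ := h.inv.wf.cnt_ne hp
    obtain ⟨r', h1, h2, h3⟩ := cell_rule h.inv.wf hs hq
    exact ⟨q, hq, by rw [← h3]; exact rule_fil h1⟩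

theorem en1 {α : Config 3} {p : P3} {f : Dir} {q c : Q} (h : cn α (nb p f) = some q) : Enab R1 α p (c, (f, q), none) := by
  intro g q' hg
  by_cases hgf : g = f
  · subst hgf; simp [inp] at hg; rw [← hg]; exact h
  · simp [inp, hgf] at hg

theorem en2 {α : Config 3} {p : P3} {f g : Dir} {q q2 c : Q} (h : cn α (nb p f) = some q)
    (h2 : cn α (nb p g) = some q2) : Enab R1 α p (c, (f, q), some (g, q2)) := by
  intro g' q' hg
  by_cases hgf : g' = f
  · subst hgf; simp [inp] at hg; rw [← hg]; exact h
  · by_cases hgg : g' = g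
    · subst hgg; simp [inp, hgf] at hg; rw [← hg]; exact h2
    · simp [inp, hgf, hgg] at hg

theorem Live.pres1 {δ : Config 3} (h : Live W δ) {p : P3} (hs : W.sd (blk W p) = none) {f q c} (hr : R1 f q c)
    (hn : ∀ ev tk l, c ≠ .nc ev tk l) (hq : cn δ (nb p f) = some q) : Pres δ p :=
  h.pres_rule hs (r := (c, (f, q), none)) hr (en1 hq) hn

theorem Live.pres2 {δ : Config 3} (h : Live W δ) {p : P3} (hs : W.sd (blk W p) = none) {f q g q2 c} (hr : R2 f q g q2 c)
    (hn : ∀ ev tk l, c ≠ .nc ev tk l) (hfg : f ≠ g) (hq : cn δ (nb p f) = some q) (hq2 : cn δ (nb p g) = some q2)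
    (n1 : ¬ Str R1 f q) (n2 : ¬ Str R1 g q2) : Pres δ p :=
  h.pres_rule hs (r := (c, (f, q), some (g, q2))) ⟨hr, hfg, n1, n2⟩ (en2 hq hq2) hn

theorem geo_uniq {t e k' k k2} (h : Ent t e k' k) (h2 : Ent t e k' k2) : k = k2 := by
  apply tab_mod
  intro i
  rw [tab_geo h i, tab_geo h2 i]
  omega

theorem Str_mk {t : Fin 3} {e : Bool} {k : Kind} {ρ} {c1 : P3} (h : Str R1 (t, e) (mk k (Gf W ρ) c1)) :
    (t ≠ pas k ∧ c1 (oth (pas k) t) = c1 t + sg (!e)) ∨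
    (∃ k2, Ent t (!e) k k2 ∧ k2 ≠ trunk ∧ c1 t = en W (!e) ∧ c1 (oth (pas k2) t) = en W e ∧ (k2.val < 6 → c1 0 % 2 = 0)) ∨
    (t = 0 ∧ k = trunk) ∨
    (∃ d, t = 1 ∧ e = false ∧ k = dock d ∧ c1 1 = W.K - 1 ∧ c1 0 % 2 = 1 ∧ ∀ d' < d, W.Db (c1 0 / 2) d' = false) := by
  obtain ⟨q, h⟩ := h
  generalize hq : mk k (Gf W ρ) c1 = q0 at h
  generalize hf : (t, e) = f at h
  cases h with
  | diagSame t' e' k' k0 F D h hD =>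
    obtain ⟨rfl, rfl⟩ := Prod.mk.inj hf
    obtain rfl : k = k0 := by unfold mk at hq; injection hq
    left
    have hp := (tab_ent h).pas
    refine ⟨hp, ?_⟩
    rw [mkD hq.symm hp (oth_ne hp).1] at hD
    have := cl_eq (by cases e <;> simp [sg]) hD
    linarith
  | diagCross t' e' k' k2 F D S h hk hF hS hE hu =>
    obtain ⟨rfl, rfl⟩ := Prod.mk.inj hf
    obtain rfl : k = k' := by unfold mk at hq; injection hq
    right; left
    have E := tab_ent h
    refine ⟨k2, h, hk, ?_, ?_, ?_⟩
    · rw [mkF hq.symm E.pas', atE_iff] at hF; exact hF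
    · rw [hS, mkF hq.symm (oth_ne E.pas').1, gs_cross h (c := c1) (c' := c1) (fun _ _ => rfl), atE_iff] at hE
      exact hE
    · intro h6
      have := hu h6
      rw [hS, mkF hq.symm (oth_ne E.pas').1] at this
      have hk15 : k.val < 15 := by have := (E.bus h6).2; omega
      rw [gs0 hk15] at this
      simp [Gf] at this
      omega
  | oddcopy k0 F D hk h =>
    obtain ⟨rfl, rfl⟩ := Prod.mk.inj hf
    obtain rfl : k = k0 := by unfold mk at hq; injection hq
    exact Or.inr (Or.inr (Or.inl ⟨rfl, hk⟩))
  | tokStart k0 d F D hk h1 h2 h3 h4 h5 h6 =>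
    obtain ⟨rfl, rfl⟩ := Prod.mk.inj hf
    obtain rfl : k = k0 := by unfold mk at hq; injection hq
    have h15 : k.val < 15 := by rw [hk]; simp only [dock]; omega
    have f1 := mkF0 h15 hq.symm (a := 1) (by decide)
    rw [f1] at h1 h3 h5
    refine Or.inr (Or.inr (Or.inr ⟨d, rfl, rfl, hk, ?_, ?_, ?_⟩))
    · simpa [Gf] using h1
    · simpa [Gf] using h3
    · intro d' hd; simpa [Gf] using h5 d' hd
  | nPass => unfold mk at hq; injection hq
  | nTake => unfold mk at hq; injection hq
  | bStart => unfold mk at hq; injection hq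
  | selOddR => unfold mk at hq; injection hq
  | selOddL => unfold mk at hq; injection hq

theorem nstr_same {t : Fin 3} {e : Bool} {k : Kind} {ρ} {c : P3} (hc : In W c) (ht : t ≠ pas k)
    (hne : c (oth (pas k) t) ≠ c t) : ¬ Str R1 (t, e) (mk k (Gf W ρ) (nb c (t, e))) := by
  intro h
  have o := oth_ne ht
  have h1 := nbc c t e
  have h2 := nbo c t e o.2.1
  have hK := hc t
  have hs : sg (!e) = - sg e := by cases e <;> rfl
  rcases Str_mk h with ⟨-, h⟩ | ⟨k2, -, -, h, -⟩ | ⟨h, h'⟩ | ⟨d, rfl, rfl, -, h, -⟩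
  · omega
  · rw [h1] at h; cases e <;> simp [sg, en] at h <;> omega
  · rw [h, h'] at ht; exact ht (tab_pas0 (by decide)).symm
  · rw [h1] at h; simp [sg] at h; omega

theorem nstr_cross {t : Fin 3} {e : Bool} {k' k : Kind} {ρ} {c1 : P3} (hc : In W c1) (hE : Ent t (!e) k' k)
    (h1 : c1 t = en W (!e)) (h2 : c1 (oth (pas k) t) ≠ en W e) (hu : k.val < 6 → c1 0 % 2 = 0) :
    ¬ Str R1 (t, e) (mk k' (Gf W ρ) c1) := by
  intro h
  have E := tab_ent hE
  rcases Str_mk h with ⟨-, h⟩ | ⟨k2, h3, -, h, h4, -⟩ | ⟨h, h'⟩ | ⟨d, rfl, rfl, h5, h, h6, -⟩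
  · have := hc (oth (pas k') t)
    rw [h, h1] at this
    cases e <;> simp [en, sg] at this
  · rw [geo_uniq hE h3] at h2; exact h2 h4
  · have := E.pas'
    rw [h', tab_pas0 (by decide)] at this
    exact this h
  · have hk : k = bus d := geo_uniq hE (by rw [h5]; exact (tab_dock d).1)
    have := hu (by rw [hk]; exact d.isLt)
    omega

theorem live_sq {δ : Config 3} (h : Live W δ) {b : P3} {k : Kind} {c : P3} (hc : In W c) (hk : 8 ≤ k.val ∨ k.val ≤ 6 ∧ c 0 % 2 = 0)
    (hp : Pres δ (pt W b k c)) : ∃ ρ, Cls W (win W δ) b k c ρ ∧ cn δ (pt W b k c) = some (mk k (Gf W ρ) c) := by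
  obtain ⟨q, hq, hf⟩ := hp
  have hal := h.inv.al _ _ hq
  have k7 : k ≠ chip := by rintro rfl; revert hk; simp [chip]
  cases q with
  | sq k2 F D =>
    obtain ⟨b', c', ρ, h1, h2, h3, h4⟩ := hal
    obtain ⟨rfl, rfl, rfl⟩ := pt_inj W h1 hc h2
    exact ⟨ρ, h3, by rw [hq, h4]⟩
  | tok d t l =>
    obtain ⟨b', c', h1, h2, h3, -⟩ := hal
    obtain ⟨rfl, rfl, rfl⟩ := pt_inj W h1 hc h2
    simp only [bus] at hk; omega
  | nc ev tk l =>
    obtain ⟨b', c', h1, h2, -⟩ := hal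
    exact absurd (pt_inj W h1 hc h2).2.1 k7
  | bk w =>
    obtain ⟨b', c', e, h1, h2, -⟩ := hal
    exact absurd (pt_inj W h1 hc h2).2.1 k7
  | wi =>
    obtain ⟨b', c', e, h1, h2, -⟩ := hal
    exact absurd (pt_inj W h1 hc h2).2.1 k7
  | sel r f l =>
    obtain ⟨b', c', e, h1, h2, -⟩ := hal
    exact absurd (pt_inj W h1 hc h2).2.1 k7
  | selodd l =>
    obtain ⟨b', c', e, h1, h2, -⟩ := hal
    exact absurd (pt_inj W h1 hc h2).2.1 k7
  | rw r =>
    obtain ⟨b', c', e, h1, h2, -⟩ := hal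
    exact absurd (pt_inj W h1 hc h2).2.1 k7
  | fil => exact absurd rfl hf

theorem live_tok {δ : Config 3} (h : Live W δ) {b : P3} {d : Fin 6} {c : P3} (hc : In W c) (ho : c 0 % 2 = 1)
    (hp : Pres δ (pt W b (bus d) c)) :
    cn δ (pt W b (bus d) c) = some (.tok d (decide (c 2 = W.K - 1)) (decide (c 0 = W.K - 1))) := by
  obtain ⟨q, hq, hf⟩ := hp
  have hal := h.inv.al _ _ hq
  have k7 : bus d ≠ chip := by intro h; have := congrArg Fin.val h; simp only [bus] at this; change d.val = 7 at this; omega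
  cases q with
  | sq k2 F D =>
    obtain ⟨b', c', ρ, h1, h2, h3, h4⟩ := hal
    obtain ⟨rfl, rfl, rfl⟩ := pt_inj W h1 hc h2
    have := (bus_par (by simp only [bus]; omega) h3).1
    omega
  | tok d t l =>
    obtain ⟨b', c', h1, h2, h3, h4, h5, h6, -⟩ := hal
    obtain ⟨rfl, hb, rfl⟩ := pt_inj W h1 hc h2
    have := congrArg Fin.val hb
    simp only [bus] at this
    obtain rfl := Fin.ext this
    rw [hq, h5, h6]
  | nc ev tk l =>
    obtain ⟨b', c', h1, h2, -⟩ := hal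
    exact absurd (pt_inj W h1 hc h2).2.1 k7
  | bk w =>
    obtain ⟨b', c', e, h1, h2, -⟩ := hal
    exact absurd (pt_inj W h1 hc h2).2.1 k7
  | wi =>
    obtain ⟨b', c', e, h1, h2, -⟩ := hal
    exact absurd (pt_inj W h1 hc h2).2.1 k7
  | sel r f l =>
    obtain ⟨b', c', e, h1, h2, -⟩ := hal
    exact absurd (pt_inj W h1 hc h2).2.1 k7
  | selodd l =>
    obtain ⟨b', c', e, h1, h2, -⟩ := hal
    exact absurd (pt_inj W h1 hc h2).2.1 k7
  | rw r =>
    obtain ⟨b', c', e, h1, h2, -⟩ := hal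
    exact absurd (pt_inj W h1 hc h2).2.1 k7
  | fil => exact absurd rfl hf

theorem live_chip {δ : Config 3} (h : Live W δ) {b : P3} {e : ℤ} (hw : win W δ b e) {c : P3} (hc : In W c) (h1 : 1 ≤ c 1)
    (hp : Pres δ (pt W b chip c)) :
    (cn δ (pt W b chip c) = some (.bk (decide (c 0 = 2 * e + 1))) ∧ c 1 = 1 ∧ 2 * e + 1 ≤ c 0) ∨
    (cn δ (pt W b chip c) = some .wi ∧ c 0 = 2 * e ∧ c 1 < 2 * e) ∨
    (cn δ (pt W b chip c) = some (.sel (W.Mb (c 0 / 2) e) (decide (c 0 = 0)) (decide (c 0 + 2 = W.K))) ∧ c 0 % 2 = 0 ∧ c 1 = 2 * e) ∨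
    (cn δ (pt W b chip c) = some (.selodd (decide (c 0 = W.K - 1))) ∧ c 0 % 2 = 1 ∧ c 1 = 2 * e) ∨
    (cn δ (pt W b chip c) = some (.rw (W.Mb (c 0 / 2) e)) ∧ c 0 % 2 = 0 ∧ 2 * e < c 1) := by
  obtain ⟨q, hq, hf⟩ := hp
  have hal := h.inv.al _ _ hq
  cases q with
  | sq k2 F D =>
    obtain ⟨b', c', ρ, h1, h2, h3, h4⟩ := hal
    obtain ⟨rfl, rfl, rfl⟩ := pt_inj W h1 hc h2
    rcases h3 with h3 | h3
    · exact absurd h3.1 (by decide)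
    · exact absurd h3.1 (by decide)
  | tok d t l =>
    obtain ⟨b', c', h1, h2, h3, -⟩ := hal
    obtain ⟨-, hb, -⟩ := pt_inj W h1 hc h2
    have := congrArg Fin.val hb
    simp only [bus] at this; change 7 = d.val at this; omega
  | nc ev tk l =>
    obtain ⟨b', c', h1, h2, h3, -⟩ := hal
    obtain ⟨rfl, -, rfl⟩ := pt_inj W h1 hc h2
    omega
  | bk w =>
    obtain ⟨b', c', e', h1, h2, h3, h4, h5, h6, h7⟩ := hal
    obtain ⟨rfl, -, rfl⟩ := pt_inj W h1 hc h2
    obtain rfl := Win.uniq hw h5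
    exact Or.inl ⟨by rw [hq, h7], h3, h6⟩
  | wi =>
    obtain ⟨b', c', e', h1, h2, h3, h4, h5, h6, h7⟩ := hal
    obtain ⟨rfl, -, rfl⟩ := pt_inj W h1 hc h2
    obtain rfl := Win.uniq hw h7
    exact Or.inr (Or.inl ⟨by rw [hq], h3, h5⟩)
  | sel r f l =>
    obtain ⟨b', c', e', h1, h2, h3, h4, h5, h6, h7, h8, h9⟩ := hal
    obtain ⟨rfl, -, rfl⟩ := pt_inj W h1 hc h2
    obtain rfl := Win.uniq hw h6
    exact Or.inr (Or.inr (Or.inl ⟨by rw [hq, h7, h8, h9], h3, h4⟩))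
  | selodd l =>
    obtain ⟨b', c', e', h1, h2, h3, h4, h5, h6, h7⟩ := hal
    obtain ⟨rfl, -, rfl⟩ := pt_inj W h1 hc h2
    obtain rfl := Win.uniq hw h6
    exact Or.inr (Or.inr (Or.inr (Or.inl ⟨by rw [hq, h7], h3, h4⟩)))
  | rw r =>
    obtain ⟨b', c', e', h1, h2, h3, h4, h5, h6, h7⟩ := hal
    obtain ⟨rfl, -, rfl⟩ := pt_inj W h1 hc h2
    obtain rfl := Win.uniq hw h6
    exact Or.inr (Or.inr (Or.inr (Or.inr ⟨by rw [hq, h7], h3, h4⟩)))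
  | fil => exact absurd rfl hf

end IU

namespace IU

variable {W : World}

theorem mkq_nc {k t T S z} : ∀ ev tk l, mkq k t T S z ≠ .nc ev tk l := by
  intro ev tk l h; unfold mkq at h; injection h

theorem mk_sq (k : Kind) (g c) : ∃ F D, mk k g c = .sq k F D := ⟨_, _, rfl⟩

theorem ent_src {t e k' k} (h : Ent t e k' k) : 8 ≤ k'.val ∨ (k'.val ≤ 6 ∧ k.val ≤ 8) := by
  have E := tab_ent h
  by_cases h9 : 9 ≤ k.val
  · exact Or.inl (E.tree h9)
  · by_cases h8 : k = trunk
    · have := (E.trunk h8).2.2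
      right; rw [this]; exact ⟨by decide, by omega⟩
    · by_cases h7 : k = branch
      · have := (E.branch h7).2.2
        right; rw [this]; exact ⟨by decide, by omega⟩
      · have h5 : k ≠ chip := E.chip
        have a1 : k.val ≠ 8 := fun h => h8 (Fin.ext h)
        have a2 : k.val ≠ 6 := fun h => h7 (Fin.ext h)
        have a3 : k.val ≠ 7 := fun h => h5 (Fin.ext h)
        have := (E.bus (by omega)).2
        omega

theorem sg_cases (e : Bool) : (sg e = 1 ∧ sg (!e) = -1) ∨ (sg e = -1 ∧ sg (!e) = 1) := by cases e <;> simp [sg]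

theorem fill_sq {δ : Config 3} (h : Live W δ) {t e k' k} (hE : Ent t (!e) k' k) {b : P3}
    (hs : W.sd (fun i => b i + hom k i) = none)
    (hsrc : ∀ c1, In W c1 → c1 t = en W (!e) → (k.val ≤ 8 → c1 0 % 2 = 0) → Pres δ (pt W (fun i => b i + shv k' k i) k' c1))
    (hcor : ∀ c, In W c → (k.val ≤ 8 → c 0 % 2 = 0) → c t = en W e → c (oth (pas k) t) = en W e → Pres δ (pt W b k c)) :
    ∀ c, In W c → (k.val ≤ 8 → c 0 % 2 = 0) → Pres δ (pt W b k c) := by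
  have E := tab_ent hE
  have hK := K_pos W
  obtain ⟨o1, o2, -⟩ := oth_ne E.pas
  obtain ⟨o1', o2', -⟩ := oth_ne E.pas'
  have oo : oth (pas k) (oth (pas k) t) = t := oth_oth
  set s := oth (pas k) t with hsd
  have h7 : k.val ≠ 7 := fun h => E.chip (Fin.ext h)
  have p0 : k.val ≤ 8 → t ≠ 0 ∧ s ≠ 0 := by
    intro h8
    have := tab_pas0 (k := k) (by omega)
    rw [← this]; exact ⟨E.pas, o1⟩
  have hsb : ∀ c, In W c → W.sd (blk W (pt W b k c)) = none := fun c hc => by rw [blk_pt W hc]; exact hs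
  have hsq : ∀ c, In W c → (k.val ≤ 8 → c 0 % 2 = 0) → Pres δ (pt W b k c) →
      ∃ ρ F D, cn δ (pt W b k c) = some (.sq k F D) ∧ Q.sq k F D = mk k (Gf W ρ) c := by
    intro c hc hp hP
    obtain ⟨ρ, -, h2⟩ := live_sq h hc (k := k) (by
      by_cases h8 : 8 ≤ k.val
      · exact Or.inl h8
      · exact Or.inr ⟨by omega, hp (by omega)⟩) hP
    obtain ⟨F, D, h3⟩ := mk_sq k (Gf W ρ) c
    exact ⟨ρ, F, D, by rw [h2, h3], h3.symm⟩
  have sne : ∀ ε : Bool, sg (!ε) = - sg ε := fun ε => by cases ε <;> rfl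
  have hen : en W e = if e then W.K - 1 else 0 := rfl
  -- first row
  have A : ∀ n : ℕ, ∀ c, In W c → (k.val ≤ 8 → c 0 % 2 = 0) → c t = en W e → c s - en W e = sg (!e) * n → Pres δ (pt W b k c) := by
    intro n
    induction n with
    | zero => intro c hc hp ht hn; exact hcor c hc hp ht (by push_cast at hn; linarith)
    | succ n ih =>
      intro c hc hp ht hn
      have c2s : nb c (s, e) s = c s + sg e := nbc c s e
      have c2o : ∀ i, i ≠ s → nb c (s, e) i = c i := fun i hi => nbo c s e hi
      push_cast at hn
      have hn2 : nb c (s, e) s - en W e = sg (!e) * n := by rw [c2s]; rw [sne] at hn ⊢; linarith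
      have hin2 : In W (nb c (s, e)) := by
        have := In_nb W hc (t := s) (e := !e) (by
          rw [Bool.not_not]; intro hh; rw [hh] at hn; cases e <;> simp [sg] at hn <;> omega)
        rwa [Bool.not_not] at this
      have hp2 : k.val ≤ 8 → nb c (s, e) 0 % 2 = 0 := fun h8 => by rw [c2o 0 (p0 h8).2.symm]; exact hp h8
      have P2 := ih _ hin2 hp2 (by rw [c2o t o2.symm]; exact ht) hn2
      obtain ⟨ρ2, F2, D2, q2, m2⟩ := hsq _ hin2 hp2 P2
      have cpos := nb_cross W (shv k' k) (tab_geo hE) b c ht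
      set c1 := Function.update c t (en W (!e)) with hc1
      have hin1 : In W c1 := In_upd W hc t (!e)
      have c1t : c1 t = en W (!e) := by simp [hc1]
      have c1o : ∀ i, i ≠ t → c1 i = c i := fun i hi => by simp [hc1, hi]
      have hp1 : k.val ≤ 8 → c1 0 % 2 = 0 := fun h8 => by rw [c1o 0 (p0 h8).1.symm]; exact hp h8
      have P1 := hsrc c1 hin1 c1t hp1
      obtain ⟨ρ1, -, q1⟩ := live_sq h hin1 (k := k') (by
        rcases ent_src hE with h8 | ⟨h8, h9⟩
        · exact Or.inl h8
        · exact Or.inr ⟨h8, hp1 h9⟩) P1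
      obtain ⟨F1, D1, m1⟩ := mk_sq k' (Gf W ρ1) c1
      have hse : c s ≠ en W e := by intro hh; rw [hh] at hn; cases e <;> simp [sg] at hn <;> omega
      have gsE : F1 (oth (pas k') t) = gs k (Gf W ρ1) c1 s := by
        rw [mkF m1.symm o1', gs_cross hE (c := c1) (c' := c1) (fun _ _ => rfl)]
      refine h.pres2 (hsb c hc) (f := (t, e)) (g := (s, e)) (R2.sideCross t e k' k s F1 D1 F2 D2 _ hE hsd ?_ rfl ?_ ?_ ?_ ?_ ?_)
        mkq_nc ?_ ?_ ?_ ?_ ?_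
      · rw [mkF m1.symm E.pas', atE_iff]; exact c1t
      · rw [gsE, atE_iff', c1o s o2]; exact hse
      · intro h6
        rw [gsE, gs0 (by omega)]
        have := hp1 (by omega)
        simp [Gf]; omega
      · rw [mkF m2 o1, atE_iff', c2s]
        have := hc s
        have := hen
        cases e <;> simp [sg, en] <;> omega
      · rw [mkF m2 E.pas, atE_iff, c2o t o2.symm]; exact ht
      · rw [mkD m2 E.pas o1, c2o t o2.symm, ht, hn2, cl_val]
        rcases sg_cases e with ⟨-, a⟩ | ⟨-, a⟩ <;> rw [a] <;> omega
      · intro hh; exact o2 (Prod.mk.inj hh).1.symm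
      · rw [cpos, q1, m1]
      · rw [pt_nb]; exact q2
      · rw [← m1]
        exact nstr_cross hin1 hE c1t (by rw [← hsd, c1o s o2]; exact hse) (fun h6 => hp1 (by omega))
      · rw [m2]
        refine nstr_same hc o1 ?_
        rw [oo, ht]; exact hse.symm
  -- all rows
  have B : ∀ m : ℕ, ∀ c, In W c → (k.val ≤ 8 → c 0 % 2 = 0) → c t - en W e = sg (!e) * m → Pres δ (pt W b k c) := by
    intro m
    induction m with
    | zero =>
      intro c hc hp ht
      refine A (c s - en W e).natAbs c hc hp (by push_cast at ht; linarith) ?_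
      have := hc s
      cases e <;> simp [en, sg, -Nat.cast_natAbs] <;> omega
    | succ m ih =>
      have row : ∀ c, In W c → (k.val ≤ 8 → c 0 % 2 = 0) → c t - en W e = sg (!e) * (m + 1 : ℕ) →
          In W (nb c (t, e)) ∧ (k.val ≤ 8 → nb c (t, e) 0 % 2 = 0) ∧ nb c (t, e) t ≠ en W (!e) ∧
          Pres δ (pt W b k (nb c (t, e))) := by
        intro c hc hp ht
        push_cast at ht
        have hin2 : In W (nb c (t, e)) := by
          have := In_nb W hc (t := t) (e := !e) (by
            rw [Bool.not_not]; intro hh; rw [hh] at ht; cases e <;> simp [sg] at ht <;> omega)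
          rwa [Bool.not_not] at this
        have hp2 : k.val ≤ 8 → nb c (t, e) 0 % 2 = 0 := fun h8 => by rw [nbo c t e (p0 h8).1.symm]; exact hp h8
        refine ⟨hin2, hp2, ?_, ih _ hin2 hp2 ?_⟩
        · rw [nbc]; have := hc t
          cases e <;> simp [sg, en] <;> omega
        · rw [nbc]; rw [sne] at ht ⊢; linarith
      have C : ∀ j : ℕ, ∀ ε : Bool, ∀ c, In W c → (k.val ≤ 8 → c 0 % 2 = 0) → c t - en W e = sg (!e) * (m + 1 : ℕ) →
          c s - c t = sg (!ε) * j → Pres δ (pt W b k c) := by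
        intro j
        induction j with
        | zero =>
          intro ε c hc hp ht hj
          obtain ⟨hin1, hp1, hne, P1⟩ := row c hc hp ht
          obtain ⟨ρ1, F1, D1, q1, m1⟩ := hsq _ hin1 hp1 P1
          refine h.pres1 (hsb c hc) (f := (t, e)) (R1.diagSame t e k' k F1 D1 hE ?_) mkq_nc ?_
          · rw [← hsd, mkD m1 E.pas o1, nbc, nbo c t e o2]
            congr 1
            rw [sne]; push_cast at hj; linarith
          · rw [pt_nb]; exact q1
        | succ j ihj =>
          intro ε c hc hp ht hj
          obtain ⟨hin1, hp1, hne, P1⟩ := row c hc hp ht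
          obtain ⟨ρ1, F1, D1, q1, m1⟩ := hsq _ hin1 hp1 P1
          push_cast at hj
          have ht' := hc t
          have hs' := hc s
          have c2s : nb c (s, ε) s = c s + sg ε := nbc c s ε
          have c2o : ∀ i, i ≠ s → nb c (s, ε) i = c i := fun i hi => nbo c s ε hi
          have hj2 : nb c (s, ε) s - nb c (s, ε) t = sg (!ε) * j := by
            rw [c2s, c2o t o2.symm]; rw [sne] at hj ⊢; linarith
          have hin2 : In W (nb c (s, ε)) := by
            have := In_nb W hc (t := s) (e := !ε) (by
              rw [Bool.not_not]; intro hh; rw [hh] at hj; cases ε <;> simp [sg, en] at hj <;> omega)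
            rwa [Bool.not_not] at this
          have hp2 : k.val ≤ 8 → nb c (s, ε) 0 % 2 = 0 := fun h8 => by rw [c2o 0 (p0 h8).2.symm]; exact hp h8
          have P2 := ihj ε _ hin2 hp2 (by rw [c2o t o2.symm]; exact ht) hj2
          obtain ⟨ρ2, F2, D2, q2, m2⟩ := hsq _ hin2 hp2 P2
          have hst : c s ≠ c t := by intro hh; rw [hh] at hj; cases ε <;> simp [sg] at hj <;> omega
          refine h.pres2 (hsb c hc) (f := (t, e)) (g := (s, ε)) (R2.sideSame t e k' k s ε F1 D1 F2 D2 hE hsd ?_ ?_ ?_)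
            mkq_nc ?_ ?_ ?_ ?_ ?_
          · rw [mkF m1 E.pas, atE_iff']; exact hne
          · rw [mkF m2 o1, atE_iff', c2s]
            cases ε <;> simp [sg, en] <;> omega
          · rw [mkD m2 E.pas o1, hj2, cl_val]
            rcases sg_cases ε with ⟨-, a⟩ | ⟨-, a⟩ <;> rw [a] <;> omega
          · intro hh; exact o2 (Prod.mk.inj hh).1.symm
          · rw [pt_nb]; exact q1
          · rw [pt_nb]; exact q2
          · rw [m1]; exact nstr_same hc E.pas hst
          · rw [m2]
            refine nstr_same hc o1 ?_
            rw [oo]; exact hst.symm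
      intro c hc hp ht
      refine C (c s - c t).natAbs (decide (c s < c t)) c hc hp ht ?_
      by_cases hlt : c s < c t
      · rw [decide_eq_true hlt]; simp [sg, -Nat.cast_natAbs]; omega
      · rw [decide_eq_false hlt]; simp [sg, -Nat.cast_natAbs]; omega
  intro c hc hp
  refine B (c t - en W e).natAbs c hc hp ?_
  have := hc t
  cases e <;> simp [en, sg, -Nat.cast_natAbs] <;> omega

theorem fill_kind {δ : Config 3} (h : Live W δ) {t e k' k} (hE : Ent t (!e) k' k) (hk : k ≠ trunk) {b : P3}
    (hs : W.sd (fun i => b i + hom k i) = none)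
    (hsrc : ∀ c1, In W c1 → c1 t = en W (!e) → (k.val ≤ 8 → c1 0 % 2 = 0) → Pres δ (pt W (fun i => b i + shv k' k i) k' c1)) :
    ∀ c, In W c → (k.val ≤ 8 → c 0 % 2 = 0) → Pres δ (pt W b k c) := by
  have E := tab_ent hE
  obtain ⟨o1, o2, -⟩ := oth_ne E.pas
  obtain ⟨o1', o2', -⟩ := oth_ne E.pas'
  refine fill_sq h hE hs hsrc ?_
  intro c hc hp ht hst
  have cpos := nb_cross W (shv k' k) (tab_geo hE) b c ht
  set c1 := Function.update c t (en W (!e)) with hc1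
  have hin1 : In W c1 := In_upd W hc t (!e)
  have c1t : c1 t = en W (!e) := by simp [hc1]
  have c1o : ∀ i, i ≠ t → c1 i = c i := fun i hi => by simp [hc1, hi]
  have hp1 : k.val ≤ 8 → c1 0 % 2 = 0 := fun h8 => by
    have := tab_pas0 (k := k) (by omega)
    rw [c1o 0 (by rw [← this]; exact E.pas.symm)]; exact hp h8
  have P1 := hsrc c1 hin1 c1t hp1
  obtain ⟨ρ1, -, q1⟩ := live_sq h hin1 (k := k') (by
    rcases ent_src hE with h8 | ⟨h8, h9⟩
    · exact Or.inl h8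
    · exact Or.inr ⟨h8, hp1 h9⟩) P1
  obtain ⟨F1, D1, m1⟩ := mk_sq k' (Gf W ρ1) c1
  have gsE : F1 (oth (pas k') t) = gs k (Gf W ρ1) c1 (oth (pas k) t) := by
    rw [mkF m1.symm o1', gs_cross hE (c := c1) (c' := c1) (fun _ _ => rfl)]
  refine h.pres1 (by rw [blk_pt W hc]; exact hs) (f := (t, e)) (R1.diagCross t e k' k F1 D1 _ hE hk ?_ rfl ?_ ?_) mkq_nc ?_
  · rw [mkF m1.symm E.pas', atE_iff]; exact c1t
  · rw [gsE, atE_iff, c1o _ o2]; exact hst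
  · intro h6
    rw [gsE, gs0 (by omega)]
    have := hp1 (by omega)
    simp [Gf]; omega
  · rw [cpos, q1, m1]

end IU

namespace IU

variable {W : World}

def v3 (x y z : ℤ) : P3 := ![x, y, z]
theorem v30 (x y z : ℤ) : v3 x y z 0 = x := rfl
theorem v31 (x y z : ℤ) : v3 x y z 1 = y := rfl
theorem v32 (x y z : ℤ) : v3 x y z 2 = z := rfl
theorem v3_ext {c : P3} {x y z : ℤ} (h0 : c 0 = x) (h1 : c 1 = y) (h2 : c 2 = z) : c = v3 x y z :=
  funext (all3 h0 h1 h2)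
theorem v3_eta (c : P3) : c = v3 (c 0) (c 1) (c 2) := v3_ext rfl rfl rfl
theorem nb0 (x y z : ℤ) (e : Bool) : nb (v3 x y z) (0, e) = v3 (x + sg e) y z :=
  v3_ext (nbc _ _ _) (nbo _ _ _ (by decide)) (nbo _ _ _ (by decide))
theorem nb1 (x y z : ℤ) (e : Bool) : nb (v3 x y z) (1, e) = v3 x (y + sg e) z :=
  v3_ext (nbo _ _ _ (by decide)) (nbc _ _ _) (nbo _ _ _ (by decide))
theorem nb2 (x y z : ℤ) (e : Bool) : nb (v3 x y z) (2, e) = v3 x y (z + sg e) :=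
  v3_ext (nbo _ _ _ (by decide)) (nbo _ _ _ (by decide)) (nbc _ _ _)
theorem upd1 (x y z u : ℤ) : Function.update (v3 x y z) 1 u = v3 x u z := v3_ext rfl rfl rfl
theorem upd2 (x y z u : ℤ) : Function.update (v3 x y z) 2 u = v3 x y u := v3_ext rfl rfl rfl
theorem ax_v3 (x : ℤ) : ax x = v3 x 0 0 := v3_ext rfl rfl rfl
theorem In_v3 {x y z : ℤ} (h1 : 0 ≤ x) (h2 : x < W.K) (h3 : 0 ≤ y) (h4 : y < W.K) (h5 : 0 ≤ z) (h6 : z < W.K) :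
    In W (v3 x y z) := all3 (P := fun i => 0 ≤ v3 x y z i ∧ v3 x y z i < W.K) ⟨h1, h2⟩ ⟨h3, h4⟩ ⟨h5, h6⟩
theorem In3 {c : P3} (hc : In W c) : (0 ≤ c 0 ∧ c 0 < W.K) ∧ (0 ≤ c 1 ∧ c 1 < W.K) ∧ (0 ≤ c 2 ∧ c 2 < W.K) :=
  ⟨hc 0, hc 1, hc 2⟩

theorem add_hom0 {b : P3} {k : Kind} (hk : k.val ≤ 8) : (fun i => b i + hom k i) = b := by
  funext i; rw [tab_hom0 hk]; ring

theorem live_bus {δ : Config 3} (h : Live W δ) {B : P3} {d0 : Fin 6} (hB : W.sd B = none)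
    (hd : ∀ c, In W c → Pres δ (pt W (nb B (dirOf d0)) (dock d0) c)) (n : ℕ) :
    ∀ d : Fin 6, d.val = d0.val + n → ∀ c, In W c → c 0 % 2 = 0 → Pres δ (pt W B (bus d) c) := by
  have h8 : ∀ d : Fin 6, (bus d).val ≤ 8 := fun d => by simp only [bus]; omega
  have ht : ∀ d : Fin 6, bus d ≠ trunk := fun d hh => by
    have := congrArg Fin.val hh; simp only [bus] at this; change d.val = 8 at this; omega
  induction n with
  | zero =>
    intro d hdd c hc hp
    obtain rfl : d = d0 := Fin.ext (by omega)
    refine fill_kind h (e := false) (tab_dock d).1 (ht d) (by rw [add_hom0 (h8 d)]; exact hB) ?_ c hc (fun _ => hp)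
    intro c1 h1 _ _
    have : (fun i => B i + shv (dock d) (bus d) i) = nb B (dirOf d) := by
      funext i; rw [nb_apply, shv_bus]
    rw [this]; exact hd c1 h1
  | succ n ih =>
    intro d hdd c hc hp
    have ih' := ih ⟨d0.val + n, by omega⟩ rfl
    refine fill_kind h (e := false) (tab_bus (d := ⟨d0.val + n, by omega⟩) (d' := d) (by simp; omega)) (ht d)
      (by rw [add_hom0 (h8 d)]; exact hB) ?_ c hc (fun _ => hp)
    intro c1 h1 _ h3
    have : (fun i => B i + shv (bus ⟨d0.val + n, by omega⟩) (bus d) i) = B := by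
      funext i; rw [shv_zero (fun _ => by simp only [bus]; omega)]; ring
    rw [this]; exact ih' c1 h1 (h3 (h8 d))

theorem live_branch {δ : Config 3} (h : Live W δ) {b : P3} (hb : W.sd b = none)
    (hbus : ∀ c, In W c → c 0 % 2 = 0 → Pres δ (pt W b (bus 5) c)) :
    ∀ c, In W c → c 0 % 2 = 0 → Pres δ (pt W b branch c) := by
  intro c hc hp
  refine fill_kind h (e := false) tab_branch (by decide) (by rw [add_hom0 (by decide)]; exact hb) ?_ c hc (fun _ => hp)
  intro c1 h1 _ h3
  have : (fun i => b i + shv (bus 5) branch i) = b := by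
    funext i; rw [shv_zero (fun _ => by decide)]; ring
  rw [this]; exact hbus c1 h1 (h3 (by decide))

theorem chip_src {δ : Config 3} (h : Live W δ) {b : P3}
    (hbus : ∀ c, In W c → c 0 % 2 = 0 → Pres δ (pt W b (bus 5) c)) {x y : ℤ} (hx : 0 ≤ x) (hx' : x < W.K)
    (hy : 0 ≤ y) (hy' : y < W.K) (hp : x % 2 = 0) :
    ∃ ρ F D, cn δ (nb (pt W b chip (v3 x y 0)) (2, false)) = some (.sq (bus 5) F D) ∧ F 1 = Gf W ρ x y ∧
      (F 2).vl = true ∧ ¬ Str R1 (2, false) (.sq (bus 5) F D) := by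
  have hK := K_pos W
  have hin : In W (v3 x y (W.K - 1)) := In_v3 hx hx' hy hy' (by omega) (by omega)
  obtain ⟨ρ, -, hq⟩ := live_sq h hin (k := bus 5) (Or.inr ⟨by decide, hp⟩) (hbus _ hin hp)
  obtain ⟨F, D, m⟩ := mk_sq (bus 5) (Gf W ρ) (v3 x y (W.K - 1))
  refine ⟨ρ, F, D, ?_, mkF0 (by decide) m.symm (by decide), ?_, ?_⟩
  · rw [nb_cross0 W geo_chip b _ (by rfl), upd2]
    rw [m] at hq; exact hq
  · rw [mkF0 (by decide) m.symm (by decide)]; simp [Gf, v32]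
  · rw [← m]
    intro hs
    rcases Str_mk hs with ⟨-, h1⟩ | ⟨k2, h1, -⟩ | ⟨h1, -⟩ | ⟨d, h1, -⟩
    · rw [tab_pas0 (by decide), oth02, v31, v32] at h1; simp [sg] at h1; omega
    · have : k2 = chip := by
        apply tab_mod
        intro i
        rw [tab_geo h1 i, geo_chip i]; simp only [Bool.not_false]; omega
      exact (tab_ent h1).chip this
    · exact absurd h1 (by decide)
    · exact absurd h1 (by decide)

theorem nc_win {δ : Config 3} (h : Inv W δ) {b : P3} {e : ℤ} (hw : win W δ b e) {x : ℤ} (h1 : 2 * e + 1 ≤ x) (h2 : x < W.K) :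
    cn δ (ch W b x) = some (.nc (decide (x % 2 = 0)) (decide (x = 2 * e + 1)) (decide (W.K - 2 ≤ x))) := by
  obtain ⟨w1, w2, ⟨l, w3⟩, w4⟩ := hw
  have key : ∀ ev tk l, cn δ (ch W b x) = some (.nc ev tk l) → ev = decide (x % 2 = 0) ∧ l = decide (W.K - 2 ≤ x) := by
    intro ev tk l hc
    obtain ⟨b', c, a1, a2, a3, a4, a5, a6, -⟩ := h.al _ _ hc
    obtain ⟨-, -, rfl⟩ := pt_inj W a1 (In_ax W (by omega) h2) a2
    exact ⟨a5, a6⟩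
  by_cases hx : x = 2 * e + 1
  · rw [← hx] at w3
    obtain ⟨k1, k2⟩ := key _ _ _ w3
    rw [w3, ← k1, ← k2, decide_eq_true hx]
  · obtain ⟨ev, l, w5⟩ := w4 x (by omega) h2
    obtain ⟨k1, k2⟩ := key _ _ _ w5
    rw [w5, ← k1, ← k2, decide_eq_false hx]

section
variable {δ : Config 3} {b : P3} {e : ℤ}

theorem sg_t : sg true = 1 := rfl
theorem sg_f : sg false = -1 := rfl
theorem blk_chip {x y : ℤ} (hb : W.sd b = none) (h1 : 0 ≤ x) (h2 : x < W.K) (h3 : 0 ≤ y) (h4 : y < W.K) :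
    W.sd (blk W (pt W b chip (v3 x y 0))) = none := by
  have hK := K_pos W
  rw [blk_pt0 W (by decide) (In_v3 h1 h2 h3 h4 (by omega) (by omega))]; exact hb

theorem lc_bk (h : Live W δ) (hb : W.sd b = none) (hw : win W δ b e) (n : ℕ) :
    ∀ x, x = W.K - 1 - n → 2 * e + 1 ≤ x → cn δ (pt W b chip (v3 x 1 0)) = some (.bk (decide (x = 2 * e + 1))) := by
  have hK := K_pos W
  have hKN : W.K = 2 * W.N := rfl
  have w1 := hw.1
  suffices hs : ∀ x, x = W.K - 1 - n → 2 * e + 1 ≤ x → Pres δ (pt W b chip (v3 x 1 0)) by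
    intro x hx he
    rcases live_chip h hw (In_v3 (by omega) (by omega) (by omega) (by omega) (by omega) (by omega)) (by simp [v31]) (hs x hx he) with
      ⟨h1, h2⟩ | ⟨h1, h2⟩ | ⟨h1, h2⟩ | ⟨h1, h2⟩ | ⟨h1, h2⟩
    · exact h1
    all_goals (simp only [v30, v31] at h2; omega)
  induction n with
  | zero =>
    intro x hx he
    have hc := nc_win h.inv hw he (by omega)
    rw [decide_eq_false (show ¬ x % 2 = 0 by omega), decide_eq_true (show W.K - 2 ≤ x by omega)] at hc
    refine h.pres1 (blk_chip hb (by omega) (by omega) (by omega) (by omega)) (R1.bStart (decide (x = 2 * e + 1))) (by intro _ _ _ hh; cases hh) ?_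
    · rw [pt_nb, nb1, sg_f]
      simp only [Int.reduceNeg, Int.reduceAdd]
      rw [← ax_v3]; exact hc
  | succ n ih =>
    intro x hx he
    have ih' := ih (x + 1) (by push_cast at hx; omega) (by omega)
    have hc := nc_win h.inv hw he (by omega)
    obtain ⟨bk, hbk, hq⟩ : ∃ bk, cn δ (pt W b chip (v3 (x + 1) 1 0)) = some (.bk bk) ∧ bk = false := by
      rcases live_chip h hw (In_v3 (by omega) (by omega) (by omega) (by omega) (by omega) (by omega)) (by simp [v31]) ih' with
        ⟨h1, h2⟩ | ⟨h1, h2⟩ | ⟨h1, h2⟩ | ⟨h1, h2⟩ | ⟨h1, h2⟩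
      · refine ⟨_, h1, ?_⟩
        rw [decide_eq_false_iff_not, v30]; omega
      all_goals (simp only [v30, v31] at h2; omega)
    subst hq
    refine h.pres2 (f := (0, true)) (g := (1, false)) (blk_chip hb (by omega) (by omega) (by omega) (by omega))
      (R2.bMove _ _ _) (by intro _ _ _ hh; cases hh)
      (by decide) (by rw [pt_nb, nb0]; exact hbk) (by
        rw [pt_nb, nb1, sg_f]
        simp only [Int.reduceNeg, Int.reduceAdd]
        rw [← ax_v3]; exact hc) ?_ ?_
    · rintro ⟨c, hh⟩; cases hh
    · rintro ⟨c, hh⟩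
      generalize hq : Q.nc (decide (x % 2 = 0)) (decide (x = 2 * e + 1)) (decide (W.K - 2 ≤ x)) = q at hh
      cases hh <;> simp at hq
      omega

theorem lc_wi (h : Live W δ) (hb : W.sd b = none) (hw : win W δ b e)
    (hbus : ∀ c, In W c → c 0 % 2 = 0 → Pres δ (pt W b (bus 5) c)) (n : ℕ) :
    ∀ y : ℤ, y = 1 + n → y < 2 * e → cn δ (pt W b chip (v3 (2 * e) y 0)) = some .wi := by
  have hK := K_pos W
  have hKN : W.K = 2 * W.N := rfl
  have w1 := hw.1
  have w2 := hw.2.1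
  induction n with
  | zero =>
    intro y hy he
    obtain ⟨ρ, F, D, s1, s2, s3, s4⟩ := chip_src h hbus (x := 2 * e) (y := y) (by omega) (by omega) (by omega) (by omega) (by omega)
    have hP : Pres δ (pt W b chip (v3 (2 * e) y 0)) := by
      have hbk := lc_bk h hb hw (W.K - 1 - (2 * e + 1)).toNat (2 * e + 1) (by omega) le_rfl
      rw [decide_eq_true rfl] at hbk
      refine h.pres2 (f := (0, true)) (g := (2, false)) (blk_chip hb (by omega) (by omega) (by omega) (by omega))
        (R2.wiStart _ F D rfl s3) (by intro _ _ _ hh; cases hh) (by decide) (by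
          rw [pt_nb, nb0, sg_t, show y = 1 by omega]; exact hbk) s1 ?_ s4
      rintro ⟨c, hh⟩; cases hh
    rcases live_chip h hw (In_v3 (by omega) (by omega) (by omega) (by omega) (by omega) (by omega)) (by simp [v31]; omega) hP with
      ⟨h1, h2⟩ | ⟨h1, h2⟩ | ⟨h1, h2⟩ | ⟨h1, h2⟩ | ⟨h1, h2⟩
    case inr.inl => exact h1
    all_goals (simp only [v30, v31] at h2; omega)
  | succ n ih =>
    intro y hy he
    push_cast at hy
    have ih' := ih (y - 1) (by omega) (by omega)
    obtain ⟨ρ, F, D, s1, s2, s3, s4⟩ := chip_src h hbus (x := 2 * e) (y := y) (by omega) (by omega) (by omega) (by omega) (by omega)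
    have hP : Pres δ (pt W b chip (v3 (2 * e) y 0)) := by
      refine h.pres2 (f := (1, false)) (g := (2, false)) (blk_chip hb (by omega) (by omega) (by omega) (by omega))
        (R2.wiMove _ F D rfl s3 ?_) (by intro _ _ _ hh; cases hh) (by decide) (by
          rw [pt_nb, nb1, sg_f]; exact ih') s1 ?_ s4
      · rw [s2]; simp [Gf]; omega
      · rintro ⟨c, hh⟩; cases hh
    rcases live_chip h hw (In_v3 (by omega) (by omega) (by omega) (by omega) (by omega) (by omega)) (by simp [v31]; omega) hP with
      ⟨h1, h2⟩ | ⟨h1, h2⟩ | ⟨h1, h2⟩ | ⟨h1, h2⟩ | ⟨h1, h2⟩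
    case inr.inl => exact h1
    all_goals (simp only [v30, v31] at h2; omega)

/-- contents of the selector row -/
theorem sel_val (h : Live W δ) (hw : win W δ b e) {x : ℤ} (h0 : 0 ≤ x) (h1 : x < W.K) (hP : Pres δ (pt W b chip (v3 x (2 * e) 0))) :
    (x % 2 = 0 → cn δ (pt W b chip (v3 x (2 * e) 0)) = some (.sel (W.Mb (x / 2) e) (decide (x = 0)) (decide (x + 2 = W.K)))) ∧
    (x % 2 = 1 → cn δ (pt W b chip (v3 x (2 * e) 0)) = some (.selodd (decide (x = W.K - 1)))) := by
  have hK := K_pos W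
  have hKN : W.K = 2 * W.N := rfl
  have w1 := hw.1
  have w2 := hw.2.1
  rcases live_chip h hw (In_v3 (by omega) (by omega) (by omega) (by omega) (by omega) (by omega)) (by simp [v31]; omega) hP with
    ⟨h1, h2⟩ | ⟨h1, h2⟩ | ⟨h1, h2⟩ | ⟨h1, h2⟩ | ⟨h1, h2⟩ <;> simp only [v30, v31] at h2
  · omega
  · omega
  · exact ⟨fun _ => h1, fun _ => by omega⟩
  · exact ⟨fun _ => by omega, fun _ => h1⟩
  · omega

theorem lc_diag (h : Live W δ) (hb : W.sd b = none) (hw : win W δ b e)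
    (hbus : ∀ c, In W c → c 0 % 2 = 0 → Pres δ (pt W b (bus 5) c)) : Pres δ (pt W b chip (v3 (2 * e) (2 * e) 0)) := by
  have hK := K_pos W
  have hKN : W.K = 2 * W.N := rfl
  have w1 := hw.1
  have w2 := hw.2.1
  obtain ⟨ρ, F, D, s1, s2, s3, s4⟩ := chip_src h hbus (x := 2 * e) (y := 2 * e) (by omega) (by omega) (by omega) (by omega) (by omega)
  have hwi := lc_wi h hb hw hbus (2 * e - 2).toNat (2 * e - 1) (by omega) (by omega)
  refine h.pres2 (f := (1, false)) (g := (2, false)) (blk_chip hb (by omega) (by omega) (by omega) (by omega))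
    (R2.selDiag _ F D rfl s3 ?_) (by intro _ _ _ hh; cases hh) (by decide) (by
      rw [pt_nb, nb1, sg_f]; exact hwi) s1 ?_ s4
  · rw [s2]; simp [Gf]
  · rintro ⟨c, hh⟩; cases hh

theorem lc_right (h : Live W δ) (hb : W.sd b = none) (hw : win W δ b e)
    (hbus : ∀ c, In W c → c 0 % 2 = 0 → Pres δ (pt W b (bus 5) c)) (n : ℕ) :
    ∀ x, x = 2 * e + n → x < W.K → Pres δ (pt W b chip (v3 x (2 * e) 0)) := by
  have hK := K_pos W
  have hKN : W.K = 2 * W.N := rfl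
  have w1 := hw.1
  have w2 := hw.2.1
  induction n with
  | zero => intro x hx _; rw [hx]; simpa using lc_diag h hb hw hbus
  | succ n ih =>
    intro x hx hxK
    push_cast at hx
    have ih' := sel_val h hw (by omega) (by omega) (ih (x - 1) (by omega) (by omega))
    by_cases hp : x % 2 = 0
    · have hq := ih'.2 (by omega)
      rw [decide_eq_false (by omega)] at hq
      obtain ⟨ρ, F, D, s1, s2, s3, s4⟩ := chip_src h hbus (x := x) (y := 2 * e) (by omega) (by omega) (by omega) (by omega) (by omega)
      refine h.pres2 (f := (0, false)) (g := (2, false)) (blk_chip hb (by omega) (by omega) (by omega) (by omega))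
        (R2.selEvR _ F D rfl s3) (by intro _ _ _ hh; cases hh) (by decide) (by
          rw [pt_nb, nb0, sg_f]; exact hq) s1 ?_ s4
      rintro ⟨c, hh⟩; cases hh
    · have hq := ih'.1 (by omega)
      exact h.pres1 (blk_chip hb (by omega) (by omega) (by omega) (by omega)) (R1.selOddR _ _ _)
        (by intro _ _ _ hh; cases hh) (by rw [pt_nb, nb0, sg_f]; exact hq)

theorem lc_left (h : Live W δ) (hb : W.sd b = none) (hw : win W δ b e)
    (hbus : ∀ c, In W c → c 0 % 2 = 0 → Pres δ (pt W b (bus 5) c)) (n : ℕ) :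
    ∀ x, x = 2 * e - n → 0 ≤ x → Pres δ (pt W b chip (v3 x (2 * e) 0)) := by
  have hK := K_pos W
  have hKN : W.K = 2 * W.N := rfl
  have w1 := hw.1
  have w2 := hw.2.1
  induction n with
  | zero => intro x hx _; rw [hx]; simpa using lc_diag h hb hw hbus
  | succ n ih =>
    intro x hx hxK
    push_cast at hx
    have ih' := sel_val h hw (by omega) (by omega) (ih (x + 1) (by omega) (by omega))
    by_cases hp : x % 2 = 0
    · have hq := ih'.2 (by omega)
      obtain ⟨ρ, F, D, s1, s2, s3, s4⟩ := chip_src h hbus (x := x) (y := 2 * e) (by omega) (by omega) (by omega) (by omega) (by omega)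
      refine h.pres2 (f := (0, true)) (g := (2, false)) (blk_chip hb (by omega) (by omega) (by omega) (by omega))
        (R2.selEvL _ _ F D rfl s3) (by intro _ _ _ hh; cases hh) (by decide) (by
          rw [pt_nb, nb0, sg_t]; exact hq) s1 ?_ s4
      rintro ⟨c, hh⟩; cases hh
    · have hq := ih'.1 (by omega)
      rw [decide_eq_false (show ¬ x + 1 = 0 by omega)] at hq
      exact h.pres1 (blk_chip hb (by omega) (by omega) (by omega) (by omega)) (R1.selOddL _ _)
        (by intro _ _ _ hh; cases hh) (by rw [pt_nb, nb0, sg_t]; exact hq)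

theorem lc_rw (h : Live W δ) (hb : W.sd b = none) (hw : win W δ b e)
    (hbus : ∀ c, In W c → c 0 % 2 = 0 → Pres δ (pt W b (bus 5) c)) {x : ℤ} (h0 : 0 ≤ x) (h1 : x < W.K) (hp : x % 2 = 0) (n : ℕ) :
    ∀ y, y = 2 * e + 1 + n → y < W.K → cn δ (pt W b chip (v3 x y 0)) = some (.rw (W.Mb (x / 2) e)) := by
  have hK := K_pos W
  have hKN : W.K = 2 * W.N := rfl
  have w1 := hw.1
  have w2 := hw.2.1
  suffices hs : ∀ y, y = 2 * e + 1 + n → y < W.K → Pres δ (pt W b chip (v3 x y 0)) by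
    intro y hy hyK
    rcases live_chip h hw (In_v3 (by omega) (by omega) (by omega) (by omega) (by omega) (by omega)) (by simp [v31]; omega) (hs y hy hyK) with
      ⟨h1, h2⟩ | ⟨h1, h2⟩ | ⟨h1, h2⟩ | ⟨h1, h2⟩ | ⟨h1, h2⟩
    case inr.inr.inr.inr => exact h1
    all_goals (simp only [v30, v31] at h2; omega)
  induction n with
  | zero =>
    intro y hy hyK
    have hP : Pres δ (pt W b chip (v3 x (2 * e) 0)) := by
      by_cases hx : x ≤ 2 * e
      · exact lc_left h hb hw hbus (2 * e - x).toNat x (by omega) h0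
      · exact lc_right h hb hw hbus (x - 2 * e).toNat x (by omega) h1
    have hq := (sel_val h hw h0 h1 hP).1 hp
    obtain ⟨ρ, F, D, s1, s2, s3, s4⟩ := chip_src h hbus (x := x) (y := y) (by omega) (by omega) (by omega) (by omega) (by omega)
    refine h.pres2 (f := (1, false)) (g := (2, false)) (blk_chip hb (by omega) (by omega) (by omega) (by omega))
        (R2.rwStart _ _ _ _ F D rfl s3 ?_) (by intro _ _ _ hh; cases hh) (by decide) (by
          rw [pt_nb, nb1, sg_f, show y + -1 = 2 * e by omega]; exact hq) s1 ?_ s4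
    · rw [s2]; simp [Gf]; omega
    · rintro ⟨c, hh⟩; cases hh
  | succ n ih =>
    intro y hy hyK
    push_cast at hy
    have ih' : cn δ (pt W b chip (v3 x (y - 1) 0)) = some (.rw (W.Mb (x / 2) e)) := by
      rcases live_chip h hw (In_v3 (by omega) (by omega) (by omega) (by omega) (by omega) (by omega)) (by simp [v31]; omega) (ih (y - 1) (by omega) (by omega)) with
        ⟨h1, h2⟩ | ⟨h1, h2⟩ | ⟨h1, h2⟩ | ⟨h1, h2⟩ | ⟨h1, h2⟩
      case inr.inr.inr.inr => exact h1
      all_goals (simp only [v30, v31] at h2; omega)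
    obtain ⟨ρ, F, D, s1, s2, s3, s4⟩ := chip_src h hbus (x := x) (y := y) (by omega) (by omega) (by omega) (by omega) (by omega)
    refine h.pres2 (f := (1, false)) (g := (2, false)) (blk_chip hb (by omega) (by omega) (by omega) (by omega))
        (R2.rwMove _ _ F D rfl s3 ?_) (by intro _ _ _ hh; cases hh) (by decide) (by
          rw [pt_nb, nb1, sg_f]; exact ih') s1 ?_ s4
    · rw [s2]; simp [Gf]; omega
    · rintro ⟨c, hh⟩; cases hh

theorem live_trunk (h : Live W δ) (hb : W.sd b = none) (hw : win W δ b e)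
    (hbus : ∀ c, In W c → c 0 % 2 = 0 → Pres δ (pt W b (bus 5) c)) :
    ∀ c, In W c → Pres δ (pt W b trunk c) := by
  have hK := K_pos W
  have hKN : W.K = 2 * W.N := rfl
  have w1 := hw.1
  have w2 := hw.2.1
  have hbr := live_branch h hb hbus
  have ev : ∀ c, In W c → c 0 % 2 = 0 → Pres δ (pt W b trunk c) := by
    intro c hc hp
    refine fill_sq h (e := false) tab_trunk (by rw [add_hom0 (by decide)]; exact hb) ?_ ?_ c hc (fun _ => hp)
    · intro c1 h1 _ h3
      have : (fun i => b i + shv branch trunk i) = b := by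
        funext i; rw [shv_zero (fun _ => by decide)]; ring
      rw [this]; exact hbr c1 h1 (h3 (by decide))
    · intro c hc hp ht hs
      have hp := hp (by decide)
      rw [tab_pas0 (by decide), oth02] at hs
      simp only [en] at ht hs
      obtain ⟨⟨c0, c0'⟩, -, -⟩ := In3 hc
      have hcv : c = v3 (c 0) 0 0 := v3_ext rfl hs ht
      generalize c 0 = x at *
      subst hcv
      have hr := lc_rw h hb hw hbus c0 c0' hp (W.K - 1 - (2 * e + 1)).toNat (W.K - 1) (by omega) (by omega)
      have hin : In W (v3 x 0 (W.K - 1)) := In_v3 c0 c0' (by omega) (by omega) (by omega) (by omega)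
      obtain ⟨ρ, -, hq⟩ := live_sq h hin (k := branch) (Or.inr ⟨by decide, hp⟩) (hbr _ hin hp)
      obtain ⟨F, D, m⟩ := mk_sq branch (Gf W ρ) (v3 x 0 (W.K - 1))
      have n1 : nb (pt W b trunk (v3 x 0 0)) (1, false) = pt W b chip (v3 x (W.K - 1) 0) := by
        rw [nb_cross0 W geo_trunk b _ (by rfl), upd1]; rfl
      have n2 : nb (pt W b trunk (v3 x 0 0)) (2, false) = pt W b branch (v3 x 0 (W.K - 1)) := by
        rw [nb_cross W (shv branch trunk) (tab_geo (e := true) tab_trunk) b _ (by rfl), upd2]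
        congr 1
        funext i; rw [shv_zero (fun _ => by decide)]; ring
      refine h.pres2 (f := (1, false)) (g := (2, false)) (by rw [blk_pt0 W (by decide) hc]; exact hb)
        (R2.trunkDiag _ _ F D _ rfl ?_ ?_ rfl) mkq_nc (by decide) (by rw [n1]; exact hr) (by rw [n2, hq, m]) ?_ ?_
      · rw [mkF0 (by decide) m.symm (by decide)]; simp [Gf, v32]
      · rw [mkF0 (by decide) m.symm (by decide)]; simp [Gf, v31]
      · rintro ⟨c, hh⟩; cases hh
      · rw [← m]
        intro hs
        rcases Str_mk hs with ⟨-, h1⟩ | ⟨k2, h1, h2, -⟩ | ⟨h1, -⟩ | ⟨d, h1, -⟩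
        · rw [tab_pas0 (by decide), oth02, v31, v32] at h1; simp [sg] at h1; omega
        · exact h2 (geo_uniq h1 tab_trunk)
        · exact absurd h1 (by decide)
        · exact absurd h1 (by decide)
  intro c hc
  by_cases hp : c 0 % 2 = 0
  · exact ev c hc hp
  obtain ⟨⟨c0, c0'⟩, ⟨c1, c1'⟩, ⟨c2, c2'⟩⟩ := In3 hc
  have hin : In W (v3 (c 0 - 1) (c 1) (c 2)) := In_v3 (by omega) (by omega) c1 c1' c2 c2'
  obtain ⟨ρ, -, hq⟩ := live_sq h hin (k := trunk) (Or.inl (by decide)) (ev _ hin (by rw [v30]; omega))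
  obtain ⟨F, D, m⟩ := mk_sq trunk (Gf W ρ) (v3 (c 0 - 1) (c 1) (c 2))
  refine h.pres1 (by rw [blk_pt0 W (by decide) hc]; exact hb) (R1.oddcopy _ F D rfl ?_) (by intro _ _ _ hh; cases hh) (by
    rw [pt_nb, v3_eta c, nb0, sg_f]; rw [m] at hq; exact hq)
  rw [mkF0 (by decide) m.symm (by decide)]; change decide ((c 0 - 1) % 2 = 1) = false; rw [decide_eq_false_iff_not]; omega

end

end IU

namespace IU

variable {W : World}

/-! ### Trees -/

def par (k : ℕ) : ℕ := ((row k).2.2.2.2.headD (0, 0, 0)).2.2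
def rch : ℕ → ℕ → Bool
  | 0, k => k == 8
  | n + 1, k => k == 8 || rch n (par k)

set_option maxRecDepth 100000 in
theorem par_rch : (List.range 79).all (fun k => Nat.blt k 8 || rch 79 k) = true := by decide +kernel

theorem tab_ind (P : Kind → Prop) (h8 : P trunk)
    (hs : ∀ t e k' k, Ent t e k' k → 9 ≤ k.val → P k' → P k) (k : Kind) (hk : 8 ≤ k.val) : P k := by
  have key : ∀ n, ∀ k : Kind, 8 ≤ k.val → rch n k.val = true → P k := by
    intro n
    induction n with
    | zero =>
      intro k _ h
      have h' : k.val = 8 := by simpa [rch] using h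
      have : k = trunk := Fin.ext h'
      rw [this]; exact h8
    | succ n ih =>
      intro k hk h
      by_cases h' : k.val = 8
      · have : k = trunk := Fin.ext h'
        rw [this]; exact h8
      · have h9 : 9 ≤ k.val := by omega
        obtain ⟨t0, e0, k0, hE0⟩ := tab_ex h9
        have hmem : (row k.val).2.2.2.2.headD (0, 0, 0) ∈ (row k.val).2.2.2.2 := by
          unfold Ent at hE0
          cases hl : (row k.val).2.2.2.2 with
          | nil => rw [hl] at hE0; simp at hE0
          | cons a l => simp
        obtain ⟨t, e, k', hE, -, -, hv⟩ := ent_of hmem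
        have hv' : k'.val = par k.val := hv
        refine hs t e k' k hE h9 (ih k' ((tab_ent hE).tree h9) ?_)
        simp only [rch, Bool.or_eq_true, beq_iff_eq, h', false_or] at h
        rw [hv']; exact h
  refine key 79 k hk ?_
  have := List.all_eq_true.mp par_rch k.val (by simp)
  simp only [Bool.or_eq_true, Nat.blt, Nat.ble_eq] at this
  rcases this with h | h
  · omega
  · exact h

theorem mk_fil {k : Kind} {g c} : mk k g c ≠ .fil := by unfold mk; intro h; injection h

def TC (W : World) (b : P3) (k : Kind) : Prop :=
  W.sd (fun i => b i + hom k i) = none ∨ (W.sd b ≠ none ∧ ∀ i, hom k i = 0)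

theorem tree_of_trunk {δ : Config 3} (h : Live W δ) {b : P3}
    (h8 : ∀ c, In W c → Pres δ (pt W b trunk c))
    (hz : W.sd b ≠ none → ∀ k : Kind, 8 ≤ k.val → (∀ i, hom k i = 0) → ∀ c, In W c → Pres δ (pt W b k c)) :
    ∀ k : Kind, 8 ≤ k.val → TC W b k → ∀ c, In W c → Pres δ (pt W b k c) := by
  refine tab_ind _ (fun _ => h8) ?_
  intro t e k' k hE h9 ih hT c hc
  have E := tab_ent hE
  rcases hT with hT | ⟨hT, hT'⟩
  · have hT2 : TC W b k' := by
      rcases E.hom h9 with h0 | h0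
      · by_cases hb : W.sd b = none
        · left
          rw [show (fun i => b i + hom k' i) = b from funext fun i => by rw [h0]; ring]; exact hb
        · exact Or.inr ⟨hb, h0⟩
      · left
        rw [show (fun i => b i + hom k' i) = fun i => b i + hom k i from funext fun i => by rw [h0]]; exact hT
    have hE' : Ent t (!(!e)) k' k := by rw [Bool.not_not]; exact hE
    refine fill_kind h hE' (by rintro rfl; revert h9; decide) hT ?_ c hc (fun _ => by omega)
    intro c1 h1 _ _
    rw [show (fun i => b i + shv k' k i) = b from funext fun i => by rw [shv_zero (fun _ => by omega)]; ring]
    exact ih hT2 c1 h1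
  · exact hz hT k (by omega) hT' c hc

theorem nb_dock (b : P3) (d : Fin 6) : (fun i => nb b (dirOf d) i + hom (dock d) i) = b := by
  funext i
  rw [(tab_dock d).2, shv_bus, nb_apply]; ring

theorem dock_ge (d : Fin 6) : 8 ≤ (dock d).val := by simp only [dock]; omega

theorem live_tree {δ : Config 3} (h : Live W δ) {b : P3} {e : ℤ} (hj : Just W (win W δ) b e) :
    ∀ k : Kind, 8 ≤ k.val → TC W b k → ∀ c, In W c → Pres δ (pt W b k c) := by
  induction hj with
  | seed b e hs hw =>
    have hz : ∀ k : Kind, 8 ≤ k.val → (∀ i, hom k i = 0) → ∀ c, In W c → Pres δ (pt W b k c) := by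
      intro k hk h0 c hc
      refine ⟨_, seed_cn h.inv.wf (q := mk k (Gf W (fun x => W.Mb (x / 2) e)) c) ?_, mk_fil⟩
      unfold seedS
      have : blk W (pt W b k c) = b := by
        rw [blk_pt W hc]; funext i; rw [h0]; ring
      rw [this, hs, Option.map_some, sc_tree W hk hc]
    exact tree_of_trunk h (hz trunk (by decide) (tab_hom0 (by decide))) (fun _ => hz)
  | step b e hs hw f h1 h2 h3 ih =>
    obtain ⟨d, hd⟩ := h1
    have hdk : ∀ c, In W c → Pres δ (pt W (nb b (dirOf d)) (dock d) c) :=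
      ih d hd (dock d) (dock_ge d) (Or.inl (by rw [nb_dock]; exact hs))
    have hbus := live_bus h hs hdk (5 - d.val) 5 (by change 5 = _; omega)
    exact tree_of_trunk h (live_trunk h hs hw hbus) (fun hh => absurd hs hh)

/-! ### Tokens -/

theorem min_dir {P : Fin 6 → Prop} (h : ∃ d, P d) : ∃ d, P d ∧ ∀ d' < d, ¬ P d' := by
  have h' : ∃ n : ℕ, ∃ hn : n < 6, P ⟨n, hn⟩ := by obtain ⟨d, hd⟩ := h; exact ⟨d.val, d.2, hd⟩
  obtain ⟨hn, hp⟩ := Nat.find_spec h'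
  refine ⟨⟨Nat.find h', hn⟩, hp, fun d' hd hp' => ?_⟩
  exact Nat.find_min h' (show d'.val < Nat.find h' from hd) ⟨d'.2, hp'⟩

section
variable {δ : Config 3} {B : P3} {u : ℤ}

theorem valid_dock (h : Live W δ) (hv : Valid W (win W δ) B u) (hB : W.sd B = none) {d : Fin 6} (hd : W.Db u d = true) :
    ∃ e, win W δ (nb B (dirOf d)) e ∧ W.Mb u e d = true ∧ ∀ c, In W c → Pres δ (pt W (nb B (dirOf d)) (dock d) c) := by
  obtain ⟨e, h1, h2⟩ := hv.2 d (by omega) hd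
  exact ⟨e, h1, h2, live_tree h (h.inv.just _ _ h1) (dock d) (dock_ge d) (Or.inl (by rw [nb_dock]; exact hB))⟩

theorem valid_bus (h : Live W δ) (hv : Valid W (win W δ) B u) (hB : W.sd B = none) {d0 : Fin 6} (hd0 : W.Db u d0 = true)
    {d : Fin 6} (hd : d0 ≤ d) : ∀ c, In W c → c 0 % 2 = 0 → Pres δ (pt W B (bus d) c) := by
  obtain ⟨e, -, -, h3⟩ := valid_dock h hv hB hd0
  exact live_bus h hB h3 (d.val - d0.val) d (by have : d0.val ≤ d.val := hd; omega)

theorem valid_bus5 (h : Live W δ) (hv : Valid W (win W δ) B u) (hB : W.sd B = none) :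
    ∀ c, In W c → c 0 % 2 = 0 → Pres δ (pt W B (bus 5) c) := by
  obtain ⟨d, -, hd⟩ := hv.1
  exact valid_bus h hv hB hd (by omega)

theorem dock_inj {d d' : Fin 6} (h : dock d = dock d') : d = d' := by
  have := congrArg Fin.val h
  simp only [dock] at this
  exact Fin.ext (by omega)

theorem bus_src (h : Live W δ) {d : Fin 6} (hb : ∀ c, In W c → c 0 % 2 = 0 → Pres δ (pt W B (bus d) c)) (hu : 0 ≤ u)
    (hN : u < W.N) {z : ℤ} (hz : 0 ≤ z) (hz' : z < W.K) :
    ∃ ρ F D, cn δ (nb (pt W B (bus d) (v3 (2 * u + 1) 0 z)) (0, false)) = some (.sq (bus d) F D) ∧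
      F 1 = Gf W ρ (2 * u) 0 ∧ F 2 = Gf W ρ (2 * u) z ∧ ¬ Str R1 (0, false) (.sq (bus d) F D) := by
  have hK := K_pos W
  have hKN : W.K = 2 * W.N := rfl
  have h15 : (bus d).val < 15 := by simp only [bus]; omega
  have hin : In W (v3 (2 * u) 0 z) := In_v3 (by omega) (by omega) (by omega) (by omega) hz hz'
  obtain ⟨ρ, -, hq⟩ := live_sq h hin (k := bus d) (Or.inr ⟨by simp only [bus]; omega, by rw [v30]; omega⟩)
    (hb _ hin (by rw [v30]; omega))
  obtain ⟨F, D, m⟩ := mk_sq (bus d) (Gf W ρ) (v3 (2 * u) 0 z)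
  refine ⟨ρ, F, D, ?_, mkF0 h15 m.symm (by decide), mkF0 h15 m.symm (by decide), ?_⟩
  · rw [pt_nb, nb0, sg_f, show 2 * u + 1 + -1 = 2 * u by ring, hq, m]
  · rw [← m]
    intro hs
    rcases Str_mk hs with ⟨h1, -⟩ | ⟨k2, h1, -⟩ | ⟨-, h1⟩ | ⟨d, h1, -⟩
    · exact h1 (tab_pas0 h15).symm
    · exact (tab_ent h1).pas' (tab_pas0 h15).symm
    · have := congrArg Fin.val h1; simp only [bus] at this; change d.val = 8 at this; omega
    · exact absurd h1 (by decide)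

theorem tok_up (h : Live W δ) (hB : W.sd B = none) {d : Fin 6}
    (hb : ∀ c, In W c → c 0 % 2 = 0 → Pres δ (pt W B (bus d) c)) (hu : 0 ≤ u) (hN : u < W.N)
    (h0 : Pres δ (pt W B (bus d) (v3 (2 * u + 1) 0 0))) (n : ℕ) :
    ∀ z : ℤ, z = n → z < W.K → Pres δ (pt W B (bus d) (v3 (2 * u + 1) 0 z)) := by
  have hK := K_pos W
  have hKN : W.K = 2 * W.N := rfl
  have h8 : (bus d).val ≤ 8 := by simp only [bus]; omega
  induction n with
  | zero => intro z hz _; rw [hz]; exact h0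
  | succ n ih =>
    intro z hz hzK
    push_cast at hz
    have hin : In W (v3 (2 * u + 1) 0 (z - 1)) := In_v3 (by omega) (by omega) (by omega) (by omega) (by omega) (by omega)
    have ih' := live_tok h hin (by rw [v30]; omega) (ih (z - 1) (by omega) (by omega))
    rw [v32, v30, decide_eq_false (show ¬ z - 1 = W.K - 1 by omega)] at ih'
    obtain ⟨ρ, F, D, s1, s2, s3, s4⟩ := bus_src h hb hu hN (z := z) (by omega) hzK
    refine h.pres2 (f := (2, false)) (g := (0, false)) ?_ (R2.tokMove d _ _ F D rfl ?_ ?_) (by intro _ _ _ hh; cases hh) (by decide)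
      (by rw [pt_nb, nb2, sg_f]; exact ih') s1 ?_ s4
    · rw [blk_pt0 W h8 (In_v3 (by omega) (by omega) (by omega) (by omega) (by omega) (by omega))]; exact hB
    · rw [s2]; simp [Gf]
    · rw [s3]; simp [Gf]; omega
    · rintro ⟨c, hh⟩; cases hh

theorem dock_src (h : Live W δ) (hv : Valid W (win W δ) B u) (hB : W.sd B = none) (hu : 0 ≤ u)
    (hN : u < W.N) {d : Fin 6} (hd : W.Db u d = true) :
    ∃ ρ F D, cn δ (nb (pt W B (bus d) (v3 (2 * u + 1) 0 0)) (1, false)) = some (.sq (dock d) F D) ∧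
      F 1 = Gf W ρ (2 * u + 1) (W.K - 1) ∧ F 2 = Gf W ρ (2 * u + 1) 0 ∧ (F 1).r d = true ∧ (F 1).uo = true ∧
      (∀ d', (F 1).D d' = W.Db u d') ∧
      ((∃ d' < d, W.Db u d' = true) → ¬ Str R1 (1, false) (.sq (dock d) F D)) := by
  have hK := K_pos W
  have hKN : W.K = 2 * W.N := rfl
  have h15 : (dock d).val < 15 := by simp only [dock]; omega
  obtain ⟨e, w1, w2, w3⟩ := valid_dock h hv hB hd
  have hin : In W (v3 (2 * u + 1) (W.K - 1) 0) := In_v3 (by omega) (by omega) (by omega) (by omega) (by omega) (by omega)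
  obtain ⟨ρ, hcl, hq⟩ := live_sq h hin (k := dock d) (Or.inl (dock_ge d)) (w3 _ hin)
  have hρ : ρ = fun x => W.Mb (x / 2) e := by
    rcases hcl with ⟨-, e', w1', rfl⟩ | ⟨h6, -⟩
    · rw [w1.uniq w1']
    · have := dock_ge d; omega
  have hdiv : (2 * u + 1) / 2 = u := by omega
  obtain ⟨F, D, m⟩ := mk_sq (dock d) (Gf W ρ) (v3 (2 * u + 1) (W.K - 1) 0)
  have f1 : F 1 = Gf W ρ (2 * u + 1) (W.K - 1) := mkF0 h15 m.symm (by decide)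
  have hnb : nb (pt W B (bus d) (v3 (2 * u + 1) 0 0)) (1, false) = pt W (nb B (dirOf d)) (dock d) (v3 (2 * u + 1) (W.K - 1) 0) := by
    rw [nb_cross W (shv (dock d) (bus d)) (tab_geo (e := true) (tab_dock d).1) B _ (by rfl), upd1]
    have : (fun i => B i + shv (dock d) (bus d) i) = nb B (dirOf d) := by
      funext i; rw [nb_apply, shv_bus]
    rw [this]; rfl
  refine ⟨ρ, F, D, ?_, f1, mkF0 h15 m.symm (by decide), ?_, ?_, ?_, ?_⟩
  · rw [hnb, hq, m]
  · rw [f1, hρ]; change W.Mb ((2 * u + 1) / 2) e d = true; rw [hdiv]; exact w2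
  · rw [f1]; change decide ((2 * u + 1) % 2 = 1) = true; rw [decide_eq_true_iff]; omega
  · intro d'; rw [f1]; change W.Db ((2 * u + 1) / 2) d' = _; rw [hdiv]
  · rintro ⟨d', hd', hdd⟩ hs
    rw [← m] at hs
    rcases Str_mk hs with ⟨-, h1⟩ | ⟨k2, h1, -, -, -, h2⟩ | ⟨h1, -⟩ | ⟨d2, -, -, h1, -, -, h2⟩
    · rw [tab_pas0 h15, oth01, v31, v32] at h1; simp [sg] at h1; omega
    · obtain rfl := geo_uniq h1 (tab_dock d).1
      have := h2 (by simp only [bus]; omega)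
      rw [v30] at this; omega
    · exact absurd h1 (by decide)
    · obtain rfl := dock_inj h1
      have := h2 d' hd'
      rw [v30, hdiv, hdd] at this; cases this

theorem tok_all (h : Live W δ) (hv : Valid W (win W δ) B u) (hB : W.sd B = none) (hu : 0 ≤ u)
    (hN : u < W.N) {d0 : Fin 6} (hd0 : W.Db u d0 = true) (hmin : ∀ d' < d0, ¬ W.Db u d' = true) (n : ℕ) :
    ∀ d : Fin 6, d.val = d0.val + n → ∀ z, 0 ≤ z → z < W.K → Pres δ (pt W B (bus d) (v3 (2 * u + 1) 0 z)) := by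
  have hK := K_pos W
  have hKN : W.K = 2 * W.N := rfl
  have hblk : ∀ d : Fin 6, W.sd (blk W (pt W B (bus d) (v3 (2 * u + 1) 0 0))) = none := fun d => by
    rw [blk_pt0 W (by simp only [bus]; omega) (In_v3 (by omega) (by omega) (by omega) (by omega) (by omega) (by omega))]; exact hB
  induction n with
  | zero =>
    intro d hd z hz hz'
    obtain rfl : d = d0 := Fin.ext (by omega)
    refine tok_up h hB (valid_bus h hv hB hd0 le_rfl) hu hN ?_ z.toNat z (by omega) hz'
    obtain ⟨ρ, F, D, s1, s2, s3, s4, s5, s6, s7⟩ := dock_src h hv hB hu hN hd0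
    refine h.pres1 (hblk d) (R1.tokStart _ d F D rfl ?_ ?_ s5 ?_ ?_ s4) (by intro _ _ _ hh; cases hh) s1
    · rw [s2]; simp [Gf]
    · rw [s3]; simp [Gf]
    · rw [s6]; exact hd0
    · intro d' hd'; rw [s6]; simpa using hmin d' hd'
  | succ n ih =>
    intro d hd z hz hz'
    set d1 : Fin 6 := ⟨d0.val + n, by omega⟩ with hd1
    have hdd : d1.val + 1 = d.val := by rw [hd1, hd]; rfl
    have ih' := ih d1 rfl (W.K - 1) (by omega) (by omega)
    have hle : d0 ≤ d := by change d0.val ≤ d.val; omega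
    have hlt : d0 < d := by change d0.val < d.val; omega
    have hbd := valid_bus h hv hB hd0 hle
    refine tok_up h hB hbd hu hN ?_ z.toNat z (by omega) hz'
    have hin : In W (v3 (2 * u + 1) 0 (W.K - 1)) := In_v3 (by omega) (by omega) (by omega) (by omega) (by omega) (by omega)
    have hq := live_tok h hin (by rw [v30]; omega) ih'
    rw [v32, decide_eq_true rfl] at hq
    have hnb : nb (pt W B (bus d) (v3 (2 * u + 1) 0 0)) (2, false) = pt W B (bus d1) (v3 (2 * u + 1) 0 (W.K - 1)) := by
      rw [nb_cross W (shv (bus d1) (bus d)) (tab_geo (e := true) (tab_bus hdd)) B _ (by rfl), upd2]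
      rw [show (fun i => B i + shv (bus d1) (bus d) i) = B from funext fun i => by
        rw [shv_zero (fun _ => by simp only [bus]; omega)]; ring]
      rfl
    have ns : ∀ l, ¬ Str R1 (2, false) (.tok d1 true l) := by
      rintro l ⟨c, hh⟩
      generalize hq : Q.tok d1 true l = q at hh
      cases hh with
      | nTake d l hd =>
        injection hq with h1
        rw [h1, hd] at hdd
        change 5 + 1 = _ at hdd; omega
      | _ => cases hq
    by_cases hD : W.Db u d = true
    · obtain ⟨ρ, F, D, s1, s2, s3, s4, s5, s6, s7⟩ := dock_src h hv hB hu hN hD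
      refine h.pres2 (f := (2, false)) (g := (1, false)) (hblk d) (R2.tokDock d1 d _ _ F D hdd rfl ?_ ?_ s5 ?_ s4)
        (by intro _ _ _ hh; cases hh) (by decide) (by rw [hnb]; exact hq) s1 (ns _) (s7 ⟨d0, hlt, hd0⟩)
      · rw [s2]; simp [Gf]
      · rw [s3]; simp [Gf]
      · rw [s6]; exact hD
    · obtain ⟨ρ, F, D, s1, s2, s3, s4⟩ := bus_src h hbd hu hN (z := 0) le_rfl (by omega)
      refine h.pres2 (f := (2, false)) (g := (0, false)) (hblk d) (R2.tokSkip d1 d _ _ F D hdd rfl ?_ ?_ ?_)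
        (by intro _ _ _ hh; cases hh) (by decide) (by rw [hnb]; exact hq) s1 (ns _) s4
      · rw [s2]; simp [Gf]
      · rw [s3]; simp [Gf]
      · rw [s2]; change W.Db (2 * u / 2) d = false
        rw [show 2 * u / 2 = u by omega]; simpa using hD

theorem line_take (h : Live W δ) (hv : Valid W (win W δ) B u) (hB : W.sd B = none) (hu : 0 ≤ u) (hN : u < W.N) :
    ∃ r : Rule Q, IsRule R1 R2 r ∧ Enab R1 δ (ch W B (2 * u + 1)) r ∧ ∃ l, r.1 = .nc false true l := by
  have hK := K_pos W
  have hKN : W.K = 2 * W.N := rfl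
  obtain ⟨d, -, hd⟩ := hv.1
  obtain ⟨d0, h0, hmin⟩ := min_dir (P := fun d => W.Db u d = true) ⟨d, hd⟩
  have hP := tok_all h hv hB hu hN h0 hmin (5 - d0.val) 5 (by change 5 = _; omega) (W.K - 1) (by omega) (by omega)
  have hin : In W (v3 (2 * u + 1) 0 (W.K - 1)) := In_v3 (by omega) (by omega) (by omega) (by omega) (by omega) (by omega)
  have hq := live_tok h hin (by rw [v30]; omega) hP
  rw [v32, decide_eq_true rfl] at hq
  refine ⟨(.nc false true _, ((2, false), .tok 5 true _), none),
    R1.nTake 5 (decide (v3 (2 * u + 1) 0 (W.K - 1) 0 = W.K - 1)) rfl, en1 ?_, ⟨_, rfl⟩⟩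
  unfold ch
  rw [ax_v3, nb_cross0 W geo_chip B _ (by rfl), upd2]
  exact hq

theorem line_next (h : Live W δ) (hbus : ∀ c, In W c → c 0 % 2 = 0 → Pres δ (pt W B (bus 5) c)) {x : ℤ} (hx : 0 ≤ x)
    (hx' : x + 1 < W.K) {ev tk l} (hc : cn δ (ch W B x) = some (.nc ev tk l)) :
    ∃ r : Rule Q, IsRule R1 R2 r ∧ Enab R1 δ (ch W B (x + 1)) r ∧ ∃ ev l, r.1 = .nc ev false l := by
  have hK := K_pos W
  have hKN : W.K = 2 * W.N := rfl
  obtain ⟨b', c, a1, a2, a3, a4, a5, a6, -⟩ := h.inv.al _ _ hc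
  obtain ⟨-, -, rfl⟩ := pt_inj W a1 (In_ax W hx (by omega)) a2
  rw [ax0] at a5 a6
  have hnb : nb (ch W B (x + 1)) (0, false) = ch W B x := by
    unfold ch; rw [pt_nb, ax_v3, ax_v3, nb0, sg_f, show x + 1 + -1 = x by ring]
  by_cases hp : x % 2 = 0
  · rw [decide_eq_true hp] at a5
    subst a5
    exact ⟨(_, ((0, false), _), none), R1.nPass tk l, en1 (by rw [hnb]; exact hc), ⟨_, _, rfl⟩⟩
  · rw [decide_eq_false hp] at a5
    rw [decide_eq_false (by omega)] at a6
    subst a5 a6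
    obtain ⟨ρ, F, D, s1, s2, s3, s4⟩ := chip_src h hbus (x := x + 1) (y := 0) (by omega) (by omega) (by omega) (by omega) (by omega)
    refine ⟨(_, ((0, false), _), some ((2, false), _)), ⟨R2.nEv tk _ F D rfl s3 ?_, by decide, ?_, s4⟩,
      en2 (by rw [hnb]; exact hc) (by unfold ch; rw [ax_v3]; exact s1), ⟨_, _, rfl⟩⟩
    · rw [s2]; simp [Gf]
    · rintro ⟨c, hh⟩; cases hh

end

end IU

namespace IU

/-! ### The world of a tile assembly system -/

structure Rel (T : TAS 3) (W : World) (te : ℤ → TileType 3) : Prop where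
  mem : ∀ e, 1 ≤ e → e < W.N → te e ∈ T.tileset
  seed : ∀ b, T.seed b = (W.sd b).map te
  sound : ∀ (α : Config 3) (w : P3 → ℤ → Prop), (∀ b e, w b e → α b = some (te e)) → ∀ b h, 1 ≤ h → h < W.N →
    Valid W w b h → T.temp ≤ lsum α b (te h)
  compl : ∀ (α : Config 3) b t, t ∈ T.tileset → T.temp ≤ lsum α b t → ∃ h, 1 ≤ h ∧ h < W.N ∧ te h = t ∧
    ∀ w : P3 → ℤ → Prop, (∀ b t, α b = some t → ∃ e, w b e ∧ te e = t) → Valid W w b h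

def dsum (t : TileType 3) (D : Fin 6 → Bool) : ℕ := ∑ d, if D d = true then (face t (dirOf d)).2 else 0

theorem lsum_dir (α : Config 3) (p : P3) (t : TileType 3) : lsum α p t = ∑ d : Fin 6, lb α p t (dirOf d) := by
  unfold lsum
  exact (Function.Bijective.sum_comp (e := dirOf) ⟨fun _ _ => dirOf_inj, dirOf_surj⟩ (fun f => lb α p t f)).symm

abbrev Entry (T : TAS 3) :=
  {x : TileType 3 × (Fin 6 → Bool) // x.1 ∈ T.tileset ∧ (x.2 = (fun _ => false) ∨ T.temp ≤ dsum x.1 x.2)}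

theorem entry_finite (T : TAS 3) : Finite (Entry T) := by
  have : Set.Finite {x : TileType 3 × (Fin 6 → Bool) | x.1 ∈ T.tileset ∧ (x.2 = (fun _ => false) ∨ T.temp ≤ dsum x.1 x.2)} := by
    refine Set.Finite.subset (Set.Finite.prod (T.tileset.finite_toSet) (Set.finite_univ (α := Fin 6 → Bool))) ?_
    rintro x ⟨h, -⟩
    exact ⟨h, trivial⟩
  exact this

theorem exists_world (T : TAS 3) : ∃ W te, Rel T W te := by
  have := entry_finite T
  obtain ⟨n, ⟨f⟩⟩ := Finite.exists_equiv_fin (Entry T)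
  obtain ⟨b0, hb0⟩ := T.seed_nonempty
  obtain ⟨t0, ht0⟩ := Option.ne_none_iff_exists'.mp (mem_dom.mp hb0)
  have hx0 : ∀ t ∈ T.tileset, t ∈ T.tileset ∧ ((fun _ : Fin 6 => false) = (fun _ => false) ∨ T.temp ≤ dsum t (fun _ => false)) :=
    fun t ht => ⟨ht, Or.inl rfl⟩
  let x0 : Entry T := ⟨(t0, fun _ => false), hx0 t0 (T.seed_tiles _ _ ht0)⟩
  let en : ℤ → Entry T := fun h => if hh : 1 ≤ h ∧ h ≤ n then f.symm ⟨(h - 1).toNat, by omega⟩ else x0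
  let ix : Entry T → ℤ := fun x => (f x).val + 1
  have hn : 1 ≤ n := by have := (f x0).2; omega
  have ix1 : ∀ x, 1 ≤ ix x ∧ ix x < (n : ℤ) + 1 := fun x => by
    have := (f x).2
    simp only [ix]; omega
  have enix : ∀ x, en (ix x) = x := fun x => by
    have h1 := (ix1 x).1
    have h2 := (ix1 x).2
    simp only [en]
    rw [dif_pos ⟨h1, by omega⟩, Equiv.symm_apply_eq]
    apply Fin.ext
    simp [ix]
  let te : ℤ → TileType 3 := fun h => (en h).1.1
  let W : World :=
    { N := n + 1
      hN := by omega
      Mb := fun h e d => decide (face (te h) (dirOf d) = face (te e) (opp (dirOf d)))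
      Db := fun h => (en h).1.2
      D0 := fun d => by simp only [en]; rw [dif_neg (by omega)]
      sd := fun b => if h : ∃ t, T.seed b = some t then some (ix ⟨(h.choose, fun _ => false), hx0 _ (T.seed_tiles _ _ h.choose_spec)⟩) else none
      hsd := by
        intro b e h
        by_cases hh : ∃ t, T.seed b = some t
        · rw [dif_pos hh] at h
          obtain rfl := Option.some.inj h
          refine ⟨(ix1 _).1, (ix1 _).2, fun d => ?_⟩
          rw [enix]
        · rw [dif_neg hh] at h; cases h }
  refine ⟨W, te, ⟨fun e _ _ => (en e).2.1, fun b => ?_, ?_, ?_⟩⟩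
  · by_cases hh : ∃ t, T.seed b = some t
    · have : W.sd b = some (ix ⟨(hh.choose, fun _ => false), hx0 _ (T.seed_tiles _ _ hh.choose_spec)⟩) := dif_pos hh
      rw [this, Option.map_some]
      simp only [te]
      rw [enix]
      exact hh.choose_spec
    · have : W.sd b = none := dif_neg hh
      rw [this, Option.map_none]
      exact Option.eq_none_iff_forall_ne_some.mpr fun t ht => hh ⟨t, ht⟩
  · intro α w hw b h h1 h2 hv
    obtain ⟨d0, -, hd0⟩ := hv.1
    rcases (en h).2.2 with hz | hs
    · change (en h).1.2 d0 = true at hd0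
      rw [hz] at hd0; cases hd0
    · refine hs.trans ?_
      rw [lsum_dir]
      unfold dsum
      refine Finset.sum_le_sum fun d _ => ?_
      by_cases hd : (en h).1.2 d = true
      · rw [if_pos hd]
        obtain ⟨e', h3, h4⟩ := hv.2 d (by omega) hd
        have h5 := hw _ _ h3
        have h6 : face (te h) (dirOf d) = face (te e') (opp (dirOf d)) := of_decide_eq_true h4
        unfold lb
        rw [h5]
        simp only [gb]
        rw [if_pos h6]
      · rw [if_neg hd]; exact Nat.zero_le _
  · intro α b t ht hl
    let D : Fin 6 → Bool := fun d => decide (lb α b t (dirOf d) ≠ 0)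
    have key : ∀ d, lb α b t (dirOf d) ≠ 0 → lb α b t (dirOf d) = (face t (dirOf d)).2 ∧
        ∃ t', α (nb b (dirOf d)) = some t' ∧ face t (dirOf d) = face t' (opp (dirOf d)) := by
      intro d hd
      unfold lb at hd ⊢
      cases hα : α (nb b (dirOf d)) with
      | none => rw [hα] at hd; exact absurd rfl hd
      | some t' =>
        rw [hα] at hd
        simp only [gb] at hd ⊢
        by_cases hf : face t (dirOf d) = face t' (opp (dirOf d))
        · rw [if_pos hf]; exact ⟨rfl, t', rfl, hf⟩
        · rw [if_neg hf] at hd; exact absurd rfl hd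
    have hsum : T.temp ≤ dsum t D := by
      refine hl.trans ?_
      rw [lsum_dir]
      unfold dsum
      refine Finset.sum_le_sum fun d _ => ?_
      by_cases hd : lb α b t (dirOf d) = 0
      · rw [hd]; exact Nat.zero_le _
      · rw [if_pos (decide_eq_true hd), (key d hd).1]
    let x : Entry T := ⟨(t, D), ht, Or.inr hsum⟩
    have hDb : W.Db (ix x) = D := by change (en (ix x)).1.2 = D; rw [enix]
    have hte : te (ix x) = t := by change (en (ix x)).1.1 = t; rw [enix]
    refine ⟨ix x, (ix1 _).1, (ix1 _).2, hte, fun w hw => ⟨?_, ?_⟩⟩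
    · rw [hDb]
      by_contra hcon
      push Not at hcon
      have : lsum α b t = 0 := by
        rw [lsum_dir]
        refine Finset.sum_eq_zero fun d _ => ?_
        by_contra hd
        exact hcon d (by omega) (decide_eq_true hd)
      have := T.temp_pos
      omega
    · intro d _ hd
      rw [hDb] at hd
      obtain ⟨-, t', h1, h2⟩ := key d (of_decide_eq_true hd)
      obtain ⟨e, h3, h4⟩ := hw _ _ h1
      refine ⟨e, h3, ?_⟩
      change decide (face (te (ix x)) (dirOf d) = face (te e) (opp (dirOf d))) = true
      rw [hte, h4]; exact decide_eq_true h2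

/-! ### The seed region -/

variable (W : World)

theorem seedS_ne (p : P3) : seedS W p ≠ none ↔ W.sd (blk W p) ≠ none := by
  simp [seedS]

theorem blk_iff (p b : P3) : blk W p = b ↔ ∀ i, 8 * W.K * b i ≤ p i ∧ p i < 8 * W.K * b i + 8 * W.K := by
  have hK := K_pos W
  rw [funext_iff]
  refine forall_congr' fun i => ?_
  unfold blk
  rw [Int.ediv_eq_iff_of_pos (by omega)]
  constructor <;> rintro ⟨h1, h2⟩ <;> constructor <;> nlinarith

theorem seed_fin (h : {b | W.sd b ≠ none}.Finite) : {p | seedS W p ≠ none}.Finite := by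
  refine Set.Finite.subset (h.biUnion (t := fun b => Set.Icc (fun i => 8 * W.K * b i) (fun i => 8 * W.K * b i + 8 * W.K))
    fun b _ => Set.finite_Icc _ _) ?_
  intro p hp
  rw [Set.mem_setOf_eq, seedS_ne] at hp
  refine Set.mem_biUnion hp ?_
  have := (blk_iff W p _).mp rfl
  exact ⟨fun i => (this i).1, fun i => (this i).2.le⟩

theorem walk {S : Set P3} (i : Fin 3) (n : ℕ) : ∀ p : P3, (∀ j : ℤ, 0 ≤ j → j ≤ n → Function.update p i (p i + j) ∈ S) →
    Relation.ReflTransGen (fun a b => adj a b ∧ a ∈ S ∧ b ∈ S) p (Function.update p i (p i + n)) := by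
  induction n with
  | zero => intro p _; simp; exact .refl
  | succ n ih =>
    intro p h
    refine .tail (ih p fun j h1 h2 => h j h1 (by push_cast; omega)) ⟨?_, h _ (by omega) (by push_cast; omega), h _ (by omega) le_rfl⟩
    rw [adj_iff]
    refine ⟨(i, true), ?_⟩
    funext j
    rw [nb_apply]
    by_cases hj : j = i
    · subst hj; simp [sg]; ring
    · simp [hj]

theorem rt_symm {S : Set P3} {p q : P3} (h : Relation.ReflTransGen (fun a b => adj a b ∧ a ∈ S ∧ b ∈ S) p q) :
    Relation.ReflTransGen (fun a b => adj a b ∧ a ∈ S ∧ b ∈ S) q p := by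
  have hs : ∀ ⦃a b : P3⦄, (adj a b ∧ a ∈ S ∧ b ∈ S) → (adj b a ∧ b ∈ S ∧ a ∈ S) := by
    rintro a b ⟨h1, h2, h3⟩
    refine ⟨?_, h3, h2⟩
    obtain ⟨f, rfl⟩ := (adj_iff _ _).mp h1
    exact (adj_iff _ _).mpr ⟨opp f, (nb_nb _ _).symm⟩
  induction h with
  | refl => exact .refl
  | tail _ h ih => exact .head (hs h) ih

def crn (b : P3) : P3 := fun i => 8 * W.K * b i

theorem to_crn {S : Set P3} {b : P3} (hS : ∀ p, blk W p = b → p ∈ S) {p : P3} (hp : blk W p = b) :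
    Relation.ReflTransGen (fun a b => adj a b ∧ a ∈ S ∧ b ∈ S) (crn W b) p := by
  have hK := K_pos W
  have hb := (blk_iff W p b).mp hp
  have step : ∀ (i : Fin 3) (q : P3), blk W q = b → q i = crn W b i →
      Relation.ReflTransGen (fun a b => adj a b ∧ a ∈ S ∧ b ∈ S) q (Function.update q i (p i)) ∧
      blk W (Function.update q i (p i)) = b := by
    intro i q hq hqi
    have hq' := (blk_iff W q b).mp hq
    have key : ∀ z, 8 * W.K * b i ≤ z → z < 8 * W.K * b i + 8 * W.K → blk W (Function.update q i z) = b := by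
      intro z h1 h2
      rw [blk_iff]
      intro j
      by_cases hj : j = i
      · subst hj; simp only [Function.update_self]; exact ⟨h1, h2⟩
      · simp only [Function.update_of_ne hj]; exact hq' j
    refine ⟨?_, key _ (hb i).1 (hb i).2⟩
    have hqi' : q i = 8 * W.K * b i := hqi
    have hbi := hb i
    have := walk (S := S) i (p i - q i).toNat q ?_
    · rwa [show q i + ((p i - q i).toNat : ℤ) = p i by omega] at this
    · intro j h1 h2
      exact hS _ (key _ (by omega) (by omega))
  have h0 : blk W (crn W b) = b := by
    rw [blk_iff]; intro i; simp only [crn]; omega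
  obtain ⟨a0, b0⟩ := step 0 _ h0 rfl
  obtain ⟨a1, b1⟩ := step 1 _ b0 (by simp)
  obtain ⟨a2, b2⟩ := step 2 _ b1 (by simp)
  have e : Function.update (Function.update (Function.update (crn W b) 0 (p 0)) 1 (p 1)) 2 (p 2) = p := by
    funext i; fin_cases i <;> simp [Function.update_apply]
  rw [e] at a2
  exact (a0.trans a1).trans a2

theorem crn_nb {S : Set P3} {b : P3} {i : Fin 3} (hS : ∀ p, blk W p = b → p ∈ S) (hS' : ∀ p, blk W p = nb b (i, true) → p ∈ S) :
    Relation.ReflTransGen (fun a b => adj a b ∧ a ∈ S ∧ b ∈ S) (crn W b) (crn W (nb b (i, true))) := by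
  have hK := K_pos W
  have := walk (S := S) i (8 * W.K).toNat (crn W b) ?_
  · rw [show ((8 * W.K).toNat : ℤ) = 8 * W.K by omega] at this
    convert this using 1
    funext j
    simp only [crn, nb_apply]
    by_cases hj : j = i
    · subst hj; simp [sg, crn]; ring
    · simp [hj, crn]
  · intro z h1 h2
    rw [show ((8 * W.K).toNat : ℤ) = 8 * W.K by omega] at h2
    by_cases hz : z = 8 * W.K
    · apply hS'
      rw [blk_iff]
      intro j
      simp only [crn, nb_apply]
      by_cases hj : j = i
      · subst hj; simp [sg, hz, crn]; constructor <;> nlinarith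
      · simp [hj, crn]; omega
    · apply hS
      rw [blk_iff]
      intro j
      simp only [crn]
      by_cases hj : j = i
      · subst hj; simp [crn]; omega
      · simp [hj, crn]; omega

theorem seed_conn (h : ConnectedSet {b | W.sd b ≠ none}) : ConnectedSet {p | seedS W p ≠ none} := by
  intro p hp q hq
  have hp' := (seedS_ne W p).mp hp
  have hq' := (seedS_ne W q).mp hq
  have hS : ∀ b, W.sd b ≠ none → ∀ p, blk W p = b → p ∈ {p | seedS W p ≠ none} := by
    rintro b hb p rfl
    exact (seedS_ne W p).mpr hb
  have hpath := h _ hp' _ hq'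
  have hc : Relation.ReflTransGen (fun a b => adj a b ∧ a ∈ {p | seedS W p ≠ none} ∧ b ∈ {p | seedS W p ≠ none})
      (crn W (blk W p)) (crn W (blk W q)) := by
    clear hq' hq
    generalize blk W q = c at hpath ⊢
    induction hpath with
    | refl => exact .refl
    | @tail b c _ hbc ih =>
      refine ih.trans ?_
      obtain ⟨h1, h2, h3⟩ := hbc
      obtain ⟨⟨i, s⟩, rfl⟩ := (adj_iff _ _).mp h1
      cases s with
      | true => exact crn_nb W (hS _ h2) (hS _ h3)
      | false =>
        have hb : nb (nb b (i, false)) (i, true) = b := nb_nb b (i, false)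
        have := crn_nb W (i := i) (hS _ h3) (by rw [hb]; exact hS _ h2)
        rw [hb] at this
        exact rt_symm this
  exact (rt_symm (to_crn W (hS _ hp') rfl)).trans (hc.trans (to_crn W (hS _ hq') rfl))

end IU

namespace IU

/-! ### The representation function -/

def Rf (W : World) (te : ℤ → TileType 3) : RepFn 3 := fun γ =>
  if h : ∃ e, Win W (cnt R1 γ) 0 e then some (te h.choose) else none

abbrev msc (W : World) : ℕ := (8 * W.K).toNat

abbrev rs (W : World) (te : ℤ → TileType 3) (α : Config 3) : Config 3 := repStar (Rf W te) (msc W) α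

structure Sys (T : TAS 3) (W : World) (te : ℤ → TileType 3) (U : TAS 3) : Prop where
  rel : Rel T W te
  tiles : U.tileset = USet R1 R2
  seed : U.seed = seedcfg R1 (seedS W)
  temp : U.temp = 2

variable {T U : TAS 3} {W : World} {te : ℤ → TileType 3}

theorem msc_val : ((msc W : ℕ) : ℤ) = 8 * W.K := by
  have := K_pos W
  unfold msc; omega

theorem Rf_iff {γ : Config 3} {t} : Rf W te γ = some t ↔ ∃ e, Win W (cnt R1 γ) 0 e ∧ te e = t := by
  unfold Rf
  constructor
  · intro h
    by_cases hh : ∃ e, Win W (cnt R1 γ) 0 e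
    · rw [dif_pos hh] at h
      exact ⟨_, hh.choose_spec, Option.some.inj h⟩
    · rw [dif_neg hh] at h; cases h
  · rintro ⟨e, he, rfl⟩
    have hh : ∃ e, Win W (cnt R1 γ) 0 e := ⟨e, he⟩
    rw [dif_pos hh, Win.uniq hh.choose_spec he]

theorem mblock_ch (α : Config 3) (b : P3) {x : ℤ} (h0 : 0 ≤ x) (h1 : x < W.K) :
    mblock (msc W) α b (ch W 0 x) = α (ch W b x) := by
  have := (blk_iff W _ _).mp (blk_ch W (b := 0) h0 h1)
  unfold mblock
  rw [if_pos]
  · congr 1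
    funext i
    rw [msc_val]
    simp only [ch, pt, Pi.zero_apply]
    ring
  · intro i
    rw [msc_val]
    have := this i
    simp only [Pi.zero_apply, mul_zero, zero_add] at this
    exact this

theorem mwin {α : Config 3} {b : P3} {e} : Win W (cnt R1 (mblock (msc W) α b)) 0 e ↔ win W α b e := by
  have hc : ∀ x, 0 ≤ x → x < W.K → cnt R1 (mblock (msc W) α b) (ch W 0 x) = cn α (ch W b x) := by
    intro x h0 h1
    simp only [cn, cnt]
    rw [mblock_ch α b h0 h1]
  have hK : W.K = 2 * W.N := rfl
  unfold win Win
  constructor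
  · rintro ⟨h1, h2, ⟨l, h3⟩, h4⟩
    refine ⟨h1, h2, ⟨l, ?_⟩, fun x hx hx' => ?_⟩
    · rw [← hc _ (by omega) (by omega)]; exact h3
    · rw [← hc _ (by omega) (by omega)]; exact h4 x hx hx'
  · rintro ⟨h1, h2, ⟨l, h3⟩, h4⟩
    refine ⟨h1, h2, ⟨l, ?_⟩, fun x hx hx' => ?_⟩
    · rw [hc _ (by omega) (by omega)]; exact h3
    · rw [hc _ (by omega) (by omega)]; exact h4 x hx hx'

theorem rep_iff {α : Config 3} {b t} : rs W te α b = some t ↔ ∃ e, win W α b e ∧ te e = t := by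
  unfold rs repStar
  rw [Rf_iff]
  simp only [mwin]

theorem rep_none {α : Config 3} {b} : rs W te α b = none ↔ ∀ e, ¬ win W α b e := by
  rw [Option.eq_none_iff_forall_ne_some]
  constructor
  · intro h e he
    exact h (te e) (rep_iff.mpr ⟨e, he, rfl⟩)
  · intro h t ht
    obtain ⟨e, he, -⟩ := rep_iff.mp ht
    exact h e he

theorem rep_ext {α β : Config 3} (h : Extends α β) : Extends (rs W te α) (rs W te β) := by
  intro b t hb
  obtain ⟨e, he, ht⟩ := rep_iff.mp hb
  exact rep_iff.mpr ⟨e, win_mono h _ _ he, ht⟩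

theorem valid_rep (hR : Rel T W te) : ValidRep T.tileset (Rf W te) := by
  constructor
  · intro γ γ' h t ht
    obtain ⟨e, he, h1⟩ := Rf_iff.mp ht
    exact Rf_iff.mpr ⟨e, Win.mono (fun p q hq => cnt_mono R1 h hq) he, h1⟩
  · intro γ t ht
    obtain ⟨e, he, rfl⟩ := Rf_iff.mp ht
    exact hR.mem e he.1 he.2.1

/-! ### Producible assemblies of the simulator -/

theorem Sys.attach (S : Sys T W te U) {α β : Config 3} (hg : Good U α) (hi : Inv W α) :
    Attach U α β ↔ ∃ p r, α p = none ∧ IsRule R1 R2 r ∧ Enab R1 α p r ∧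
      β = Function.update α p (some (rtile R1 r)) := by
  rw [attach_iff hg, S.tiles, S.temp]
  constructor
  · rintro ⟨p, t, h1, h2, h3, h4⟩
    obtain ⟨r, a, b, rfl⟩ := (hi.wf.attachable h1).mp ⟨h2, h3⟩
    exact ⟨p, r, h1, a, b, h4⟩
  · rintro ⟨p, r, h1, a, b, h4⟩
    obtain ⟨h2, h3⟩ := (hi.wf.attachable h1).mpr ⟨r, a, b, rfl⟩
    exact ⟨p, _, h1, h2, h3, h4⟩

theorem Sys.chain_inv (S : Sys T W te U) {f : ℕ → Config 3} (hc : Chain (Attach U) f) (h0 : Good U (f 0))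
    (hi : Inv W (f 0)) (n : ℕ) : Good U (f n) ∧ Inv W (f n) := by
  refine chain_ind hc (I := fun α => Good U α ∧ Inv W α) ⟨h0, hi⟩ ?_ n
  rintro α β ⟨h1, h2⟩ h
  refine ⟨good_mono h1 h, ?_⟩
  obtain ⟨p, r, a1, a2, a3, rfl⟩ := (S.attach h1 h2).mp h
  exact h2.step a1 a2 a3

theorem Sys.prod_inv (S : Sys T W te U) {α β : Config 3} (hg : Good U α) (hi : Inv W α)
    (h : ProducesFrom (Attach U) α β) : Inv W β := by
  obtain ⟨f, rfl, hc, hl⟩ := h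
  exact inv_limit (fun n m h => chain_ext hc h) hl (fun n => (S.chain_inv hc hg hi n).2)

theorem Sys.inv0 (S : Sys T W te U) : Inv W U.seed := by rw [S.seed]; exact inv_seed

theorem Sys.good (_ : Sys T W te U) {α : Config 3} (h : ProducesFrom (Attach U) U.seed α) : Good U α :=
  produces_good (good_seed U) h

theorem Sys.inv (S : Sys T W te U) {α : Config 3} (h : ProducesFrom (Attach U) U.seed α) : Inv W α :=
  S.prod_inv (good_seed U) S.inv0 h

theorem Sys.win_sd (_ : Sys T W te U) {α : Config 3} (hi : Inv W α) {b e} (h : W.sd b = some e) : win W α b e :=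
  Win.mono (fun _ _ hq => seed_cn hi.wf hq) (seed_win W h)

theorem seedcfg_ne (p : P3) : seedcfg R1 (seedS W) p ≠ none ↔ W.sd (blk W p) ≠ none := by
  rw [← seedS_ne]; simp [seedcfg]

theorem Sys.seed_rep (S : Sys T W te U) : rs W te U.seed = T.seed := by
  funext b
  rw [S.rel.seed b]
  cases hb : W.sd b with
  | none =>
    rw [Option.map_none, rep_none]
    intro e he
    obtain ⟨l, hl⟩ := he.2.2.1
    have h1 := he.1
    have h2 := he.2.1
    have hK : W.K = 2 * W.N := rfl
    rw [S.seed] at hl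
    have : seedcfg R1 (seedS W) (ch W b (2 * e + 1)) ≠ none := by
      intro h
      simp only [cn, cnt, h, Option.bind_none] at hl
      cases hl
    rw [seedcfg_ne, blk_ch W (by omega) (by omega)] at this
    exact this hb
  | some e =>
    rw [Option.map_some, rep_iff]
    exact ⟨e, S.win_sd S.inv0 hb, rfl⟩

/-! ### Following -/

theorem Sys.follow_step (S : Sys T W te U) {α β : Config 3} (hg : Good U α) (hi : Inv W α)
    (hT : Good T (rs W te α)) (h : Attach U α β) : rs W te α = rs W te β ∨ Attach T (rs W te α) (rs W te β) := by
  obtain ⟨p, r, a1, a2, a3, rfl⟩ := (S.attach hg hi).mp h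
  set β := Function.update α p (some (rtile R1 r)) with hβ
  have hext : Extends α β := extends_update a1 _
  have hKN : W.K = 2 * W.N := rfl
  have hloc : ∀ b e, b ≠ blk W p → win W β b e → win W α b e := by
    intro b e hb hw
    have hc : ∀ x, 0 ≤ x → x < W.K → cn β (ch W b x) = cn α (ch W b x) := by
      intro x h0 h1
      have : ch W b x ≠ p := by
        rintro rfl
        exact hb (blk_ch W h0 h1).symm
      simp only [cn, cnt, hβ, Function.update_of_ne this]
    obtain ⟨h1, h2, ⟨l, h3⟩, h4⟩ := hw
    refine ⟨h1, h2, ⟨l, ?_⟩, fun x hx hx' => ?_⟩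
    · rw [← hc _ (by omega) (by omega)]; exact h3
    · rw [← hc _ (by omega) (by omega)]; exact h4 x hx hx'
  by_cases hall : ∀ b e, win W β b e → win W α b e
  · left
    apply ext_antisymm (rep_ext hext)
    intro b t hb
    obtain ⟨e, he, ht⟩ := rep_iff.mp hb
    exact rep_iff.mpr ⟨e, hall _ _ he, ht⟩
  · right
    push Not at hall
    obtain ⟨b, e, hw, hn⟩ := hall
    have hb : b = blk W p := by by_contra hb; exact hn (hloc b e hb hw)
    rcases hi.new a1 a2 a3 hw with h | ⟨-, h2, h3, h4, h5⟩
    · exact absurd h hn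
    rw [attach_iff hT]
    refine ⟨b, te e, rep_none.mpr h2, S.rel.mem e h3 h4,
      S.rel.sound _ (win W α) (fun b e h => rep_iff.mpr ⟨e, h, rfl⟩) b e h3 h4 h5, ?_⟩
    funext b'
    by_cases hbb : b' = b
    · subst hbb
      rw [Function.update_self]
      exact rep_iff.mpr ⟨e, hw, rfl⟩
    · rw [Function.update_of_ne hbb]
      have h1 : ∀ t, rs W te β b' = some t ↔ rs W te α b' = some t := by
        intro t
        refine ⟨fun h => ?_, fun h => rep_ext hext _ _ h⟩
        obtain ⟨e', he', ht⟩ := rep_iff.mp h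
        exact rep_iff.mpr ⟨e', hloc b' e' (by rw [← hb]; exact hbb) he', ht⟩
      exact Option.ext h1

theorem Sys.follow (S : Sys T W te U) {α β : Config 3} (hg : Good U α) (hi : Inv W α)
    (hT : Good T (rs W te α)) (h : ProducesFrom (Attach U) α β) :
    ProducesFrom (Attach T) (rs W te α) (rs W te β) := by
  obtain ⟨f, rfl, hc, hl⟩ := h
  have hGI := S.chain_inv hc hg hi
  have hgT : ∀ n, Good T (rs W te (f n)) := by
    intro n
    induction n with
    | zero => exact hT
    | succ n ih =>
      rcases hc n with h | h
      · rwa [← h]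
      · rcases S.follow_step (hGI n).1 (hGI n).2 ih h with h | h
        · rwa [← h]
        · exact good_mono ih h
  refine ⟨fun n => rs W te (f n), rfl, fun n => ?_, fun b t => ⟨fun h => ?_, ?_⟩⟩
  · rcases hc n with h | h
    · left; change rs W te (f n) = rs W te (f (n+1)); rw [← h]
    · exact S.follow_step (hGI n).1 (hGI n).2 (hgT n) h
  · obtain ⟨e, he, ht⟩ := rep_iff.mp h
    obtain ⟨n, hn⟩ := win_limit (fun n m h => chain_ext hc h) hl he
    exact ⟨n, rep_iff.mpr ⟨e, hn, ht⟩⟩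
  · rintro ⟨n, hn⟩
    exact rep_ext (limit_ext hl n) _ _ hn

theorem Sys.follow0 (S : Sys T W te U) {α : Config 3} (h : ProducesFrom (Attach U) U.seed α) :
    ProducesFrom (Attach T) T.seed (rs W te α) := by
  have := S.follow (good_seed U) S.inv0 (by rw [S.seed_rep]; exact good_seed T) h
  rwa [S.seed_rep] at this

theorem Sys.goodT (S : Sys T W te U) {α : Config 3} (h : ProducesFrom (Attach U) U.seed α) : Good T (rs W te α) :=
  produces_good (good_seed T) (S.follow0 h)

/-! ### Clean mapping -/

theorem near_clean {α : Config 3} {b : P3} (h : Near (win W α) b) :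
    rs W te α b ≠ none ∨ ∃ u, adj b u ∧ rs W te α u ≠ none := by
  have key : ∀ b e, win W α b e → rs W te α b ≠ none := fun b e h h' => rep_none.mp h' e h
  rcases h with ⟨e, he⟩ | ⟨d, e, he⟩
  · exact Or.inl (key _ _ he)
  · exact Or.inr ⟨_, (adj_iff _ _).mpr ⟨dirOf d, rfl⟩, key _ _ he⟩

theorem Sys.clean (S : Sys T W te U) {α : Config 3} (hi : Inv W α) : MapsCleanly (Rf W te) (msc W) α := by
  left
  rintro x ⟨y, hy⟩
  have hyx : ∃ p, α p ≠ none ∧ blk W p = x := by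
    unfold mblock at hy
    by_cases hh : ∀ i, 0 ≤ y i ∧ y i < ((msc W : ℕ) : ℤ)
    · rw [if_pos hh] at hy
      refine ⟨_, hy, ?_⟩
      rw [blk_iff]
      intro i
      have := hh i
      rw [msc_val] at this ⊢
      constructor <;> linarith [this.1, this.2]
    · rw [if_neg hh] at hy; exact absurd rfl hy
  obtain ⟨p, hp, rfl⟩ := hyx
  obtain ⟨q, hq⟩ := hi.wf.cnt_ne hp
  have hal := hi.al p q hq
  have hc7 : (chip : Kind).val ≤ 8 := by decide
  have chipW : ∀ b c e, p = pt W b chip c → In W c → win W α b e → rs W te α (blk W p) ≠ none ∨ ∃ u, adj (blk W p) u ∧ rs W te α u ≠ none := by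
    rintro b c e rfl hin hw
    rw [blk_pt0 W hc7 hin]
    exact near_clean (Or.inl ⟨e, hw⟩)
  cases q with
  | sq k F D =>
    obtain ⟨b, c, ρ, rfl, hin, hcls, -⟩ := hal
    rcases hcls with ⟨-, e, he, -⟩ | ⟨hk, -, hn, -⟩
    · rw [blk_pt W hin]
      rcases tab_hom k with h | ⟨f, h⟩
      · left
        have : (fun i => b i + hom k i) = b := by funext i; rw [h i, add_zero]
        rw [this]
        exact fun h' => rep_none.mp h' e he
      · right
        have : (fun i => b i + hom k i) = nb b f := by funext i; rw [h i, nb_apply]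
        rw [this]
        refine ⟨b, (adj_iff _ _).mpr ⟨opp f, (nb_nb _ _).symm⟩, fun h' => rep_none.mp h' e he⟩
    · rw [blk_pt0 W (by omega) hin]
      exact near_clean hn
  | tok d top l =>
    obtain ⟨b, c, rfl, hin, -, -, -, -, hn, -⟩ := hal
    rw [blk_pt0 W (by simp only [bus]; omega) hin]
    exact near_clean hn
  | nc ev tk l =>
    obtain ⟨b, c, rfl, hin, -, -, -, -, -, hn⟩ := hal
    rw [blk_pt0 W hc7 hin]
    exact near_clean hn
  | bk w => obtain ⟨b, c, e, h1, h2, -, -, h3, -⟩ := hal; exact chipW b c e h1 h2 h3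
  | wi => obtain ⟨b, c, e, h1, h2, -, -, -, -, h3⟩ := hal; exact chipW b c e h1 h2 h3
  | sel r f l => obtain ⟨b, c, e, h1, h2, -, -, -, h3, -⟩ := hal; exact chipW b c e h1 h2 h3
  | selodd l => obtain ⟨b, c, e, h1, h2, -, -, -, h3, -⟩ := hal; exact chipW b c e h1 h2 h3
  | rw r => obtain ⟨b, c, e, h1, h2, -, -, -, h3, -⟩ := hal; exact chipW b c e h1 h2 h3
  | fil =>
    obtain ⟨b, h1, h2⟩ := hal
    rw [(blk_iff W p b).mpr h2]
    obtain ⟨e, he⟩ := Option.ne_none_iff_exists'.mp h1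
    left
    exact fun h' => rep_none.mp h' e (S.win_sd hi he)

end IU

namespace IU

variable {T U : TAS 3} {W : World} {te : ℤ → TileType 3}

theorem reach' {T : TAS 3} {α γ : Config 3} (hg : Good T α) (hαγ : Extends α γ)
    (h : ∀ δ, ProducesFrom (Attach T) α δ → Extends δ γ → δ ≠ γ →
      ∃ p t, δ p = none ∧ γ p = some t ∧ t ∈ T.tileset ∧ T.temp ≤ lsum δ p t) :
    ProducesFrom (Attach T) α γ := by
  obtain ⟨δ, h1, h2, h3⟩ := greedy T (fun p t => γ p = some t) hg
  have hδ : Extends δ γ := by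
    intro p t hp
    cases ha : α p with
    | none => exact h2 p t ha hp
    | some s =>
      have := produces_ext h1 _ _ ha
      rw [this] at hp
      rw [← hp]; exact hαγ _ _ ha
  by_cases he : δ = γ
  · rwa [← he]
  · obtain ⟨p, t, a, b, c, e⟩ := h δ h1 hδ he
    exact absurd e (h3 p t a c b)

theorem terminal_self {A : Config 3 → Config 3 → Prop} {α β : Config 3} (ht : Terminal A α) (h : ProducesFrom A α β) : β = α := by
  obtain ⟨f, rfl, hc, hl⟩ := h
  have hn : ∀ n, f n = f 0 := by
    intro n
    induction n with
    | zero => rfl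
    | succ n ih =>
      rcases hc n with h | h
      · rw [← h, ih]
      · rw [ih] at h; exact absurd h (ht _)
  funext p
  refine Option.ext fun t => ?_
  rw [hl p t]
  constructor
  · rintro ⟨n, h⟩; rwa [hn n] at h
  · intro h; exact ⟨0, h⟩

theorem nc_at {α : Config 3} (hi : Inv W α) {B : P3} (hB : W.sd B = none) {x : ℤ} (h0 : 0 ≤ x) (h1 : x < W.K)
    (hne : α (ch W B x) ≠ none) : ∃ ev tk l, cn α (ch W B x) = some (.nc ev tk l) ∧ ev = decide (x % 2 = 0) := by
  obtain ⟨q, hq⟩ := hi.wf.cnt_ne hne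
  have hal := hi.al _ q hq
  have key : ∀ b c, ch W B x = pt W b chip c → In W c → c = ax x := fun b c h hin =>
    (pt_inj W h (In_ax W h0 h1) hin).2.2.symm
  have key1 : ∀ b c, ch W B x = pt W b chip c → In W c → c 1 = 0 := fun b c h hin => by rw [key b c h hin]; rfl
  cases q with
  | sq k F D =>
    obtain ⟨b, c, ρ, h, hin, hcls, -⟩ := hal
    obtain ⟨-, rfl, -⟩ := pt_inj W h (In_ax W h0 h1) hin
    rcases hcls with ⟨hk, -⟩ | ⟨hk, -⟩
    · exact absurd hk (by decide)
    · exact absurd hk (by decide)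
  | tok d top l =>
    obtain ⟨b, c, h, hin, -⟩ := hal
    obtain ⟨-, h2, -⟩ := pt_inj W h (In_ax W h0 h1) hin
    have := congrArg Fin.val h2
    simp only [bus, chip] at this
    have h7 : ((7 : Kind) : ℕ) = 7 := rfl
    omega
  | nc ev tk l =>
    obtain ⟨b, c, h, hin, -, -, h3, -⟩ := hal
    rw [key b c h hin] at h3
    exact ⟨ev, tk, l, hq, h3⟩
  | bk w =>
    obtain ⟨b, c, e, h, h2, h3, -⟩ := hal
    have := key1 b c h h2
    omega
  | wi =>
    obtain ⟨b, c, e, h, h2, -, h3, -⟩ := hal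
    have := key1 b c h h2
    omega
  | sel r f l =>
    obtain ⟨b, c, e, h, h2, -, h3, -, h4, -⟩ := hal
    have := key1 b c h h2
    have := h4.1
    omega
  | selodd l =>
    obtain ⟨b, c, e, h, h2, -, h3, -, h4, -⟩ := hal
    have := key1 b c h h2
    have := h4.1
    omega
  | rw r =>
    obtain ⟨b, c, e, h, h2, -, h3, -, h4, -⟩ := hal
    have := key1 b c h h2
    have := h4.1
    omega
  | fil =>
    obtain ⟨b, h, h2⟩ := hal
    have := (blk_iff W _ b).mpr h2
    rw [blk_ch W h0 h1] at this
    rw [this] at hB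
    exact absurd hB h

/-! ### Terminal assemblies -/

theorem Sys.term_rep (S : Sys T W te U) {α : Config 3} (hp : ProducesFrom (Attach U) U.seed α)
    (ht : Terminal (Attach U) α) : Terminal (Attach T) (rs W te α) := by
  have hi := S.inv hp
  have hg := S.good hp
  have hno : ∀ p r, IsRule R1 R2 r → Enab R1 α p r → α p ≠ none := fun p r h1 h2 h3 =>
    ht _ ((S.attach hg hi).mpr ⟨p, r, h3, h1, h2, rfl⟩)
  have hlive : Live W α := ⟨hi, fun p h1 r h2 h3 => absurd h1 (hno p r h2 h3)⟩
  intro β hβ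
  obtain ⟨B, t, h1, h2, h3, -⟩ := (attach_iff (S.goodT hp)).mp hβ
  obtain ⟨u, hu1, hu2, -, hv⟩ := S.rel.compl _ B t h2 h3
  have hv := hv (win W α) (fun b t h => rep_iff.mp h)
  have hK : W.K = 2 * W.N := rfl
  have hB : W.sd B = none := by
    cases hs : W.sd B with
    | none => rfl
    | some e => exact absurd (S.win_sd hi hs) (rep_none.mp h1 e)
  have hall : ∀ n : ℕ, ∀ x : ℤ, x = 2 * u + 1 + n → x < W.K → ∃ ev tk l, cn α (ch W B x) = some (.nc ev tk l) := by
    intro n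
    induction n with
    | zero =>
      intro x hx hxK
      obtain ⟨r, a1, a2, -⟩ := line_take hlive hv hB (by omega) hu2
      have hx' : x = 2 * u + 1 := by simpa using hx
      subst hx'
      obtain ⟨ev, tk, l, hc, -⟩ := nc_at hi hB (by omega) hxK (hno _ r a1 a2)
      exact ⟨ev, tk, l, hc⟩
    | succ n ih =>
      intro x hx hxK
      obtain ⟨ev, tk, l, hc⟩ := ih (x - 1) (by push_cast at hx; omega) (by omega)
      obtain ⟨r, a1, a2, -⟩ := line_next hlive (valid_bus5 hlive hv hB) (by omega) (by omega) hc
      rw [sub_add_cancel] at a2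
      obtain ⟨ev, tk, l, hc, -⟩ := nc_at hi hB (by omega) hxK (hno _ r a1 a2)
      exact ⟨ev, tk, l, hc⟩
  obtain ⟨ev, tk, l, hc⟩ := hall (W.K - 1 - (2 * u + 1)).toNat (W.K - 1) (by omega) (by omega)
  obtain ⟨e, he⟩ := exists_win hi.wf hi.al hB (W.K - 1).toNat (W.K - 1) (by omega) (by omega) ⟨ev, tk, l, hc⟩
    (fun y h1 h2 => by omega)
  exact rep_none.mp h1 e he

/-! ### Modelling -/

def PureC (W : World) (α : Config 3) : Prop :=
  ∀ p ev tk l, cn α p = some (.nc ev tk l) → ∃ e, win W α (blk W p) e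

theorem Sys.models1 (S : Sys T W te U) {α' β : Config 3} (hp : ProducesFrom (Attach U) U.seed α') (hpure : PureC W α')
    (h : ProducesFrom (Attach T) (rs W te α') β) : ∃ β', ProducesFrom (Attach U) α' β' ∧ rs W te β' = β := by
  have hgT := S.goodT hp
  have hi' := S.inv hp
  have hg' := S.good hp
  have hK : W.K = 2 * W.N := rfl
  obtain ⟨g, hg0, hc, hl⟩ := h
  have hgood : ∀ n, Good T (g n) := chain_good hc (by rw [hg0]; exact hgT)
  -- stages
  have hst : ∀ b, ∃ u : ℤ, rs W te α' b = none → β b ≠ none → 1 ≤ u ∧ u < W.N ∧ β b = some (te u) ∧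
      ∃ n, g n b = none ∧ ∀ w : P3 → ℤ → Prop, (∀ b t, g n b = some t → ∃ e, w b e ∧ te e = t) → Valid W w b u := by
    intro b
    by_cases hb : rs W te α' b = none ∧ β b ≠ none
    · obtain ⟨hb1, hb2⟩ := hb
      obtain ⟨t, ht⟩ := Option.ne_none_iff_exists'.mp hb2
      obtain ⟨n, hn⟩ := (hl b t).mp ht
      have hex : ∃ n, g n b ≠ none := ⟨n, by rw [hn]; simp⟩
      have h1 := Nat.find_spec hex
      have h2 : ∀ m < Nat.find hex, g m b = none := fun m hm => by
        have := Nat.find_min hex hm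
        simpa using this
      generalize Nat.find hex = k at h1 h2
      cases k with
      | zero => rw [hg0] at h1; exact absurd hb1 h1
      | succ k =>
        have h3 := h2 k (Nat.lt_succ_self k)
        rcases hc k with h | h
        · rw [← h] at h1; exact absurd h3 h1
        · obtain ⟨p, t', a1, a2, a3, a4⟩ := (attach_iff (hgood k)).mp h
          have hpb : p = b := by
            by_contra hne
            rw [a4, Function.update_of_ne (Ne.symm hne)] at h1
            exact h1 h3
          subst hpb
          obtain ⟨u, u1, u2, u3, u4⟩ := S.rel.compl _ p t' a2 a3
          refine ⟨u, fun _ _ => ⟨u1, u2, ?_, k, h3, u4⟩⟩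
          rw [u3]
          refine limit_ext hl (k + 1) _ _ ?_
          rw [a4, Function.update_self]
    · exact ⟨0, fun h1 h2 => absurd ⟨h1, h2⟩ hb⟩
  choose u hu using hst
  obtain ⟨γ, hγ, hOk, hmax⟩ := greedy U (fun p t => ∀ ev tk l, ct R1 t = some (.nc ev tk l) →
    ∃ b x, p = ch W b x ∧ 0 ≤ x ∧ x < W.K ∧ rs W te α' b = none ∧ β b ≠ none ∧ 2 * u b + 1 ≤ x ∧
      tk = decide (x = 2 * u b + 1)) hg'
  refine ⟨γ, hγ, ?_⟩
  have hiγ : Inv W γ := S.prod_inv hg' hi' hγ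
  have hext := produces_ext hγ
  have hmax' : ∀ p r, IsRule R1 R2 r → Enab R1 γ p r → (∀ ev tk l, r.1 = .nc ev tk l →
    ∃ b x, p = ch W b x ∧ 0 ≤ x ∧ x < W.K ∧ rs W te α' b = none ∧ β b ≠ none ∧ 2 * u b + 1 ≤ x ∧
      tk = decide (x = 2 * u b + 1)) → γ p ≠ none := by
    intro p r h1 h2 h3 h4
    obtain ⟨c1, c2⟩ := (hiγ.wf.attachable h4).mpr ⟨r, h1, h2, rfl⟩
    refine hmax p (rtile R1 r) h4 (by rw [S.tiles]; exact c1) ?_ (by rw [S.temp]; exact c2)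
    intro ev tk l hct
    rw [ct_rtile] at hct
    exact h3 ev tk l (Option.some.inj hct)
  have hlive : Live W γ := by
    refine ⟨hiγ, fun p h1 r h2 h3 => ?_⟩
    by_contra hcon
    exact hmax' p r h2 h3 (fun ev tk l h => absurd ⟨ev, tk, l, h⟩ hcon) h1
  -- contents of new counter cells
  have hcell : ∀ b x ev tk l, 0 ≤ x → x < W.K → rs W te α' b = none → cn γ (ch W b x) = some (.nc ev tk l) →
      β b ≠ none ∧ 2 * u b + 1 ≤ x ∧ tk = decide (x = 2 * u b + 1) := by
    intro b x ev tk l h0 h1 hb hcn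
    have hα : α' (ch W b x) = none := by
      by_contra hne
      obtain ⟨q, hq⟩ := hi'.wf.cnt_ne hne
      have := cnt_mono R1 hext hq
      change cn γ (ch W b x) = some q at this
      rw [hcn] at this
      obtain rfl := Option.some.inj this
      obtain ⟨e, he⟩ := hpure _ _ _ _ hq
      rw [blk_ch W h0 h1] at he
      exact rep_none.mp hb e he
    cases hγp : γ (ch W b x) with
    | none => simp only [cn, cnt, hγp, Option.bind_none] at hcn; cases hcn
    | some t =>
      have hct : ct R1 t = some (.nc ev tk l) := by
        simp only [cn, cnt, hγp, Option.bind_some] at hcn; exact hcn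
      obtain ⟨b', x', a1, a2, a3, a4, a5, a6, a7⟩ := hOk _ _ hα hγp ev tk l hct
      obtain ⟨rfl, rfl⟩ := ch_inj W a1 h0 h1 a2 a3
      exact ⟨a5, a6, a7⟩
  have hup : ∀ n b t, g n b = some t → rs W te γ b = some t := by
    intro n
    induction n with
    | zero => intro b t h; rw [hg0] at h; exact rep_ext hext _ _ h
    | succ n ih =>
      intro B t hB
      cases hgn : g n B with
      | some s =>
        have := chain_ext hc (Nat.le_succ n) _ _ hgn
        rw [this] at hB
        obtain rfl := Option.some.inj hB
        exact ih _ _ hgn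
      | none =>
        have hβ : β B = some t := limit_ext hl (n + 1) _ _ hB
        have hαB : rs W te α' B = none := by
          cases hr : rs W te α' B with
          | none => rfl
          | some s =>
            have := chain_ext hc (Nat.zero_le n) B s (by rw [hg0]; exact hr)
            rw [hgn] at this; cases this
        have hβne : β B ≠ none := by rw [hβ]; simp
        obtain ⟨u1, u2, u3, k, k1, k2⟩ := hu B hαB hβne
        have hkn : k ≤ n := by
          by_contra hk
          have := chain_ext hc (show n + 1 ≤ k by omega) _ _ hB
          rw [k1] at this; cases this
        have hv : Valid W (win W γ) B (u B) := k2 _ fun b t h => rep_iff.mp (ih b t (chain_ext hc hkn _ _ h))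
        have hsd : W.sd B = none := by
          cases hs : W.sd B with
          | none => rfl
          | some e => exact absurd (S.win_sd hi' hs) (rep_none.mp hαB e)
        have hline : ∀ n : ℕ, ∀ x : ℤ, x = 2 * u B + 1 + n → x < W.K → ∃ ev tk l, cn γ (ch W B x) = some (.nc ev tk l) ∧
            ev = decide (x % 2 = 0) := by
          intro n
          induction n with
          | zero =>
            intro x hx hxK
            obtain ⟨r, a1, a2, l, a3⟩ := line_take hlive hv hsd (by omega) u2
            have hx' : x = 2 * u B + 1 := by simpa using hx
            subst hx'
            refine nc_at hiγ hsd (by omega) hxK (hmax' _ r a1 a2 ?_)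
            intro ev tk l' hr
            rw [a3] at hr
            injection hr with r1 r2 r3
            exact ⟨B, _, rfl, by omega, hxK, hαB, hβne, le_rfl, by rw [← r2]; simp⟩
          | succ n ih2 =>
            intro x hx hxK
            push_cast at hx
            obtain ⟨ev, tk, l, hc, -⟩ := ih2 (x - 1) (by omega) (by omega)
            obtain ⟨r, a1, a2, ev1, l1, a3⟩ := line_next hlive (valid_bus5 hlive hv hsd) (by omega) (by omega) hc
            rw [sub_add_cancel] at a2
            refine nc_at hiγ hsd (by omega) hxK (hmax' _ r a1 a2 ?_)
            intro ev tk l' hr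
            rw [a3] at hr
            injection hr with r1 r2 r3
            refine ⟨B, _, rfl, by omega, hxK, hαB, hβne, by omega, ?_⟩
            rw [← r2, eq_comm, decide_eq_false_iff_not]
            omega
        rw [rep_iff]
        refine ⟨u B, ⟨u1, u2, ?_, ?_⟩, ?_⟩
        · obtain ⟨ev, tk, l, h1, h2⟩ := hline 0 (2 * u B + 1) (by simp) (by omega)
          obtain ⟨-, -, h3⟩ := hcell B _ _ _ _ (by omega) (by omega) hαB h1
          have h4 : tk = true := by rw [h3]; simp
          have h5 : ev = false := by rw [h2, decide_eq_false_iff_not]; omega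
          subst h4 h5
          exact ⟨l, h1⟩
        · intro x hx hxK
          obtain ⟨ev, tk, l, h1, -⟩ := hline (x - (2 * u B + 1)).toNat x (by omega) hxK
          obtain ⟨-, -, h3⟩ := hcell B _ _ _ _ (by omega) hxK hαB h1
          have h4 : tk = false := by rw [h3, decide_eq_false_iff_not]; omega
          subst h4
          exact ⟨ev, l, h1⟩
        · rw [u3] at hβ; exact Option.some.inj hβ
  apply ext_antisymm
  · intro b t hb
    cases hα : rs W te α' b with
    | some s =>
      have := rep_ext hext _ _ hα
      rw [hb] at this
      obtain rfl := Option.some.inj this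
      exact limit_ext hl 0 _ _ (by rw [hg0]; exact hα)
    | none =>
      obtain ⟨e, he, rfl⟩ := rep_iff.mp hb
      obtain ⟨l, hcl⟩ := he.2.2.1
      have e1 := he.1
      have e2 := he.2.1
      obtain ⟨h1, h2, h3⟩ := hcell b _ _ _ _ (by omega) (by omega) hα hcl
      have : 2 * e + 1 = 2 * u b + 1 := of_decide_eq_true h3.symm
      obtain ⟨-, -, h4, -⟩ := hu b hα h1
      rw [h4, show e = u b by omega]
  · intro b t hb
    obtain ⟨n, hn⟩ := (hl b t).mp hb
    exact hup n b t hn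

end IU

namespace IU

variable {T U : TAS 3} {W : World} {te : ℤ → TileType 3}

theorem nc_input {ε : Config 3} (hi : Inv W ε) {p : P3} {r : Rule Q} (hr : IsRule R1 R2 r) (he : Enab R1 ε p r)
    {f : Dir} {ev tk l} (hf : inp r f = some (.nc ev tk l)) :
    blk W (nb p f) = blk W p ∧ ((∃ ev tk l, r.1 = .nc ev tk l) ∨ ∃ e, win W ε (blk W p) e) := by
  have hc := he _ _ hf
  have hc7 : (chip : Kind).val ≤ 8 := by decide
  have hKN : W.K = 2 * W.N := rfl
  have hK4 := K_pos W
  have key0 : ∀ ev' tk' l', cn ε (nb p (0, false)) = some (.nc ev' tk' l') → (ev' = true ∨ l' = false) →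
      blk W (nb p (0, false)) = blk W p := by
    intro ev' tk' l' hc hor
    obtain ⟨b', c1, hp, hin, a1, a2, a3, a4, -⟩ := hi.al _ _ hc
    have hin0 := hin 0
    have hne : c1 0 ≠ W.K - 1 := by
      rcases hor with rfl | rfl
      · have : c1 0 % 2 = 0 := by simpa using a3.symm
        omega
      · have : ¬ W.K - 2 ≤ c1 0 := by rw [eq_comm, decide_eq_false_iff_not] at a4; exact a4
        omega
    have i1 := In_nb W (t := 0) (e := false) hin (by simpa [en] using hne)
    rw [hp, inp_same W hp, blk_pt0 W hc7 hin]
    exact (blk_pt0 W hc7 i1).symm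
  have key1 : ∀ ev' tk' l', cn ε (nb p (1, false)) = some (.nc ev' tk' l') →
      ∃ b c1, nb p (1, false) = pt W b chip c1 ∧ In W c1 ∧ c1 1 = 0 ∧ c1 2 = 0 ∧ ev' = decide (c1 0 % 2 = 0) ∧
        l' = decide (W.K - 2 ≤ c1 0) ∧ p = pt W b chip (nb c1 (1, true)) ∧ In W (nb c1 (1, true)) := by
    intro ev' tk' l' hc
    obtain ⟨b', c1, hp, hin, a1, a2, a3, a4, -⟩ := hi.al _ _ hc
    have i1 := In_nb W (t := 1) (e := false) hin (by simp only [en]; simp; omega)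
    exact ⟨b', c1, hp, hin, a1, a2, a3, a4, inp_same W hp, i1⟩
  obtain ⟨c, ⟨f0, q0⟩, o⟩ := r
  cases o with
  | none =>
    have hr1 : R1 f0 q0 c := hr
    simp only [inp] at hf
    by_cases hff : f = f0
    · subst hff
      rw [if_pos rfl] at hf
      obtain rfl := Option.some.inj hf
      cases hr1 with
      | nPass => exact ⟨key0 _ _ _ hc (Or.inl rfl), Or.inl ⟨_, _, _, rfl⟩⟩
      | bStart =>
        obtain ⟨b, c1, hp, hin, a1, a2, a3, a4, hp2, i1⟩ := key1 _ _ _ hc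
        have hb : blk W p = b := by rw [hp2]; exact blk_pt0 W hc7 i1
        refine ⟨by rw [hb, hp]; exact blk_pt0 W hc7 hin, Or.inr ?_⟩
        rw [hb]
        have h0 : ¬ c1 0 % 2 = 0 := by rw [eq_comm, decide_eq_false_iff_not] at a3; exact a3
        have h1 : W.K - 2 ≤ c1 0 := of_decide_eq_true a4.symm
        have h2 := (hin 0).2
        change cn ε (nb p (1, false)) = _ at hc
        rw [hp] at hc
        exact (inv_SH hi.wf hi.al).last b c1 _ _ _ hin (by omega) a1 a2 hc
    · rw [if_neg hff] at hf; cases hf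
  | some o =>
    obtain ⟨f1, q1⟩ := o
    obtain ⟨hr2, hne, -, -⟩ := hr
    have i0 : inp (c, (f0, q0), some (f1, q1)) f0 = some q0 := by simp [inp]
    have i1 : inp (c, (f0, q0), some (f1, q1)) f1 = some q1 := by simp [inp, hne.symm]
    have hc0 := he _ _ i0
    have hc1 := he _ _ i1
    have hor : (f = f0 ∧ q0 = .nc ev tk l) ∨ (f = f1 ∧ q1 = .nc ev tk l) := by
      simp only [inp] at hf
      by_cases hff : f = f0
      · rw [if_pos hff] at hf; exact Or.inl ⟨hff, Option.some.inj hf⟩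
      · rw [if_neg hff] at hf
        by_cases hff1 : f = f1
        · rw [if_pos hff1] at hf; exact Or.inr ⟨hff1, Option.some.inj hf⟩
        · rw [if_neg hff1] at hf; cases hf
    clear hf hc i0 i1 he
    rcases hor with ⟨rfl, rfl⟩ | ⟨rfl, rfl⟩
    · cases hr2 with
      | nEv => exact ⟨key0 _ _ _ hc0 (Or.inr rfl), Or.inl ⟨_, _, _, rfl⟩⟩
    · cases hr2 with
      | bMove =>
        obtain ⟨b, c1, hp, hin, a1, a2, a3, a4, hp2, i1⟩ := key1 _ _ _ hc1
        have hb : blk W p = b := by rw [hp2]; exact blk_pt0 W hc7 i1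
        refine ⟨by rw [hb, hp]; exact blk_pt0 W hc7 hin, Or.inr ?_⟩
        rw [hb]
        obtain ⟨b', c', e, hp', hin', -, -, hw, h5, -⟩ := hi.al _ _ hc0
        have hw1 := hw.1
        have i2 := In_nb W (t := 0) (e := true) hin' (by simp only [en]; simp; omega)
        have h6 := (inp_same W hp').symm.trans hp2
        obtain ⟨rfl, -, -⟩ := pt_inj W h6 i2 i1
        exact ⟨e, hw⟩

theorem Sys.models2 (S : Sys T W te U) {α : Config 3} (hp : ProducesFrom (Attach U) U.seed α) :
    ∃ α', ProducesFrom (Attach U) U.seed α' ∧ rs W te α' = rs W te α ∧ PureC W α' ∧ ProducesFrom (Attach U) α' α := by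
  have hi := S.inv hp
  have hKN : W.K = 2 * W.N := rfl
  let Er : P3 → Prop := fun p => (∃ ev tk l, cn α p = some (.nc ev tk l)) ∧ ¬ ∃ e, win W α (blk W p) e
  let α' : Config 3 := fun p => if Er p then none else α p
  have hα' : ∀ p, ¬ Er p → α' p = α p := fun p h => if_neg h
  have hEr : ∀ p, Er p → α' p = none := fun p h => if_pos h
  have hnE : ∀ p t, α' p = some t → ¬ Er p ∧ α p = some t := by
    intro p t h
    by_cases hE : Er p
    · rw [hEr p hE] at h; cases h
    · exact ⟨hE, by rw [← hα' p hE]; exact h⟩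
  have hsub : Extends α' α := fun p t h => (hnE p t h).2
  have hσα := produces_ext hp
  have hσ : Extends U.seed α' := by
    intro p t h
    rw [hα', hσα p t h]
    rintro ⟨-, h2⟩
    have h3 : seedcfg R1 (seedS W) p ≠ none := by rw [← S.seed, h]; simp
    rw [seedcfg_ne] at h3
    obtain ⟨e, he⟩ := Option.ne_none_iff_exists'.mp h3
    exact h2 ⟨e, S.win_sd hi he⟩
  have hwin : ∀ b e, win W α b e → win W α' b e := by
    intro b e hw
    have hc : ∀ x, 0 ≤ x → x < W.K → cn α' (ch W b x) = cn α (ch W b x) := by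
      intro x h0 h1
      have : α' (ch W b x) = α (ch W b x) := by
        apply hα'
        rintro ⟨-, h2⟩
        rw [blk_ch W h0 h1] at h2
        exact h2 ⟨e, hw⟩
      simp only [cn, cnt, this]
    obtain ⟨h1, h2, ⟨l, h3⟩, h4⟩ := hw
    refine ⟨h1, h2, ⟨l, ?_⟩, fun x hx hx' => ?_⟩
    · rw [hc _ (by omega) (by omega)]; exact h3
    · rw [hc _ (by omega) (by omega)]; exact h4 x hx hx'
  have hprod : ProducesFrom (Attach U) U.seed α' := by
    refine reach' (good_seed U) hσ fun δ hδ hδα hne => ?_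
    have hiδ := S.inv hδ
    let δ' : Config 3 := fun p => if Er p then α p else δ p
    have hδ1 : ∀ p, Er p → δ' p = α p := fun p h => if_pos h
    have hδ2 : ∀ p, ¬ Er p → δ' p = δ p := fun p h => if_neg h
    have h0 : Extends U.seed δ' := by
      intro p t h
      rw [hδ2 p (hnE p t (hσ p t h)).1]
      exact produces_ext hδ p t h
    have hn : ¬ Extends α δ' := by
      intro hx
      apply hne
      refine ext_antisymm hδα fun p t h => ?_
      obtain ⟨h1, h2⟩ := hnE p t h
      rw [← hδ2 p h1]; exact hx p t h2
    obtain ⟨ε, p, t, e1, e2, e3, e4, e5, e6, e7, e8⟩ := first_missing (good_seed U) hp h0 hn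
    have hiε := S.inv e8
    have hpE : ¬ Er p := fun h => e4 (by rw [hδ1 p h]; exact e5)
    rw [hδ2 p hpE] at e4
    have hpα' : α' p = some t := by rw [hα' p hpE]; exact e5
    have hpδ : δ p = none := by
      cases hd : δ p with
      | none => rfl
      | some s =>
        have := hδα p s hd
        rw [hpα'] at this
        rw [hd, Option.some.inj this] at e4
        exact absurd rfl e4
    rw [S.tiles] at e6
    rw [S.temp] at e7
    obtain ⟨r, r1, r2, rfl⟩ := (hiε.wf.attachable e3).mp ⟨e6, e7⟩
    have hen : Enab R1 δ p r := by
      intro f q hq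
      have hcε := r2 f q hq
      cases hx : ε (nb p f) with
      | none => simp only [cnt, hx, Option.bind_none] at hcε; cases hcε
      | some t' =>
        have hct : ct R1 t' = some q := by simp only [cnt, hx, Option.bind_some] at hcε; exact hcε
        have hd' := e1 _ _ hx
        by_cases hE : Er (nb p f)
        · exfalso
          obtain ⟨⟨ev, tk, l, hnc⟩, hnw⟩ := hE
          have h1 : cn α (nb p f) = some q := cnt_mono R1 e2 hcε
          rw [hnc] at h1
          obtain rfl := Option.some.inj h1
          obtain ⟨hb, hor⟩ := nc_input hiε r1 r2 hq
          rw [hb] at hnw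
          rcases hor with ⟨ev', tk', l', hr⟩ | ⟨e, he⟩
          · refine hpE ⟨⟨ev', tk', l', ?_⟩, hnw⟩
            simp only [cn, cnt, e5, Option.bind_some, ct_rtile, hr]
          · exact hnw ⟨e, win_mono e2 _ _ he⟩
        · rw [hδ2 _ hE] at hd'
          simp only [cnt, hd', Option.bind_some]; exact hct
    refine ⟨p, rtile R1 r, hpδ, hpα', by rw [S.tiles]; exact e6, ?_⟩
    rw [S.temp]
    exact (hiδ.wf.lsum_rule hpδ r1).mpr hen
  refine ⟨α', hprod, ?_, ?_, ?_⟩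
  · refine ext_antisymm (rep_ext hsub) fun b t hb => ?_
    obtain ⟨e, he, ht⟩ := rep_iff.mp hb
    exact rep_iff.mpr ⟨e, hwin _ _ he, ht⟩
  · intro p ev tk l h
    cases hx : α' p with
    | none => simp only [cn, cnt, hx, Option.bind_none] at h; cases h
    | some t =>
      obtain ⟨h1, h2⟩ := hnE p t hx
      have h3 : cn α p = some (.nc ev tk l) := cnt_mono R1 hsub h
      by_contra hcon
      refine h1 ⟨⟨ev, tk, l, h3⟩, fun ⟨e, he⟩ => hcon ⟨e, hwin _ _ he⟩⟩
  · refine reach (S.good hprod) hsub fun δ h1 h2 hne => ?_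
    have hn : ¬ Extends α δ := fun hx => hne (ext_antisymm h2 hx)
    obtain ⟨ε, p, t, e1, e2, e3, e4, e5, e6, e7, e8⟩ := first_missing (good_seed U) hp (Ext_trans' hσ h1) hn
    refine ⟨p, t, ?_, e5, e6, e7.trans (lsum_mono e1 p t)⟩
    cases hd : δ p with
    | none => rfl
    | some s =>
      have := h2 p s hd
      rw [e5] at this
      rw [hd, Option.some.inj this] at e4
      exact absurd rfl e4

theorem Sys.pure_seed (S : Sys T W te U) : PureC W U.seed := by
  intro p ev tk l h
  have : seedcfg R1 (seedS W) p ≠ none := by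
    intro hn
    rw [S.seed] at h
    simp only [cn, cnt, hn, Option.bind_none] at h; cases h
  rw [seedcfg_ne] at this
  obtain ⟨e, he⟩ := Option.ne_none_iff_exists'.mp this
  exact ⟨e, S.win_sd S.inv0 he⟩

theorem Sys.prod (S : Sys T W te U) {α : Config 3} (h : ProducesFrom (Attach T) T.seed α) :
    ∃ α', ProducesFrom (Attach U) U.seed α' ∧ rs W te α' = α := by
  rw [← S.seed_rep] at h
  exact S.models1 (produces_refl _) S.pure_seed h

theorem Sys.simulates (S : Sys T W te U) : Simulates U T (Rf W te) (msc W) where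
  prod_eq := by
    intro α
    constructor
    · exact S.prod
    · rintro ⟨α', h, rfl⟩; exact S.follow0 h
  term_eq := by
    intro α
    constructor
    · rintro ⟨h, ht⟩
      obtain ⟨α', h1, rfl⟩ := S.prod h
      obtain ⟨β', h2, h3⟩ := terminal_ext (S.good h1)
      refine ⟨β', ⟨produces_trans (good_seed U) h1 h2, h3⟩, ?_⟩
      exact terminal_self ht (S.follow (S.good h1) (S.inv h1) (S.goodT h1) h2)
    · rintro ⟨α', ⟨h1, h2⟩, rfl⟩
      exact ⟨S.follow0 h1, S.term_rep h1 h2⟩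
  clean := fun α' h => S.clean (S.inv h)
  follows := fun α' β' h1 _ h3 => S.follow (S.good h1) (S.inv h1) (S.goodT h1) h3
  models := by
    intro α hα
    refine ⟨{α' | ProducesFrom (Attach U) U.seed α' ∧ rs W te α' = α ∧ PureC W α'}, fun α' h => ⟨h.1, h.2.1⟩, ?_⟩
    intro β _ hαβ
    constructor
    · rintro α' ⟨h1, rfl, h3⟩
      exact S.models1 h1 h3 hαβ
    · rintro α'' β' h1 rfl _ _
      obtain ⟨α', a1, a2, a3, a4⟩ := S.models2 h1
      exact ⟨α', ⟨a1, a2, a3⟩, a4⟩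

theorem exists_sys (T : TAS 3) : ∃ (W : World) (te : ℤ → TileType 3) (U : TAS 3), Sys T W te U := by
  obtain ⟨W, te, hR⟩ := exists_world T
  have hs : {b | W.sd b ≠ none} = dom T.seed := by
    ext b
    rw [mem_dom, hR.seed b]
    simp
  have hne : ∃ p, seedS W p ≠ none := by
    obtain ⟨b, hb⟩ := T.seed_nonempty
    rw [← hs] at hb
    refine ⟨ch W b 0, ?_⟩
    have hK := K_pos W
    rw [seedS_ne, blk_ch W le_rfl (by omega)]
    exact hb
  have hc := seed_conn W (by rw [hs]; exact T.seed_connected)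
  have hf := seed_fin W (by rw [hs]; exact T.seed_finite)
  exact ⟨W, te, UT R1 R2 (seedS W) hne hc hf, hR, rfl, rfl, rfl⟩

end IU

/-- **The 3D aTAM is intrinsically universal.** There exist a finite tile set
`U` of 3-dimensional tile types, a temperature `τ' ∈ ℤ⁺`, and functions `Rfun`
(assigning to each 3D aTAM system a valid macrotile representation function)
and `Sfun` (assigning to each 3D aTAM system a finite seed assembly over `U`)
such that for every 3D aTAM system `T` there is `m` for which
`UT = (U, Sfun T, τ')` simulates `T` at scale `m` under `Rfun T`. -/
theorem threeD_aTAM_intrinsically_universal :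
    ∃ (U : Finset (TileType 3)) (τ' : ℕ), 0 < τ' ∧
      ∃ (Rfun : TAS 3 → RepFn 3) (Sfun : TAS 3 → Config 3),
        ∀ T : TAS 3, ∃ (UT : TAS 3) (m : ℕ), 0 < m ∧
          UT.tileset = U ∧ UT.seed = Sfun T ∧ UT.temp = τ' ∧
          ValidRep T.tileset (Rfun T) ∧ Simulates UT T (Rfun T) m := by
  choose W te U S using IU.exists_sys
  refine ⟨IU.USet IU.R1 IU.R2, 2, by norm_num, fun T => IU.Rf (W T) (te T), fun T => (U T).seed, fun T => ?_⟩
  refine ⟨U T, IU.msc (W T), ?_, (S T).tiles, rfl, (S T).temp, IU.valid_rep (S T).rel, (S T).simulates⟩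
  have := IU.K_pos (W T)
  simp only [IU.msc]; omega
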